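/- Strengthened one-sided counting in random subgraphs (Theorem 2.1): Let H be an arbitrary graph. For every subgraph H' ⊆ H and every d > 0, there exist ε, ξ, b, C > 0 and an integer n₀ such that if n ≥ n₀ and p ≥ C n^{−1/m₂(H)}, then the following holds: for every G ∈ 𝒢_ℓ(H,n,d,ε), with probability at least 1 − exp(−b p n²), the random subgraph G_p has the property that every subgraph G' of G_p belonging to 𝒢_ℓ(H,n,dp,ε) satisfies |𝒞(H,G;H',G')| ≥ ξ p^{e(H')} n^{v(H)}. -/

import Mathlib

open Finset Filter
open scoped Classical

/-- Number of ordered pairs `(x, y) ∈ X × Y` with `x` adjacent to `y` in `G`. -/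
noncomputable def edgesBetween {V : Type} (G : SimpleGraph V) (X Y : Finset V) : ℕ :=
  ((X ×ˢ Y).filter fun pq => G.Adj pq.1 pq.2).card

/-- Edge density between `X` and `Y`. -/
noncomputable def density {V : Type} (G : SimpleGraph V) (X Y : Finset V) : ℝ :=
  (edgesBetween G X Y : ℝ) / ((X.card : ℝ) * (Y.card : ℝ))

/-- The pair `(A, B)` is `(ε, p)`-regular in `G`. -/
def IsRegularPair {V : Type} (G : SimpleGraph V) (A B : Finset V) (ε p : ℝ) : Prop :=
  ∀ A' ⊆ A, ∀ B' ⊆ B, ε * A.card ≤ A'.card → ε * B.card ≤ B'.card →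
    |density G A' B' - density G A B| ≤ ε * p

/-- The pair `(A, B)` is `(ε, d)`-lower-regular in `G`. -/
def IsLowerRegularPair {V : Type} (G : SimpleGraph V) (A B : Finset V) (ε d : ℝ) : Prop :=
  ∀ A' ⊆ A, ∀ B' ⊆ B, ε * A.card ≤ A'.card → ε * B.card ≤ B'.card →
    d ≤ density G A' B'

/-- Number of edges of `H` with both endpoints in `S`. -/
noncomputable def edgesWithin {V : Type} (H : SimpleGraph V) (S : Finset V) : ℕ :=
  {e ∈ H.edgeSet | ∀ v ∈ e, v ∈ S}.ncard

/-- Number of edges of `H`. -/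
noncomputable def edgeCount {V : Type} (H : SimpleGraph V) : ℕ := H.edgeSet.ncard

/-- The 2-density `m₂(H)`. -/
noncomputable def twoDensity {k : ℕ} (H : SimpleGraph (Fin k)) : ℝ :=
  max (1/2) (sSup {x : ℝ | ∃ S : Finset (Fin k), 3 ≤ S.card ∧
    x = ((edgesWithin H S : ℝ) - 1) / ((S.card : ℝ) - 2)})

/-- `H` is strictly balanced: every proper subgraph has strictly smaller 2-density. -/
def StrictlyBalanced {k : ℕ} (H : SimpleGraph (Fin k)) : Prop :=
  ∀ H' : SimpleGraph (Fin k), H' ≤ H → H' ≠ H → twoDensity H' < twoDensity H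

/-- `G` contains a copy of `H`. -/
def ContainsCopy {V W : Type} (H : SimpleGraph V) (G : SimpleGraph W) : Prop :=
  ∃ f : V → W, Function.Injective f ∧ ∀ a b, H.Adj a b → G.Adj (f a) (f b)

/-- Number of canonical copies of `H` in `G` w.r.t. the parts `P`. -/
noncomputable def canonicalCount {k : ℕ} {W : Type} (H : SimpleGraph (Fin k))
    (G : SimpleGraph W) (P : Fin k → Finset W) : ℕ :=
  {f : Fin k → W | (∀ i, f i ∈ P i) ∧ ∀ i j, H.Adj i j → G.Adj (f i) (f j)}.ncard

/-- Probability that `G_{n,p}` satisfies the predicate `P`. -/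
noncomputable def gnpProb (n : ℕ) (p : ℝ) (P : SimpleGraph (Fin n) → Prop) : ℝ :=
  ∑ G ∈ Finset.univ.filter P, p ^ edgeCount G * (1 - p) ^ (n.choose 2 - edgeCount G)

/-- Probability that the `p`-random subgraph `G_p` of `G` satisfies the predicate `P`. -/
noncomputable def subgraphProb {V : Type} [Fintype V] [DecidableEq V] (G : SimpleGraph V)
    (p : ℝ) (P : SimpleGraph V → Prop) : ℝ :=
  ∑ G' ∈ Finset.univ.filter (fun G' => G' ≤ G ∧ P G'),
    p ^ edgeCount G' * (1 - p) ^ (edgeCount G - edgeCount G')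

/-- The chromatic number of `H`, as a natural number. -/
noncomputable def chrom {k : ℕ} (H : SimpleGraph (Fin k)) : ℕ := H.chromaticNumber.toNat

/-- The edges of `H`, each represented once as an ordered pair `(i, j)` with `i < j`. -/
noncomputable def hPairs {k : ℕ} (H : SimpleGraph (Fin k)) : Finset (Fin k × Fin k) :=
  Finset.univ.filter fun ij => H.Adj ij.1 ij.2 ∧ ij.1 < ij.2

/-- Membership in `𝒢(H, n, m, p, ε)` (with parts `P`, inside ambient vertex type). -/
def InG {k N : ℕ} (H : SimpleGraph (Fin k)) (G : SimpleGraph (Fin N))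
    (P : Fin k → Finset (Fin N)) (n m : ℕ) (p ε : ℝ) : Prop :=
  (∀ i j, i ≠ j → Disjoint (P i) (P j)) ∧
  (∀ i, (P i).card = n) ∧
  (∀ u v, G.Adj u v → ∃ i j, H.Adj i j ∧ u ∈ P i ∧ v ∈ P j) ∧
  (∀ i j, H.Adj i j → IsRegularPair G (P i) (P j) ε p) ∧
  (∀ i j, H.Adj i j → edgesBetween G (P i) (P j) = m)

/-- Membership in `𝒢_ℓ(H, n, d, ε)` (lower-regular pairs, parts `P` covering the vertex set). -/
def InGl {k : ℕ} {W : Type} (H : SimpleGraph (Fin k)) (G : SimpleGraph W)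
    (P : Fin k → Finset W) (n : ℕ) (d ε : ℝ) : Prop :=
  (∀ i j, i ≠ j → Disjoint (P i) (P j)) ∧
  (∀ i, (P i).card = n) ∧
  (∀ v, ∃ i, v ∈ P i) ∧
  (∀ u v, G.Adj u v → ∃ i j, H.Adj i j ∧ u ∈ P i ∧ v ∈ P j) ∧
  (∀ i j, H.Adj i j → IsLowerRegularPair G (P i) (P j) ε d)

/-- `|𝒞(H,G;H',G')|`: canonical copies of `H` in `G` whose `H'`-edges lie in `G'`. -/
noncomputable def restrictedCount {k : ℕ} {W : Type} (H : SimpleGraph (Fin k))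
    (G : SimpleGraph W) (H' : SimpleGraph (Fin k)) (G' : SimpleGraph W)
    (P : Fin k → Finset W) : ℕ :=
  {f : Fin k → W | (∀ i, f i ∈ P i) ∧ (∀ i j, H.Adj i j → G.Adj (f i) (f j)) ∧
    (∀ i j, H'.Adj i j → G'.Adj (f i) (f j))}.ncard

/-- Number of copies of `H` in `G`, i.e. subgraphs of `G` isomorphic to `H`. -/
noncomputable def copyCount {k : ℕ} {W : Type} (H : SimpleGraph (Fin k))
    (G : SimpleGraph W) : ℕ :=
  {G' : G.Subgraph | Nonempty (G'.coe ≃g H)}.ncard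

/-- Number of `k`-cliques of `G`. -/
noncomputable def cliqueCount {V : Type} (k : ℕ) (G : SimpleGraph V) : ℕ :=
  {s : Finset V | G.IsNClique k s}.ncard

/-- `g_k(ρ, n)`: minimum number of `K_k`s in an `n`-vertex graph with at least `ρ·C(n,2)` edges. -/
noncomputable def gkn (k n : ℕ) (ρ : ℝ) : ℕ :=
  sInf {m : ℕ | ∃ G : SimpleGraph (Fin n),
    ρ * (n.choose 2 : ℝ) ≤ (edgeCount G : ℝ) ∧ cliqueCount k G = m}

/-- The clique density function `g_k(ρ) = lim_{n → ∞} g_k(ρ, n)/C(n,k)`. -/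
noncomputable def gk (k : ℕ) (ρ : ℝ) : ℝ :=
  limUnder atTop (fun n => (gkn k n ρ : ℝ) / (n.choose k : ℝ))

/-- `G` is `(η, p, D)`-upper-uniform. -/
def UpperUniform {V : Type} [Fintype V] (G : SimpleGraph V) (η p D : ℝ) : Prop :=
  ∀ U₁ U₂ : Finset V, Disjoint U₁ U₂ →
    η * (Fintype.card V : ℝ) ≤ U₁.card → η * (Fintype.card V : ℝ) ≤ U₂.card →
    density G U₁ U₂ ≤ D * p

/-- `G` is `(η, p, D)`-upper-uniform, also for edges inside a single set. -/
def UpperUniform' {V : Type} [Fintype V] (G : SimpleGraph V) (η p D : ℝ) : Prop :=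
  UpperUniform G η p D ∧
  ∀ U : Finset V, η * (Fintype.card V : ℝ) ≤ U.card →
    (edgesWithin G U : ℝ) ≤ D * p * (U.card.choose 2 : ℝ)

/-- `H` is a star forest. -/
def IsStarForest {V : Type} (H : SimpleGraph V) : Prop :=
  ∃ c : V → V, ∀ u v, H.Adj u v → c u = c v ∧ (c u = u ∨ c u = v)

/-- `G` is `(H, r)`-Ramsey. -/
def IsRamsey {k n : ℕ} (H : SimpleGraph (Fin k)) (r : ℕ) (G : SimpleGraph (Fin n)) : Prop :=
  ∀ col : Sym2 (Fin n) → Fin r, ∃ c : Fin r, ∃ f : Fin k → Fin n, Function.Injective f ∧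
    ∀ a b, H.Adj a b → G.Adj (f a) (f b) ∧ col s(f a, f b) = c

/-- `G` is `(H, ε)`-Turán. -/
def IsTuran {k n : ℕ} (H : SimpleGraph (Fin k)) (ε : ℝ) (G : SimpleGraph (Fin n)) : Prop :=
  ∀ G' : SimpleGraph (Fin n), G' ≤ G →
    (1 - 1 / ((chrom H : ℝ) - 1) + ε) * (edgeCount G : ℝ) ≤ (edgeCount G' : ℝ) →
    ContainsCopy H G'

/-- The normalized homomorphism count `μ_H(G)`. -/
noncomputable def muH {k N : ℕ} (H : SimpleGraph (Fin k)) (G : SimpleGraph (Fin N)) : ℝ :=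
  (∑ f : Fin k → Fin N, ∏ ij ∈ hPairs H, (if G.Adj (f ij.1) (f ij.2) then (1:ℝ) else 0))
    / (N : ℝ) ^ k

/-- Membership in `H*(V₁, …, V_k)`: all edges lie between pairs `Vᵢ, Vⱼ` with `ij ∈ E(H)`. -/
def InHstar {k N : ℕ} (H : SimpleGraph (Fin k)) (G : SimpleGraph (Fin N))
    (P : Fin k → Finset (Fin N)) : Prop :=
  ∀ u v, G.Adj u v → ∃ i j, H.Adj i j ∧ u ∈ P i ∧ v ∈ P j

/-- The normalized canonical homomorphism count `μ*_H(G)`. -/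
noncomputable def muHstar {k N : ℕ} (H : SimpleGraph (Fin k)) (G : SimpleGraph (Fin N))
    (P : Fin k → Finset (Fin N)) : ℝ :=
  (∑ f ∈ Finset.univ.filter (fun f : Fin k → Fin N => ∀ i, f i ∈ P i),
    ∏ ij ∈ hPairs H, (if G.Adj (f ij.1) (f ij.2) then (1:ℝ) else 0)) / (N : ℝ) ^ k

set_option linter.unusedSectionVars false
set_option linter.unusedVariables false

section prob
variable {E : Type} [Fintype E] [DecidableEq E]

/-- weight of a set in the `p`-random subset model -/
noncomputable def wt (p : ℝ) (Γ : Finset E) : ℝ := ∏ e, if e ∈ Γ then p else 1 - p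

/-- probability of an event in the `p`-random subset model -/
noncomputable def Pr (p : ℝ) (Ev : Finset E → Prop) : ℝ :=
  ∑ Γ : Finset E, if Ev Γ then wt p Γ else 0

lemma sum_prod_ite (a b : E → ℝ) :
    ∑ Γ : Finset E, ∏ e, (if e ∈ Γ then a e else b e) = ∏ e, (a e + b e) := by
  rw [Finset.prod_add, Finset.powerset_univ]
  refine Finset.sum_congr rfl fun Γ _ => ?_
  rw [← Finset.prod_mul_prod_compl Γ]
  congr 1
  · exact Finset.prod_congr rfl fun e he => by simp [he]
  · rw [Finset.compl_eq_univ_sdiff]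
    refine Finset.prod_congr rfl fun e he => ?_
    have : e ∉ Γ := by simpa using he
    simp [this]

lemma wt_nonneg {p : ℝ} (h0 : 0 ≤ p) (h1 : p ≤ 1) (Γ : Finset E) : 0 ≤ wt p Γ := by
  refine Finset.prod_nonneg fun e _ => ?_
  split_ifs <;> linarith

lemma sum_wt (p : ℝ) : ∑ Γ : Finset E, wt p Γ = 1 := by
  unfold wt
  rw [sum_prod_ite]
  simp

lemma Pr_nonneg {p : ℝ} (h0 : 0 ≤ p) (h1 : p ≤ 1) (Ev : Finset E → Prop) : 0 ≤ Pr p Ev := by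
  refine Finset.sum_nonneg fun Γ _ => ?_
  split_ifs
  · exact wt_nonneg h0 h1 Γ
  · exact le_rfl

lemma Pr_mono {p : ℝ} (h0 : 0 ≤ p) (h1 : p ≤ 1) {Ev Ev' : Finset E → Prop}
    (h : ∀ Γ, Ev Γ → Ev' Γ) : Pr p Ev ≤ Pr p Ev' := by
  refine Finset.sum_le_sum fun Γ _ => ?_
  have := wt_nonneg h0 h1 Γ
  by_cases h' : Ev Γ
  · simp [h', h Γ h']
  · simp only [h', if_false]
    split_ifs <;> linarith

lemma Pr_or_le {p : ℝ} (h0 : 0 ≤ p) (h1 : p ≤ 1) (Ev Ev' : Finset E → Prop) :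
    Pr p (fun Γ => Ev Γ ∨ Ev' Γ) ≤ Pr p Ev + Pr p Ev' := by
  unfold Pr
  rw [← Finset.sum_add_distrib]
  refine Finset.sum_le_sum fun Γ _ => ?_
  have := wt_nonneg h0 h1 Γ
  by_cases h : Ev Γ <;> by_cases h' : Ev' Γ <;> simp [h, h', this]

lemma Pr_false (p : ℝ) : Pr p (fun _ : Finset E => False) = 0 := by
  simp [Pr]

/-- Markov-type bound -/
lemma Pr_le_sum {p : ℝ} (h0 : 0 ≤ p) (h1 : p ≤ 1) (Ev : Finset E → Prop) (g : Finset E → ℝ)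
    (hg : ∀ Γ, 0 ≤ g Γ) (h : ∀ Γ, Ev Γ → 1 ≤ g Γ) : Pr p Ev ≤ ∑ Γ, wt p Γ * g Γ := by
  refine Finset.sum_le_sum fun Γ _ => ?_
  have := wt_nonneg h0 h1 Γ
  split_ifs with h'
  · nlinarith [h Γ h']
  · exact mul_nonneg this (hg Γ)

lemma Pr_compl (p : ℝ) (Ev : Finset E → Prop) : Pr p (fun Γ => ¬ Ev Γ) = 1 - Pr p Ev := by
  rw [eq_sub_iff_add_eq, ← sum_wt (E := E) p]
  unfold Pr
  rw [← Finset.sum_add_distrib]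
  refine Finset.sum_congr rfl fun Γ _ => ?_
  by_cases h : Ev Γ <;> simp [h]

lemma mgf (p l : ℝ) (Q : Finset E) :
    ∑ Γ : Finset E, wt p Γ * l ^ (Γ ∩ Q).card = (1 - p + p * l) ^ Q.card := by
  have h1 : ∀ Γ : Finset E, wt p Γ * l ^ (Γ ∩ Q).card
      = ∏ e, (if e ∈ Γ then (if e ∈ Q then p * l else p) else 1 - p) := by
    intro Γ
    have : l ^ (Γ ∩ Q).card = ∏ e, (if e ∈ Γ then (if e ∈ Q then l else 1) else 1) := by
      have h2 : l ^ (Γ ∩ Q).card = ∏ e, (if e ∈ Γ ∩ Q then l else 1) := by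
        rw [Finset.prod_ite_mem]; simp
      rw [h2]
      refine Finset.prod_congr rfl fun e _ => ?_
      by_cases h : e ∈ Γ <;> simp [h]
    rw [this, wt, ← Finset.prod_mul_distrib]
    refine Finset.prod_congr rfl fun e _ => ?_
    split_ifs <;> simp
  simp_rw [h1]
  rw [sum_prod_ite]
  have : ∀ e ∈ (univ : Finset E), ((if e ∈ Q then p * l else p) + (1 - p))
      = if e ∈ Q then (1 - p + p * l) else 1 := by
    intro e _
    split_ifs <;> ring
  rw [Finset.prod_congr rfl this, Finset.prod_ite_mem]
  simp

lemma Pr_superset (p : ℝ) (T : Finset E) : Pr p (fun Γ => T ⊆ Γ) = p ^ T.card := by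
  have h1 : Pr p (fun Γ => T ⊆ Γ)
      = ∑ Γ : Finset E, ∏ e, (if e ∈ Γ then p else (if e ∈ T then 0 else 1 - p)) := by
    refine Finset.sum_congr rfl fun Γ _ => ?_
    split_ifs with h
    · refine Finset.prod_congr rfl fun e _ => ?_
      by_cases he : e ∈ Γ
      · simp [he]
      · have : e ∉ T := fun h' => he (h h')
        simp [he, this]
    · obtain ⟨e, he, he'⟩ := Finset.not_subset.1 h
      symm
      apply Finset.prod_eq_zero (Finset.mem_univ e)
      simp [he, he']
  rw [h1, sum_prod_ite]
  have : ∀ e ∈ (univ : Finset E), (p + (if e ∈ T then 0 else 1 - p))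
      = if e ∈ T then p else 1 := by
    intro e _
    split_ifs <;> ring
  rw [Finset.prod_congr rfl this, Finset.prod_ite_mem]
  simp

/-- law of the union of two independent random sets, with the conditional law of the first -/
lemma union_law (p1 p2 p q l : ℝ) (hp : 1 - p = (1 - p1) * (1 - p2)) (hq : q * p = p1)
    (Γ M : Finset E) (hM : M ⊆ Γ) :
    ∑ x : Finset E × Finset E, (if x.1 ∪ x.2 = Γ then
      wt p1 x.1 * wt p2 x.2 * l ^ (x.1 ∩ M).card else 0)
      = wt p Γ * (1 - q + q * l) ^ M.card := by
  rw [Fintype.sum_prod_type]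
  have key : ∀ Γ1 Γ2 : Finset E, (if Γ1 ∪ Γ2 = Γ then
      wt p1 Γ1 * wt p2 Γ2 * l ^ (Γ1 ∩ M).card else 0) =
      ∏ e, (if e ∈ Γ2 then
        (if e ∈ Γ1 then (if e ∈ Γ then p1 * p2 * (if e ∈ M then l else 1) else 0)
          else (if e ∈ Γ then (1 - p1) * p2 else 0))
        else (if e ∈ Γ1 then (if e ∈ Γ then p1 * (1 - p2) * (if e ∈ M then l else 1) else 0)
          else (if e ∈ Γ then 0 else (1 - p1) * (1 - p2)))) := by
    intro Γ1 Γ2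
    split_ifs with h
    · have : l ^ (Γ1 ∩ M).card = ∏ e, (if e ∈ Γ1 ∩ M then l else 1) := by
        rw [Finset.prod_ite_mem]; simp
      rw [this, wt, wt, ← Finset.prod_mul_distrib, ← Finset.prod_mul_distrib]
      refine Finset.prod_congr rfl fun e _ => ?_
      subst h
      by_cases h1 : e ∈ Γ1 <;> by_cases h2 : e ∈ Γ2 <;> by_cases h3 : e ∈ M <;>
        simp [h1, h2, h3]
    · have : ∃ e, ¬ (e ∈ Γ1 ∪ Γ2 ↔ e ∈ Γ) := by
        by_contra hcon
        push Not at hcon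
        exact h (Finset.ext hcon)
      obtain ⟨e, he⟩ := this
      symm
      apply Finset.prod_eq_zero (Finset.mem_univ e)
      by_cases h1 : e ∈ Γ1 <;> by_cases h2 : e ∈ Γ2 <;> by_cases h3 : e ∈ Γ <;>
        simp_all
  simp_rw [key]
  have key2 : ∀ Γ1 : Finset E, ∑ Γ2 : Finset E, 
      ∏ e, (if e ∈ Γ2 then
        (if e ∈ Γ1 then (if e ∈ Γ then p1 * p2 * (if e ∈ M then l else 1) else 0)
          else (if e ∈ Γ then (1 - p1) * p2 else 0))
        else (if e ∈ Γ1 then (if e ∈ Γ then p1 * (1 - p2) * (if e ∈ M then l else 1) else 0)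
          else (if e ∈ Γ then 0 else (1 - p1) * (1 - p2)))) = 
      ∏ e, (if e ∈ Γ1 then (if e ∈ Γ then p1 * (if e ∈ M then l else 1) else 0)
        else (if e ∈ Γ then (1 - p1) * p2 else (1 - p1) * (1 - p2))) := by
    intro Γ1
    rw [sum_prod_ite (fun e => (if e ∈ Γ1 then (if e ∈ Γ then p1 * p2 * (if e ∈ M then l else 1) else 0)
          else (if e ∈ Γ then (1 - p1) * p2 else 0))) 
          (fun e => (if e ∈ Γ1 then (if e ∈ Γ then p1 * (1 - p2) * (if e ∈ M then l else 1) else 0)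
          else (if e ∈ Γ then 0 else (1 - p1) * (1 - p2))))]
    refine Finset.prod_congr rfl fun e _ => ?_
    by_cases h1 : e ∈ Γ1 <;> by_cases h2 : e ∈ Γ <;> by_cases h3 : e ∈ M <;>
        simp [h1, h2, h3] <;> ring
  simp_rw [key2]
  rw [sum_prod_ite (fun e => (if e ∈ Γ then p1 * (if e ∈ M then l else 1) else 0))]
  have : (1 - q + q * l) ^ M.card = ∏ e, (if e ∈ M then (1 - q + q * l) else 1) := by
    rw [Finset.prod_ite_mem]; simp
  rw [this, wt, ← Finset.prod_mul_distrib]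
  refine Finset.prod_congr rfl fun e _ => ?_
  by_cases h2 : e ∈ Γ
  · by_cases h3 : e ∈ M
    · simp only [h2, h3, if_true]
      rw [← hq] at hp ⊢
      linear_combination hp
    · simp only [h2, h3, if_true, if_false]
      linear_combination hp
  · have h3 : e ∉ M := fun h => h2 (hM h)
    simp [h2, h3, hp]

/-- marginal law on a subset -/
lemma Pr_marginal (p : ℝ) (L : Finset E) (Ev : Finset E → Prop) :
    Pr p (fun Γ => Ev (Γ ∩ L)) =
      ∑ T ∈ L.powerset, if Ev T then p ^ T.card * (1 - p) ^ (L.card - T.card) else 0 := by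
  unfold Pr
  rw [← Finset.sum_fiberwise_of_maps_to (s := univ) (t := L.powerset) (g := fun Γ => Γ ∩ L)
    (fun Γ _ => by simp)]
  refine Finset.sum_congr rfl fun T hT => ?_
  rw [Finset.mem_powerset] at hT
  have h1 : ∑ Γ ∈ univ.filter (fun Γ : Finset E => Γ ∩ L = T), (if Ev (Γ ∩ L) then wt p Γ else 0)
     = ∑ Γ ∈ univ.filter (fun Γ : Finset E => Γ ∩ L = T), (if Ev T then wt p Γ else 0) :=
    Finset.sum_congr rfl fun Γ hΓ => by rw [(Finset.mem_filter.1 hΓ).2]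
  rw [h1]
  split_ifs with hE
  swap
  · simp
  rw [Finset.sum_filter]
  have h2 : ∀ Γ : Finset E, (if Γ ∩ L = T then wt p Γ else 0) = 
      ∏ e, (if e ∈ Γ then (if e ∈ L then (if e ∈ T then p else 0) else p)
        else (if e ∈ T then 0 else 1 - p)) := by
    intro Γ
    split_ifs with h
    · refine Finset.prod_congr rfl fun e _ => ?_
      subst h
      by_cases h1 : e ∈ Γ <;> by_cases h2 : e ∈ L <;> simp [h1, h2]
    · have : ∃ e, ¬ (e ∈ Γ ∩ L ↔ e ∈ T) := by
        by_contra hcon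
        push Not at hcon
        exact h (Finset.ext hcon)
      obtain ⟨e, he⟩ := this
      symm
      apply Finset.prod_eq_zero (Finset.mem_univ e)
      have := @hT e
      by_cases h1 : e ∈ Γ <;> by_cases h2 : e ∈ L <;> by_cases h3 : e ∈ T <;> simp_all
  simp_rw [h2]
  rw [sum_prod_ite (fun e => (if e ∈ L then (if e ∈ T then p else 0) else p))]
  have h3 : ∀ e ∈ (univ : Finset E), ((if e ∈ L then (if e ∈ T then p else 0) else p) + 
      (if e ∈ T then 0 else 1 - p)) = (if e ∈ T then p else 1) * (if e ∈ L \ T then (1 - p) else 1) := by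
    intro e _
    have := @hT e
    by_cases h2 : e ∈ L <;> by_cases h3 : e ∈ T <;> simp_all
  rw [Finset.prod_congr rfl h3, Finset.prod_mul_distrib, Finset.prod_ite_mem, Finset.prod_ite_mem]
  simp [Finset.card_sdiff_of_subset hT]

end prob

section deletion
variable {E : Type} [Fintype E] [DecidableEq E] {ι : Type}

/-- number of sequences of `r` disjoint hyperedges inside `Γ`, avoiding `D` -/
noncomputable def MM (I : Finset ι) (h : ι → Finset E) (Γ : Finset E) : ℕ → Finset E → ℝ
  | 0, _ => 1
  | r + 1, D => ∑ i ∈ I, if (h i ⊆ Γ ∧ Disjoint (h i) D) then MM I h Γ r (D ∪ h i) else 0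

lemma MM_nonneg (I : Finset ι) (h : ι → Finset E) (Γ : Finset E) (r : ℕ) :
    ∀ D : Finset E, 0 ≤ MM I h Γ r D := by
  induction r with
  | zero => intro D; simp [MM]
  | succ r ih =>
    intro D
    refine Finset.sum_nonneg fun i _ => ?_
    split_ifs
    · exact ih _
    · exact le_rfl

lemma MM_upper (I : Finset ι) (h : ι → Finset E) {p μ : ℝ} (h0 : 0 ≤ p) (h1 : p ≤ 1)
    (hμ : ∑ i ∈ I, p ^ (h i).card ≤ μ) (r : ℕ) : ∀ D : Finset E,
    ∑ Γ : Finset E, (if D ⊆ Γ then wt p Γ * MM I h Γ r D else 0) ≤ p ^ D.card * μ ^ r := by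
  have hμ0 : 0 ≤ μ := le_trans (Finset.sum_nonneg fun i _ => pow_nonneg h0 _) hμ
  induction r with
  | zero =>
    intro D
    have := Pr_superset p D
    simp only [MM, mul_one, pow_zero]
    rw [← this]
    unfold Pr
    refine le_of_eq (Finset.sum_congr rfl fun Γ _ => ?_)
    split_ifs <;> rfl
  | succ r ih =>
    intro D
    have step : ∀ Γ : Finset E, (if D ⊆ Γ then wt p Γ * MM I h Γ (r+1) D else 0) =
        ∑ i ∈ I, if Disjoint (h i) D then
          (if D ∪ h i ⊆ Γ then wt p Γ * MM I h Γ r (D ∪ h i) else 0) else 0 := by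
      intro Γ
      by_cases hD : D ⊆ Γ
      · simp only [hD, if_true, MM, Finset.mul_sum]
        refine Finset.sum_congr rfl fun i _ => ?_
        by_cases h1 : h i ⊆ Γ <;> by_cases h2 : Disjoint (h i) D <;>
          simp [h1, h2, Finset.union_subset_iff, hD]
      · simp [hD, Finset.union_subset_iff]
    simp_rw [step]
    rw [Finset.sum_comm]
    calc _ ≤ ∑ i ∈ I, p ^ D.card * μ ^ r * p ^ (h i).card := by
          refine Finset.sum_le_sum fun i _ => ?_
          by_cases h2 : Disjoint (h i) D
          · simp only [h2, if_true]
            refine (ih (D ∪ h i)).trans (le_of_eq ?_)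
            rw [Finset.card_union_of_disjoint h2.symm, pow_add]
            ring
          · simp only [h2, if_false, Finset.sum_const_zero]
            positivity
      _ = p ^ D.card * μ ^ r * ∑ i ∈ I, p ^ (h i).card := by rw [Finset.mul_sum]
      _ ≤ p ^ D.card * μ ^ r * μ := by gcongr
      _ = _ := by ring

lemma MM_lower (I : Finset ι) (h : ι → Finset E) (Γ : Finset E) {μ : ℝ} (hμ : 0 ≤ μ) (s t : ℕ)
    (hs : ∀ i ∈ I, (h i).card ≤ s)
    (hΓ : ∀ D : Finset E, D.card ≤ t →
      2 * μ ≤ ((I.filter fun i => h i ⊆ Γ ∧ Disjoint (h i) D).card : ℝ)) (r : ℕ) :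
    ∀ D : Finset E, D.card + r * s ≤ t → (2 * μ) ^ r ≤ MM I h Γ r D := by
  induction r with
  | zero => intro D _; simp [MM]
  | succ r ih =>
    intro D hD
    have hD1 : D.card ≤ t := by nlinarith
    simp only [MM]
    rw [← Finset.sum_filter]
    calc (2 * μ) ^ (r + 1) = (2 * μ) * (2 * μ) ^ r := by ring
      _ ≤ ((I.filter fun i => h i ⊆ Γ ∧ Disjoint (h i) D).card : ℝ) * (2 * μ) ^ r := by
          gcongr
          exact hΓ D hD1
      _ = ∑ i ∈ I.filter (fun i => h i ⊆ Γ ∧ Disjoint (h i) D), (2 * μ) ^ r := by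
          rw [Finset.sum_const, nsmul_eq_mul]
      _ ≤ _ := by
          refine Finset.sum_le_sum fun i hi => ?_
          apply ih
          rw [Finset.mem_filter] at hi
          have := Finset.card_union_le D (h i)
          have := hs i hi.1
          nlinarith

lemma deletion (I : Finset ι) (h : ι → Finset E) {p μ : ℝ} (h0 : 0 ≤ p) (h1 : p ≤ 1)
    (hμ0 : 0 < μ) (hμ : ∑ i ∈ I, p ^ (h i).card ≤ μ) (s t r : ℕ)
    (hs : ∀ i ∈ I, (h i).card ≤ s) (hr : r * s ≤ t) :
    Pr p (fun Γ => ∀ D : Finset E, D.card ≤ t →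
      2 * μ ≤ ((I.filter fun i => h i ⊆ Γ ∧ Disjoint (h i) D).card : ℝ)) ≤ (1 / 2) ^ r := by
  refine (Pr_le_sum h0 h1 _ (fun Γ => MM I h Γ r ∅ / (2 * μ) ^ r) ?_ ?_).trans ?_
  · intro Γ
    exact div_nonneg (MM_nonneg _ _ _ _ _) (by positivity)
  · intro Γ hΓ
    rw [le_div_iff₀ (by positivity), one_mul]
    exact MM_lower I h Γ hμ0.le s t hs hΓ r ∅ (by simpa using hr)
  · have := MM_upper I h h0 h1 hμ r ∅
    simp only [Finset.empty_subset, if_true, Finset.card_empty, pow_zero, one_mul] at this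
    simp_rw [← mul_div_assoc]
    rw [← Finset.sum_div, div_le_iff₀ (by positivity), ← mul_pow]
    refine this.trans (le_of_eq ?_)
    congr 1
    ring

lemma upper_tail {p y : ℝ} (h0 : 0 ≤ p) (h1 : p ≤ 1) (Q : Finset E) :
    Pr p (fun Γ => y ≤ ((Γ ∩ Q).card : ℝ)) ≤ Real.exp (p * Q.card - y * (1/2)) := by
  refine (Pr_le_sum h0 h1 _ (fun Γ => (2:ℝ) ^ (Γ ∩ Q).card * Real.exp (- (y * (1/2)))) ?_ ?_).trans ?_
  · intro Γ; positivity
  · intro Γ hΓ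
    have e1 : Real.exp (1/2) ≤ 2 := by
      have h2 := Real.exp_one_lt_d9
      have h3 : Real.exp (1/2) * Real.exp (1/2) = Real.exp 1 := by
        rw [← Real.exp_add]; norm_num
      nlinarith [Real.exp_pos (1/2)]
    calc (1:ℝ) = Real.exp (y * (1/2)) * Real.exp (- (y * (1/2))) := by
          rw [← Real.exp_add]; simp
      _ ≤ Real.exp ((Γ ∩ Q).card * (1/2)) * Real.exp (- (y * (1/2))) := by gcongr
      _ = (Real.exp (1/2)) ^ (Γ ∩ Q).card * Real.exp (- (y * (1/2))) := by
          rw [Real.exp_nat_mul]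
      _ ≤ _ := by gcongr
  · simp_rw [← mul_assoc]
    rw [← Finset.sum_mul, mgf]
    rw [sub_eq_add_neg (p * (Q.card:ℝ)), Real.exp_add]
    gcongr
    rw [mul_comm p (Q.card : ℝ), Real.exp_nat_mul]
    apply pow_le_pow_left₀
    · linarith
    · linarith [Real.add_one_le_exp p]

/-- exponent in the lower tail bound -/
noncomputable def kap (ρ : ℝ) : ℝ := (1 - (1 + ρ) / 2) * (1 - ρ / ((1 + ρ) / 2))

lemma kap_pos {ρ : ℝ} (h0 : 0 < ρ) (h1 : ρ < 1) : 0 < kap ρ := by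
  unfold kap
  apply mul_pos
  · linarith
  · rw [sub_pos, div_lt_one (by linarith)]
    linarith

lemma lower_tail {J : Type} [Fintype J] (ν : J → ℝ) (R : J → Finset E) (w q : ℝ)
    (hν : ∀ i, 0 ≤ ν i) (hw : 0 ≤ w) (hq0 : 0 ≤ q) (hq1 : q ≤ 1) (M : Finset E)
    (hmgf : ∀ l, ∑ i, ν i * l ^ (R i ∩ M).card = w * (1 - q + q * l) ^ M.card)
    {ρ z : ℝ} (h0 : 0 < ρ) (h1 : ρ < 1) (hz0 : 0 ≤ z) (hz : z ≤ M.card) :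
    ∑ i, (if ((R i ∩ M).card : ℝ) < ρ * q * z then ν i else 0) ≤ w * Real.exp (- (kap ρ * q * z)) := by
  set l : ℝ := (1 + ρ) / 2 with hl
  have hl0 : 0 < l := by rw [hl]; linarith
  have hl1 : l < 1 := by rw [hl]; linarith
  have step : ∀ i, (if ((R i ∩ M).card : ℝ) < ρ * q * z then ν i else 0) ≤
      (ν i * l ^ (R i ∩ M).card) * Real.exp (- (Real.log l * (ρ * q * z))) := by
    intro i
    split_ifs with h
    · rw [mul_assoc]
      apply le_mul_of_one_le_right (hν i)
      have : l ^ (R i ∩ M).card = Real.exp (Real.log l * (R i ∩ M).card) := by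
        rw [mul_comm, Real.exp_nat_mul, Real.exp_log hl0]
      rw [this, ← Real.exp_add]
      apply Real.one_le_exp
      have := Real.log_neg hl0 hl1
      nlinarith
    · have := hν i; positivity
  refine (Finset.sum_le_sum fun i _ => step i).trans ?_
  rw [← Finset.sum_mul, hmgf, mul_assoc]
  gcongr
  have e1 : (1 - q + q * l) ^ M.card ≤ Real.exp (- (q * (1 - l)) * z) := by
    calc (1 - q + q * l) ^ M.card ≤ (Real.exp (- (q * (1 - l)))) ^ M.card := by
          apply pow_le_pow_left₀
          · nlinarith
          · have := Real.add_one_le_exp (- (q * (1 - l)))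
            linarith
      _ = Real.exp (M.card * (- (q * (1 - l)))) := by rw [Real.exp_nat_mul]
      _ ≤ _ := by
          apply Real.exp_le_exp.2
          have : 0 ≤ q * (1 - l) := mul_nonneg hq0 (by linarith)
          nlinarith
  refine (mul_le_mul_of_nonneg_right e1 (Real.exp_pos _).le).trans ?_
  rw [← Real.exp_add]
  apply Real.exp_le_exp.2
  have e2 : - Real.log l ≤ 1 / l - 1 := by
    have := Real.log_le_sub_one_of_pos (inv_pos.2 hl0)
    rw [Real.log_inv] at this
    simpa using this
  have e3 : - (Real.log l * (ρ * q * z)) ≤ (1 / l - 1) * (ρ * q * z) := by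
    have : 0 ≤ ρ * q * z := by positivity
    nlinarith
  have e4 : kap ρ * q * z = (1 - l) * q * z - (1 / l - 1) * (ρ * q * z) := by
    unfold kap
    rw [← hl]
    field_simp
  rw [e4]
  linarith
end deletion

section model
variable {k : ℕ} {W : Type}

/-- labelled edges -/
abbrev Lab (k : ℕ) (W : Type) : Type := (Fin k × Fin k) × (W × W)

/-- number of `a`-labelled edges of `S` between `U` and `V` -/
noncomputable def ee (S : Finset (Lab k W)) (a : Fin k × Fin k) (U V : Finset W) : ℕ :=
  ((U ×ˢ V).filter fun x => (a, x) ∈ S).card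

/-- lower regularity for labels in `F`, with absolute threshold `m` and density `δ` -/
def LR (F : Finset (Fin k × Fin k)) (S : Finset (Lab k W)) (X : Fin k → Finset W) (m δ : ℝ) : Prop :=
  ∀ a ∈ F, ∀ U ⊆ X a.1, ∀ V ⊆ X a.2, m ≤ U.card → m ≤ V.card →
    δ * ((U.card : ℝ) * V.card) ≤ ee S a U V

/-- canonical copies of `A` in `G` with the `F`-edges in `S` -/
noncomputable def cop [Fintype W] (X : Fin k → Finset W) (A : Finset (Fin k × Fin k))
    (G : Finset (Lab k W)) (F : Finset (Fin k × Fin k)) (S : Finset (Lab k W)) :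
    Finset (Fin k → W) :=
  univ.filter fun f => (∀ i, f i ∈ X i) ∧ (∀ a ∈ A, (a, (f a.1, f a.2)) ∈ G) ∧
    ∀ a ∈ F, (a, (f a.1, f a.2)) ∈ S

lemma ee_mono {S T : Finset (Lab k W)} (h : S ⊆ T) (a : Fin k × Fin k) (U V : Finset W) :
    ee S a U V ≤ ee T a U V := by
  apply Finset.card_le_card
  intro x hx
  rw [Finset.mem_filter] at hx ⊢
  exact ⟨hx.1, h hx.2⟩

lemma LR_mono {F : Finset (Fin k × Fin k)} {S T : Finset (Lab k W)} {X : Fin k → Finset W}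
    {m m' δ δ' : ℝ} (hST : S ⊆ T) (hm : m ≤ m') (hδ : δ' ≤ δ) (h : LR F S X m δ) :
    LR F T X m' δ' := by
  intro a ha U hU V hV h1 h2
  have := h a ha U hU V hV (hm.trans h1) (hm.trans h2)
  have h3 : (ee S a U V : ℝ) ≤ ee T a U V := by exact_mod_cast ee_mono hST a U V
  have h4 : δ' * ((U.card : ℝ) * V.card) ≤ δ * ((U.card : ℝ) * V.card) := by gcongr
  linarith

/-- random sparsification of a lower-regular system stays lower-regular -/
lemma sparsify (F : Finset (Fin k × Fin k)) {ε d' d'' δ : ℝ} (hε : 0 < ε) (hd'' : 0 < d'')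
    (hd : d'' < d') (hδ : 0 < δ) : ∃ C : ℝ, 0 < C ∧ ∀ (W : Type) [Fintype W] (n : ℕ) (p q : ℝ),
    1 ≤ n → 0 < p → δ ≤ q → q ≤ 1 → C ≤ p * n → ∀ (X : Fin k → Finset W), (∀ i, (X i).card = n) →
    ∀ (S : Finset (Lab k W)), LR F S X (ε * n) (d' * p) →
    ∀ (J : Type) [Fintype J] (ν : J → ℝ) (R : J → Finset (Lab k W)) (w : ℝ),
    (∀ i, 0 ≤ ν i) → 0 ≤ w → (∀ M ⊆ S, ∀ l : ℝ,
      ∑ i, ν i * l ^ (R i ∩ M).card = w * (1 - q + q * l) ^ M.card) →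
    ∑ i, (if LR F (S ∩ R i) X (ε * n) (d'' * (q * p)) then 0 else ν i) ≤ w / 4 := by
  have hd' : 0 < d' := hd''.trans hd
  set ρ := d'' / d' with hρ
  have hρ0 : 0 < ρ := div_pos hd'' hd'
  have hρ1 : ρ < 1 := (div_lt_one hd').2 hd
  have hk := kap_pos hρ0 hρ1
  refine ⟨(F.card + 4) / (kap ρ * δ * d' * ε ^ 2), by positivity, ?_⟩
  intro W _ n p q hn hp hq hq1 hC X hX S hS J _ ν R w hν hw hmgf
  have hn' : (1:ℝ) ≤ n := by exact_mod_cast hn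
  have hq0 : 0 < q := hδ.trans_le hq
  set K : Finset ((Fin k × Fin k) × (Finset W × Finset W)) :=
    F.biUnion fun a => (((X a.1).powerset ×ˢ (X a.2).powerset).filter
      (fun z => ε * n ≤ z.1.card ∧ ε * n ≤ z.2.card)).image (fun z => (a, z)) with hK
  set Md : ((Fin k × Fin k) × (Finset W × Finset W)) → Finset (Lab k W) := fun z =>
    (((z.2.1 ×ˢ z.2.2).filter fun x => (z.1, x) ∈ S).image fun x => (z.1, x)) with hMd
  have hMdS : ∀ z, Md z ⊆ S := by
    intro z y hy
    simp only [hMd, Finset.mem_image, Finset.mem_filter] at hy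
    obtain ⟨x, hx, rfl⟩ := hy
    exact hx.2
  have hMcard : ∀ z, (Md z).card = ee S z.1 z.2.1 z.2.2 := by
    intro z
    simp only [hMd]
    rw [Finset.card_image_of_injective _ (fun x y h => (Prod.mk.inj h).2)]
    rfl
  have hRM : ∀ i z, (R i ∩ Md z).card = ee (S ∩ R i) z.1 z.2.1 z.2.2 := by
    intro i z
    have : R i ∩ Md z = (((z.2.1 ×ˢ z.2.2).filter fun x => (z.1, x) ∈ S ∩ R i).image 
        fun x => (z.1, x)) := by
      ext y
      simp only [hMd, Finset.mem_inter, Finset.mem_image, Finset.mem_filter]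
      constructor
      · rintro ⟨h1, x, hx, rfl⟩
        exact ⟨x, ⟨hx.1, hx.2, h1⟩, rfl⟩
      · rintro ⟨x, hx, rfl⟩
        exact ⟨hx.2.2, x, ⟨hx.1, hx.2.1⟩, rfl⟩
    rw [this, Finset.card_image_of_injective _ (fun x y h => (Prod.mk.inj h).2)]
    rfl
  have hKmem : ∀ z ∈ K, z.1 ∈ F ∧ z.2.1 ⊆ X z.1.1 ∧ z.2.2 ⊆ X z.1.2 ∧ ε * n ≤ z.2.1.card ∧
      ε * n ≤ z.2.2.card := by
    intro z hz
    simp only [hK, Finset.mem_biUnion, Finset.mem_image, Finset.mem_filter, Finset.mem_product,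
      Finset.mem_powerset] at hz
    obtain ⟨a, ha, y, hy, rfl⟩ := hz
    exact ⟨ha, hy.1.1, hy.1.2, hy.2.1, hy.2.2⟩
  have hterm : ∀ z ∈ K, ∑ i, (if ((R i ∩ Md z).card : ℝ) < 
      d'' * (q * p) * ((z.2.1.card : ℝ) * z.2.2.card) then ν i else 0) ≤
      w * Real.exp (- ((F.card + 4) * n)) := by
    intro z hz
    obtain ⟨h1, h2, h3, h4, h5⟩ := hKmem z hz
    have hlow := lower_tail ν R w q hν hw hq0.le hq1 (Md z) (hmgf (Md z) (hMdS z)) hρ0 hρ1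
      (z := d' * p * ((z.2.1.card : ℝ) * z.2.2.card)) (by positivity) 
      (by rw [hMcard]; exact hS z.1 h1 _ h2 _ h3 h4 h5)
    have e1 : ρ * q * (d' * p * ((z.2.1.card : ℝ) * z.2.2.card)) = 
        d'' * (q * p) * ((z.2.1.card : ℝ) * z.2.2.card) := by
      rw [hρ]; field_simp
    rw [e1] at hlow
    refine hlow.trans ?_
    refine mul_le_mul_of_nonneg_left (Real.exp_le_exp.2 (neg_le_neg ?_)) hw
    rw [div_le_iff₀ (by positivity)] at hC
    have e2 : (ε * n) * (ε * n) ≤ (z.2.1.card : ℝ) * z.2.2.card := by gcongr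
    calc ((F.card:ℝ) + 4) * n ≤ (p * n * (kap ρ * δ * d' * ε ^ 2)) * n := by gcongr
      _ = kap ρ * δ * (d' * p * ((ε * n) * (ε * n))) := by ring
      _ ≤ kap ρ * q * (d' * p * ((z.2.1.card : ℝ) * z.2.2.card)) := by gcongr
  have hcover : ∀ i, (if LR F (S ∩ R i) X (ε * n) (d'' * (q * p)) then 0 else ν i) ≤
      ∑ z ∈ K, (if ((R i ∩ Md z).card : ℝ) < 
      d'' * (q * p) * ((z.2.1.card : ℝ) * z.2.2.card) then ν i else 0) := by
    intro i
    have hnn : ∀ z ∈ K, 0 ≤ (if ((R i ∩ Md z).card : ℝ) < 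
      d'' * (q * p) * ((z.2.1.card : ℝ) * z.2.2.card) then ν i else 0) := by
      intro z _
      split_ifs
      · exact hν i
      · exact le_rfl
    split_ifs with hLR
    · exact Finset.sum_nonneg hnn
    · unfold LR at hLR
      push Not at hLR
      obtain ⟨a, ha, U, hU, V, hV, h1, h2, h3⟩ := hLR
      have hz : ((a, (U, V)) : (Fin k × Fin k) × (Finset W × Finset W)) ∈ K := by
        simp only [hK, Finset.mem_biUnion, Finset.mem_image, Finset.mem_filter, Finset.mem_product,
          Finset.mem_powerset]
        exact ⟨a, ha, (U, V), ⟨⟨hU, hV⟩, h1, h2⟩, rfl⟩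
      refine le_trans ?_ (Finset.single_le_sum hnn hz)
      rw [hRM, if_pos h3]
  have hKcard : (K.card : ℝ) ≤ F.card * 4 ^ n := by
    have : K.card ≤ ∑ a ∈ F, 4 ^ n := by
      refine Finset.card_biUnion_le.trans (Finset.sum_le_sum fun a _ => ?_)
      refine Finset.card_image_le.trans ((Finset.card_filter_le _ _).trans ?_)
      rw [Finset.card_product, Finset.card_powerset, Finset.card_powerset, hX, hX, ← mul_pow]
      norm_num
    rw [Finset.sum_const, smul_eq_mul] at this
    exact_mod_cast this
  calc _ ≤ ∑ i, ∑ z ∈ K, (if ((R i ∩ Md z).card : ℝ) < 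
      d'' * (q * p) * ((z.2.1.card : ℝ) * z.2.2.card) then ν i else 0) :=
        Finset.sum_le_sum fun i _ => hcover i
    _ = ∑ z ∈ K, ∑ i, (if ((R i ∩ Md z).card : ℝ) < 
      d'' * (q * p) * ((z.2.1.card : ℝ) * z.2.2.card) then ν i else 0) := Finset.sum_comm
    _ ≤ ∑ z ∈ K, w * Real.exp (- ((F.card + 4) * n)) := Finset.sum_le_sum hterm
    _ = K.card * (w * Real.exp (- ((F.card + 4) * n))) := by rw [Finset.sum_const, nsmul_eq_mul]
    _ ≤ (F.card * 4 ^ n) * (w * Real.exp (- ((F.card + 4) * n))) := by gcongr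
    _ = w * ((F.card * 4 ^ n) * Real.exp (- ((F.card + 4) * n))) := by ring
    _ ≤ w * (1 / 4) := by
        gcongr
        rw [Real.exp_neg, mul_inv_le_iff₀ (Real.exp_pos _)]
        have a1 : (F.card : ℝ) ≤ Real.exp (F.card * n) := by
          have := Real.add_one_le_exp ((F.card : ℝ) * n)
          have : (F.card : ℝ) * 1 ≤ F.card * n := by gcongr
          linarith
        have e4 : (4:ℝ) ≤ Real.exp 2 := by
          have := Real.quadratic_le_exp_of_nonneg (x := 2) (by norm_num)
          linarith
        have a2 : (4:ℝ) ^ n ≤ Real.exp (n * 2) := by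
          rw [Real.exp_nat_mul]; gcongr
        have a3 : (4:ℝ) ≤ Real.exp (n * 2) := e4.trans (Real.exp_le_exp.2 (by linarith))
        have a4 : Real.exp ((F.card + 4) * n) = Real.exp (F.card * n) * Real.exp (n * 2) * Real.exp (n * 2) := by
          rw [← Real.exp_add, ← Real.exp_add]; congr 1; ring
        rw [a4]
        have : (F.card : ℝ) * 4 ^ n * 4 ≤ Real.exp (F.card * n) * Real.exp (n * 2) * Real.exp (n * 2) := by
          gcongr
        linarith
    _ = w / 4 := by ring

end model

lemma p2_bounds {p δ p2 : ℝ} (hp0 : 0 < p) (hp1 : p ≤ 1) (hδ0 : 0 < δ) (hδ : δ ≤ 1 / 2)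
    (h : 1 - p = (1 - δ * p) * (1 - p2)) : p / 2 ≤ p2 ∧ p2 ≤ p := by
  have h1 : 0 < 1 - δ * p := by nlinarith
  have h2 : p2 * (1 - δ * p) = p - δ * p := by linarith
  constructor
  · by_contra hcon
    push Not at hcon
    have : p2 * (1 - δ * p) < p / 2 * (1 - δ * p) := mul_lt_mul_of_pos_right hcon h1
    nlinarith [mul_pos hδ0 hp0, mul_pos (mul_pos hδ0 hp0) hp0]
  · by_contra hcon
    push Not at hcon
    have : p * (1 - δ * p) < p2 * (1 - δ * p) := mul_lt_mul_of_pos_right hcon h1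
    nlinarith [mul_pos hδ0 hp0, mul_nonneg (mul_pos hδ0 hp0).le (sub_nonneg.2 hp1)]

lemma sum_prod_split {α β : Type} [Fintype α] [Fintype β] (f : α → ℝ) (g : β → ℝ) :
    ∑ x : α × β, f x.1 * g x.2 = (∑ x, f x) * ∑ y, g y := by
  rw [Fintype.sum_prod_type, Finset.sum_mul_sum]

lemma two_round {k : ℕ} (F : Finset (Fin k × Fin k)) {ε d' d'' δ : ℝ} (hε : 0 < ε) (hd'' : 0 < d'')
    (hd : d'' < d') (hδ : 0 < δ) (hδ2 : δ ≤ 1 / 2) : ∃ C : ℝ, 0 < C ∧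
    ∀ (W : Type) [Fintype W] (n : ℕ) (p p2 : ℝ),
    1 ≤ n → 0 < p → p ≤ 1 → C ≤ p * n → 1 - p = (1 - δ * p) * (1 - p2) →
    ∀ (X : Fin k → Finset W), (∀ i, (X i).card = n) →
    ∀ (G : Finset (Lab k W)) (bad : Finset (Lab k W) → Prop) (R1 : Finset (Lab k W) → Prop)
      (R2 : Finset (Lab k W) → Finset (Lab k W) → Prop) (x2 : ℝ),
    (∀ S, bad S → LR F S X (ε * n) (d' * p)) →
    (∀ Γ1 Γ2 S, S ⊆ Γ1 ∪ Γ2 → S ⊆ G → bad S → LR F (S ∩ Γ1) X (ε * n) (d'' * (δ * p)) →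
      LR F (S ∩ Γ2) X (ε * n) (d'' * p2) → R1 Γ1 ∨ R2 (S ∩ Γ1) Γ2) →
    (∀ T ⊆ G, Pr p2 (R2 T) ≤ x2) →
    Pr p (fun Γ => ∃ S, S ⊆ Γ ∧ S ⊆ G ∧ bad S) ≤
      2 * (Pr (δ * p) R1 + (1 + δ * p) ^ G.card * x2) := by
  obtain ⟨C, hC, hsp⟩ := sparsify F hε hd'' hd hδ
  refine ⟨C, hC, ?_⟩
  intro W _ n p p2 hn hp hp1 hCp hp2 X hX G bad R1 R2 x2 hbad hR hx2
  obtain ⟨hb1, hb2⟩ := p2_bounds hp hp1 hδ hδ2 hp2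
  have hp20 : 0 ≤ p2 := by linarith
  have hp21 : p2 ≤ 1 := by linarith
  have hp10 : 0 ≤ δ * p := by positivity
  have hp11 : δ * p ≤ 1 := by nlinarith
  let Rx : Finset (Lab k W) × Finset (Lab k W) → Prop := fun x => R1 x.1 ∨ ∃ T ∈ G.powerset, T ⊆ x.1 ∧ R2 T x.2
  have w12 : ∀ x : Finset (Lab k W) × Finset (Lab k W), 0 ≤ wt (δ * p) x.1 * wt p2 x.2 := fun x =>
    mul_nonneg (wt_nonneg hp10 hp11 _) (wt_nonneg hp20 hp21 _)
  have key : ∀ Γ : Finset (Lab k W), (∃ S, S ⊆ Γ ∧ S ⊆ G ∧ bad S) → wt p Γ / 2 ≤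
      ∑ x : Finset (Lab k W) × Finset (Lab k W), if x.1 ∪ x.2 = Γ then
        (if Rx x then wt (δ * p) x.1 * wt p2 x.2 else 0) else 0 := by
    rintro Γ ⟨S, hSΓ, hSG, hSb⟩
    have hw := wt_nonneg hp.le hp1 Γ
    let ν : Finset (Lab k W) × Finset (Lab k W) → ℝ := fun x =>
      if x.1 ∪ x.2 = Γ then wt (δ * p) x.1 * wt p2 x.2 else 0
    have hν : ∀ x, 0 ≤ ν x := by
      intro x
      simp only [ν]
      split_ifs
      · exact w12 x
      · exact le_rfl
    have A1 := hsp W n p δ hn hp le_rfl (by linarith) hCp X hX S (hbad S hSb) _ ν Prod.fst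
      (wt p Γ) hν hw (by
        intro M hM l
        rw [← union_law (δ * p) p2 p δ l hp2 rfl Γ M (hM.trans hSΓ)]
        refine Finset.sum_congr rfl fun x _ => ?_
        simp only [ν]
        split_ifs <;> simp)
    have A2 := hsp W n p (p2 / p) hn hp (by rw [le_div_iff₀ hp]; nlinarith)
      (by rw [div_le_one hp]; exact hb2) hCp X hX S (hbad S hSb) _ ν Prod.snd
      (wt p Γ) hν hw (by
        intro M hM l
        rw [← union_law p2 (δ * p) p (p2 / p) l (by rw [hp2]; ring) (by field_simp) Γ M (hM.trans hSΓ)]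
        rw [← (Equiv.prodComm _ _).sum_comp]
        refine Finset.sum_congr rfl fun x _ => ?_
        simp only [ν, Equiv.prodComm_apply, Prod.fst_swap, Prod.snd_swap]
        rw [Finset.union_comm]
        split_ifs
        · ring
        · simp)
    have A0 : ∑ x, ν x = wt p Γ := by
      have := union_law (δ * p) p2 p δ 1 hp2 rfl Γ ∅ (Finset.empty_subset _)
      simpa [ν] using this
    have e1 : p2 / p * p = p2 := by field_simp
    rw [e1] at A2
    have A3 : ∀ x : Finset (Lab k W) × Finset (Lab k W), ν x ≤ (if x.1 ∪ x.2 = Γ then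
        (if Rx x then wt (δ * p) x.1 * wt p2 x.2 else 0) else 0) + 
        (if LR F (S ∩ x.1) X (ε * n) (d'' * (δ * p)) then 0 else ν x) +
        (if LR F (S ∩ x.2) X (ε * n) (d'' * p2) then 0 else ν x) := by
      intro x
      by_cases hx : x.1 ∪ x.2 = Γ
      · have hνx : ν x = wt (δ * p) x.1 * wt p2 x.2 := by simp [ν, hx]
        by_cases h1 : LR F (S ∩ x.1) X (ε * n) (d'' * (δ * p))
        · by_cases h2 : LR F (S ∩ x.2) X (ε * n) (d'' * p2)
          · have : Rx x := by
              rcases hR x.1 x.2 S (by rw [hx]; exact hSΓ) hSG hSb h1 h2 with h | h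
              · exact Or.inl h
              · exact Or.inr ⟨S ∩ x.1, Finset.mem_powerset.2 (Finset.inter_subset_left.trans hSG), 
                  Finset.inter_subset_right, h⟩
            simp [h1, h2, hx, this, hνx]
          · have := w12 x
            simp only [h1, h2, hx, hνx, if_true, if_false]
            split_ifs <;> linarith
        · have := w12 x
          simp only [h1, hx, hνx, if_true, if_false]
          split_ifs <;> linarith
      · have hνx : ν x = 0 := by simp [ν, hx]
        simp [hνx, hx]
    have A4 := Finset.sum_le_sum (s := univ) fun x _ => A3 x
    rw [Finset.sum_add_distrib, Finset.sum_add_distrib, A0] at A4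
    linarith
  have main : Pr p (fun Γ => ∃ S, S ⊆ Γ ∧ S ⊆ G ∧ bad S) / 2 ≤
      ∑ x : Finset (Lab k W) × Finset (Lab k W), (if Rx x then wt (δ * p) x.1 * wt p2 x.2 else 0) := by
    have e1 : ∑ x : Finset (Lab k W) × Finset (Lab k W), (if Rx x then wt (δ * p) x.1 * wt p2 x.2 else 0) =
        ∑ Γ : Finset (Lab k W), ∑ x : Finset (Lab k W) × Finset (Lab k W), if x.1 ∪ x.2 = Γ then
        (if Rx x then wt (δ * p) x.1 * wt p2 x.2 else 0) else 0 := by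
      rw [Finset.sum_comm]
      refine Finset.sum_congr rfl fun x _ => ?_
      rw [Finset.sum_ite_eq]
      simp
    rw [e1]
    unfold Pr
    rw [Finset.sum_div]
    refine Finset.sum_le_sum fun Γ _ => ?_
    split_ifs with h
    · exact key Γ h
    · rw [zero_div]
      refine Finset.sum_nonneg fun x _ => ?_
      split_ifs
      · exact w12 x
      · exact le_rfl
      · exact le_rfl
  have bound : ∑ x : Finset (Lab k W) × Finset (Lab k W), (if Rx x then wt (δ * p) x.1 * wt p2 x.2 else 0) ≤
      Pr (δ * p) R1 + (1 + δ * p) ^ G.card * x2 := by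
    calc _ ≤ ∑ x : Finset (Lab k W) × Finset (Lab k W), ((if R1 x.1 then wt (δ * p) x.1 * wt p2 x.2 else 0) +
          ∑ T ∈ G.powerset, (if T ⊆ x.1 then wt (δ * p) x.1 else 0) * (if R2 T x.2 then wt p2 x.2 else 0)) := by
          refine Finset.sum_le_sum fun x _ => ?_
          have hnn : ∀ T ∈ G.powerset, 0 ≤ (if T ⊆ x.1 then wt (δ * p) x.1 else 0) * 
              (if R2 T x.2 then wt p2 x.2 else 0) := by
            intro T _
            have := wt_nonneg hp10 hp11 x.1
            have := wt_nonneg hp20 hp21 x.2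
            apply mul_nonneg <;> split_ifs <;> first | assumption | exact le_rfl
          have hs := Finset.sum_nonneg hnn
          by_cases hx : Rx x
          · rw [if_pos hx]
            rcases hx with h | ⟨T, hT, hTx, hR2⟩
            · rw [if_pos h]; linarith
            · have := Finset.single_le_sum hnn hT
              simp only [hTx, hR2, if_true] at this
              have := w12 x
              split_ifs <;> linarith
          · rw [if_neg hx]
            have := w12 x
            split_ifs <;> linarith
      _ = ∑ x : Finset (Lab k W) × Finset (Lab k W), (if R1 x.1 then wt (δ * p) x.1 else 0) * wt p2 x.2 +
          ∑ T ∈ G.powerset, ∑ x : Finset (Lab k W) × Finset (Lab k W), 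
          (if T ⊆ x.1 then wt (δ * p) x.1 else 0) * (if R2 T x.2 then wt p2 x.2 else 0) := by
          rw [Finset.sum_add_distrib]
          congr 1
          · refine Finset.sum_congr rfl fun x _ => ?_
            split_ifs <;> simp
          · rw [Finset.sum_comm]
      _ = Pr (δ * p) R1 + ∑ T ∈ G.powerset, (δ * p) ^ T.card * Pr p2 (R2 T) := by
          congr 1
          · rw [sum_prod_split (fun y => if R1 y then wt (δ * p) y else 0) (fun y => wt p2 y), sum_wt, mul_one, Pr]
          · refine Finset.sum_congr rfl fun T _ => ?_
            rw [sum_prod_split (fun y => if T ⊆ y then wt (δ * p) y else 0) (fun y => if R2 T y then wt p2 y else 0), ← Pr_superset]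
            congr 1
            refine Finset.sum_congr rfl fun x _ => ?_
            split_ifs <;> rfl
      _ ≤ Pr (δ * p) R1 + ∑ T ∈ G.powerset, (δ * p) ^ T.card * x2 := by
          gcongr with T hT
          exact hx2 T (Finset.mem_powerset.1 hT)
      _ = _ := by
          rw [← Finset.sum_mul]
          congr 2
          have := Finset.prod_add (fun _ : Lab k W => δ * p) (fun _ => 1) G
          simp only [Finset.prod_const, Finset.prod_const_one, mul_one, one_pow] at this
          rw [← this, add_comm]
  linarith

/-- relaxed copies: only the edges inside `T` are demanded -/
noncomputable def rel {k : ℕ} {W : Type} [Fintype W] (A : Finset (Fin k × Fin k)) (G : Finset (Lab k W))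
    (T : Finset (Fin k)) (Y : Fin k → Finset W) : Finset (Fin k → W) :=
  univ.filter fun f => (∀ i, f i ∈ Y i) ∧ ∀ a ∈ A, a.1 ∈ T → a.2 ∈ T → (a, (f a.1, f a.2)) ∈ G

lemma ee_left {k : ℕ} {W : Type} (S : Finset (Lab k W)) (a : Fin k × Fin k) (U V : Finset W) :
    ee S a U V = ∑ u ∈ U, (V.filter fun v => (a, (u, v)) ∈ S).card := by
  unfold ee
  rw [Finset.card_filter, Finset.sum_product]
  refine Finset.sum_congr rfl fun u _ => ?_
  rw [Finset.card_filter]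

lemma ee_right {k : ℕ} {W : Type} (S : Finset (Lab k W)) (a : Fin k × Fin k) (U V : Finset W) :
    ee S a U V = ∑ v ∈ V, (U.filter fun u => (a, (u, v)) ∈ S).card := by
  unfold ee
  rw [Finset.card_filter, Finset.sum_product_right]
  refine Finset.sum_congr rfl fun u _ => ?_
  rw [Finset.card_filter]

lemma rel_count {k : ℕ} (A : Finset (Fin k × Fin k)) (hA : ∀ a ∈ A, a.1 < a.2) {d : ℝ} (hd : 0 < d)
    (T : Finset (Fin k)) : ∀ γ : ℝ, 0 < γ → ∃ ε ξ : ℝ, 0 < ε ∧ 0 < ξ ∧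
    ∀ (W : Type) [Fintype W] (n : ℕ), 1 ≤ n → ∀ (X : Fin k → Finset W), (∀ i, (X i).card = n) →
    ∀ G : Finset (Lab k W), LR A G X (ε * n) d → ∀ Y : Fin k → Finset W, (∀ i, Y i ⊆ X i) →
    (∀ i, γ * n ≤ (Y i).card) → ξ * (n:ℝ) ^ k ≤ (rel A G T Y).card := by
  induction T using Finset.induction_on with
  | empty =>
    intro γ hγ
    refine ⟨1, γ ^ k, one_pos, by positivity, ?_⟩
    intro W _ n hn X hX G hG Y hY hYγ
    have : rel A G ∅ Y = Fintype.piFinset Y := by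
      ext f
      simp [rel]
    rw [this, Fintype.card_piFinset]
    push_cast
    rw [← mul_pow]
    calc (γ * n) ^ k = ∏ i : Fin k, (γ * n) := by simp
      _ ≤ _ := by
        refine Finset.prod_le_prod (fun i _ => by positivity) fun i _ => hYγ i
  | insert m T hmT ih =>
    intro γ hγ
    set γ' := min γ (d * γ) with hγ'
    have hγ'0 : 0 < γ' := lt_min hγ (by positivity)
    obtain ⟨ε', ξ', hε', hξ', H⟩ := ih γ' hγ'0
    refine ⟨min ε' (γ / (2 * (k + 1))), γ / 2 * ξ', by positivity, by positivity, ?_⟩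
    intro W _ n hn X hX G hG Y hY hYγ
    have hn0 : (0:ℝ) < n := by exact_mod_cast hn
    set ε := min ε' (γ / (2 * (k + 1))) with hεdef
    have hε0 : 0 < ε := by positivity
    have hεγ : ε ≤ γ / (2 * (k + 1)) := min_le_right _ _
    have hεγ' : ε * (k + 1) ≤ γ / 2 := by
      rw [le_div_iff₀ (by positivity)] at hεγ; linarith
    have hεγ2 : ε ≤ γ := by
      have : (0:ℝ) ≤ k := by positivity
      nlinarith
    let Y' : W → Fin k → Finset W := fun v i => (Y i).filter fun w => i ≠ m →
      (((m, i) ∈ A → ((m, i), (v, w)) ∈ G) ∧ ((i, m) ∈ A → ((i, m), (w, v)) ∈ G))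
    let badi : Fin k → Finset W := fun i => (Y m).filter fun v => ((Y' v i).card : ℝ) < γ' * n
    have hbad : ∀ i, ((badi i).card : ℝ) ≤ ε * n := by
      intro i
      by_contra hcon
      push Not at hcon
      have hU : badi i ⊆ X m := (Finset.filter_subset _ _).trans (hY m)
      have hYe : ε * n ≤ (Y i).card := le_trans (by gcongr) (hYγ i)
      have hpos : (0:ℝ) < (badi i).card := lt_of_le_of_lt (by positivity) hcon
      have hne : (badi i).Nonempty := by
        rw [← Finset.card_pos]; exact_mod_cast hpos
      have hlt : ∀ v ∈ badi i, ((Y' v i).card : ℝ) < d * (Y i).card := by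
        intro v hv
        have := (Finset.mem_filter.1 hv).2
        calc ((Y' v i).card : ℝ) < γ' * n := this
          _ ≤ d * γ * n := by gcongr; exact min_le_right _ _
          _ = d * (γ * n) := by ring
          _ ≤ _ := by gcongr; exact hYγ i
      have hall : (∀ v, Y' v i = Y i) → False := by
        intro hv
        obtain ⟨v, hvb⟩ := hne
        have h1 := (Finset.mem_filter.1 hvb).2
        rw [hv] at h1
        have h2 : γ' * n ≤ γ * n := by gcongr; exact min_le_left _ _
        have := hYγ i
        linarith
      by_cases him : i = m
      · exact hall fun v => by simp [Y', him]
      by_cases h1 : (m, i) ∈ A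
      · have h2 : (i, m) ∉ A := fun h2 => lt_asymm (hA _ h1) (hA _ h2)
        have hle := hG (m, i) h1 (badi i) hU (Y i) (hY i) hcon.le hYe
        rw [ee_left] at hle
        push_cast at hle
        have : ∑ v ∈ badi i, (((Y i).filter fun w => ((m, i), (v, w)) ∈ G).card : ℝ) <
            ∑ v ∈ badi i, d * (Y i).card := by
          refine Finset.sum_lt_sum_of_nonempty hne fun v hv => ?_
          have := hlt v hv
          simpa [Y', him, h1, h2] using this
        rw [Finset.sum_const, nsmul_eq_mul] at this
        linarith
      by_cases h2 : (i, m) ∈ A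
      · have hle := hG (i, m) h2 (Y i) (hY i) (badi i) hU hYe hcon.le
        rw [ee_right] at hle
        push_cast at hle
        have : ∑ v ∈ badi i, (((Y i).filter fun w => ((i, m), (w, v)) ∈ G).card : ℝ) <
            ∑ v ∈ badi i, d * (Y i).card := by
          refine Finset.sum_lt_sum_of_nonempty hne fun v hv => ?_
          have := hlt v hv
          simpa [Y', him, h1, h2] using this
        rw [Finset.sum_const, nsmul_eq_mul] at this
        linarith
      · exact hall fun v => by simp [Y', him, h1, h2]
    set good := (Y m) \ (univ.biUnion badi) with hgood
    have hgc : γ / 2 * n ≤ good.card := by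
      have h1 : (Y m).card ≤ good.card + (univ.biUnion badi).card := by
        have := Finset.le_card_sdiff (univ.biUnion badi) (Y m)
        rw [hgood]; omega
      have h2 : ((univ.biUnion badi).card : ℝ) ≤ k * (ε * n) := by
        calc ((univ.biUnion badi).card : ℝ) ≤ ∑ i, ((badi i).card : ℝ) := by
              exact_mod_cast Finset.card_biUnion_le
          _ ≤ ∑ i : Fin k, ε * n := Finset.sum_le_sum fun i _ => hbad i
          _ = _ := by simp
      have h3 : ((Y m).card : ℝ) ≤ good.card + (univ.biUnion badi).card := by exact_mod_cast h1
      have h4 := hYγ m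
      have h5 : ε * (k + 1) * n ≤ γ / 2 * n := by gcongr
      nlinarith [mul_pos hε0 hn0]
    have hcount : ∀ v ∈ good, ξ' * (n:ℝ) ^ k ≤ (rel A G T (Y' v)).card := by
      intro v hv
      refine H W n hn X hX G (LR_mono subset_rfl (by gcongr; exact min_le_left _ _) le_rfl hG) (Y' v)
        (fun i => (Finset.filter_subset _ _).trans (hY i)) fun i => ?_
      rw [hgood, Finset.mem_sdiff] at hv
      by_contra hcon
      push Not at hcon
      exact hv.2 (Finset.mem_biUnion.2 ⟨i, mem_univ _, Finset.mem_filter.2 ⟨hv.1, hcon⟩⟩)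
    have hinj : (good.sigma fun v => rel A G T (Y' v)).card ≤ 
        (rel A G (insert m T) Y ×ˢ X m).card := by
      refine Finset.card_le_card_of_injOn (fun x => (Function.update x.2 m x.1, x.2 m)) ?_ ?_
      · rintro ⟨v, f⟩ hx
        have hx' := Finset.mem_sigma.1 (Finset.mem_coe.1 hx)
        obtain ⟨hv, hf⟩ := hx'
        simp only [rel, Finset.mem_filter, mem_univ, true_and] at hf
        have hv1 : v ∈ Y m := (Finset.mem_sdiff.1 hv).1
        have hfY : ∀ i, f i ∈ Y i := fun i => (Finset.mem_filter.1 (hf.1 i)).1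
        have hfN : ∀ i, i ≠ m → (((m, i) ∈ A → ((m, i), (v, f i)) ∈ G) ∧
            ((i, m) ∈ A → ((i, m), (f i, v)) ∈ G)) := fun i => (Finset.mem_filter.1 (hf.1 i)).2
        simp only [Finset.coe_product, Set.mem_prod, Finset.mem_coe, rel, Finset.mem_filter, mem_univ,
          true_and]
        refine ⟨⟨?_, ?_⟩, hY m (hfY m)⟩
        · intro i
          by_cases him : i = m
          · subst him; simpa using hv1
          · simpa [him] using hfY i
        · rintro ⟨a, b⟩ hab h1 h2
          have hne : a ≠ b := (hA _ hab).ne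
          by_cases ham : a = m
          · subst ham
            have := (hfN b hne.symm).1 hab
            simpa [hne.symm] using this
          · by_cases hbm : b = m
            · subst hbm
              have := (hfN a hne).2 hab
              simpa [hne] using this
            · have := hf.2 _ hab (by simpa [ham] using h1) (by simpa [hbm] using h2)
              simpa [ham, hbm] using this
      · rintro ⟨v, f⟩ _ ⟨v', f'⟩ _ h
        simp only [Prod.mk.injEq] at h
        obtain ⟨h1, h2⟩ := h
        have e1 : v = v' := by
          have := congrFun h1 m
          simpa using this
        have e2 : f = f' := by
          funext i
          by_cases him : i = m
          · rw [him]; exact h2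
          · have := congrFun h1 i
            simpa [him] using this
        rw [e1, e2]
    rw [Finset.card_product, Finset.card_sigma, hX] at hinj
    have hinj' : ∑ v ∈ good, ((rel A G T (Y' v)).card : ℝ) ≤ (rel A G (insert m T) Y).card * n := by
      exact_mod_cast hinj
    have : good.card * (ξ' * (n:ℝ) ^ k) ≤ ∑ v ∈ good, ((rel A G T (Y' v)).card : ℝ) := by
      rw [← nsmul_eq_mul, ← Finset.sum_const]
      exact Finset.sum_le_sum hcount
    have h6 : γ / 2 * n * (ξ' * (n:ℝ) ^ k) ≤ good.card * (ξ' * (n:ℝ) ^ k) := by gcongr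
    have h7 : (γ / 2 * ξ' * (n:ℝ) ^ k) * n ≤ (rel A G (insert m T) Y).card * n := by
      calc _ = γ / 2 * n * (ξ' * (n:ℝ) ^ k) := by ring
        _ ≤ _ := by linarith
    exact le_of_mul_le_mul_right h7 hn0

lemma dense_count {k : ℕ} (A : Finset (Fin k × Fin k)) (hA : ∀ a ∈ A, a.1 < a.2) {d : ℝ} (hd : 0 < d) :
    ∃ ε ξ : ℝ, 0 < ε ∧ 0 < ξ ∧
    ∀ (W : Type) [Fintype W] (n : ℕ), 1 ≤ n → ∀ (X : Fin k → Finset W), (∀ i, (X i).card = n) →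
    ∀ G : Finset (Lab k W), LR A G X (ε * n) d → ∀ S, ξ * (n:ℝ) ^ k ≤ (cop X A G ∅ S).card := by
  obtain ⟨ε, ξ, hε, hξ, H⟩ := rel_count A hA hd univ 1 one_pos
  refine ⟨ε, ξ, hε, hξ, ?_⟩
  intro W _ n hn X hX G hG S
  have := H W n hn X hX G hG X (fun i => subset_rfl) (fun i => by rw [hX]; simp)
  have e : rel A G univ X = cop X A G ∅ S := by
    ext f; simp [rel, cop]
  rwa [e] at this

lemma avg_subset {W : Type} (f : W → ℝ) (D : ℝ) : ∀ (j : ℕ) (s : Finset W) (a : ℕ), s.card = a + j →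
    1 ≤ a → D * s.card ≤ ∑ u ∈ s, f u → ∃ t ⊆ s, t.card = a ∧ D * a ≤ ∑ u ∈ t, f u := by
  intro j
  induction j with
  | zero =>
    intro s a hs ha hD
    exact ⟨s, subset_rfl, by simpa using hs, by rw [hs] at hD; simpa using hD⟩
  | succ j ih =>
    intro s a hs ha hD
    have hne : s.Nonempty := by rw [← Finset.card_pos]; omega
    obtain ⟨u, hu, hmin⟩ := Finset.exists_min_image s f hne
    have hc : (s.erase u).card = a + j := by rw [Finset.card_erase_of_mem hu]; omega
    have hsum : ∑ x ∈ s, f x = f u + ∑ x ∈ s.erase u, f x := (Finset.add_sum_erase _ _ hu).symm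
    have hge : (a + j : ℝ) * f u ≤ ∑ x ∈ s.erase u, f x := by
      have : ∑ x ∈ s.erase u, f u ≤ ∑ x ∈ s.erase u, f x :=
        Finset.sum_le_sum fun x hx => hmin x (Finset.mem_of_mem_erase hx)
      rw [Finset.sum_const, hc, nsmul_eq_mul] at this
      push_cast at this
      exact this
    have hd : D * (s.erase u).card ≤ ∑ x ∈ s.erase u, f x := by
      rw [hs] at hD
      rw [hc]
      push_cast at hD ⊢
      have ha' : (1:ℝ) ≤ a := by exact_mod_cast ha
      have hj : (0:ℝ) ≤ j := by positivity
      rcases le_total (f u) D with h | h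
      · linarith
      · have : (a + j : ℝ) * D ≤ (a + j : ℝ) * f u := by gcongr
        linarith
    obtain ⟨t, ht, h1, h2⟩ := ih (s.erase u) a hc ha hd
    exact ⟨t, ht.trans (Finset.erase_subset _ _), h1, h2⟩

lemma trim {W : Type} (f : W → W → ℝ) (D : ℝ) (P Q : Finset W) (a : ℕ) (ha : 1 ≤ a) (hP : a ≤ P.card)
    (hQ : a ≤ Q.card) (h : D * ((P.card : ℝ) * Q.card) ≤ ∑ u ∈ P, ∑ v ∈ Q, f u v) :
    ∃ P' ⊆ P, ∃ Q' ⊆ Q, P'.card = a ∧ Q'.card = a ∧ D * ((a:ℝ) * a) ≤ ∑ u ∈ P', ∑ v ∈ Q', f u v := by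
  obtain ⟨P', hP', h1, h2⟩ := avg_subset (fun u => ∑ v ∈ Q, f u v) (D * Q.card) (P.card - a) P a
    (by omega) ha (by linarith)
  rw [Finset.sum_comm] at h2
  obtain ⟨Q', hQ', h3, h4⟩ := avg_subset (fun v => ∑ u ∈ P', f u v) (D * a) (Q.card - a) Q a
    (by omega) ha (by linarith)
  rw [Finset.sum_comm] at h4
  exact ⟨P', hP', Q', hQ', h1, h3, by linarith⟩

lemma lemD_aux {W : Type} (f : W → W → ℝ) (hf : ∀ u v, f u v ≤ 1) {ε η : ℝ} (hε : 0 < ε) (hε4 : ε ≤ 1 / 4)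
    (hη : 0 < η) : ∀ (t : ℕ) (η' : ℝ), η ≤ η' → 1 < η' * (1 + ε ^ 2 / 2) ^ t → ∀ (m : ℕ), 1 ≤ m →
    ∀ U V : Finset W, U.card = m → V.card = m → η' * ((m:ℝ) * m) ≤ ∑ u ∈ U, ∑ v ∈ V, f u v →
    ∃ U' ⊆ U, ∃ V' ⊆ V, ∃ m' : ℕ, 1 ≤ m' ∧ U'.card = m' ∧ V'.card = m' ∧ ε ^ t * m ≤ m' ∧
      ∀ A ⊆ U', ∀ B ⊆ V', ε * m' ≤ A.card → ε * m' ≤ B.card → 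
        η / 2 * ((A.card : ℝ) * B.card) ≤ ∑ u ∈ A, ∑ v ∈ B, f u v := by
  intro t
  induction t with
  | zero =>
    intro η' hη' h1 m hm U V hU hV h
    exfalso
    have : ∑ u ∈ U, ∑ v ∈ V, f u v ≤ ∑ u ∈ U, ∑ v ∈ V, 1 :=
      Finset.sum_le_sum fun u _ => Finset.sum_le_sum fun v _ => hf u v
    simp only [Finset.sum_const, nsmul_eq_mul, mul_one, hU, hV] at this
    have hm' : (1:ℝ) ≤ m := by exact_mod_cast hm
    simp only [pow_zero, mul_one] at h1
    have hmm : (0:ℝ) < (m:ℝ) * m := by positivity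
    have := mul_lt_mul_of_pos_right h1 hmm
    linarith
  | succ t ih =>
    intro η' hη' h1 m hm U V hU hV h
    have hm' : (1:ℝ) ≤ m := by exact_mod_cast hm
    by_cases hreg : ∀ A ⊆ U, ∀ B ⊆ V, ε * m ≤ A.card → ε * m ≤ B.card → 
        η / 2 * ((A.card : ℝ) * B.card) ≤ ∑ u ∈ A, ∑ v ∈ B, f u v
    · refine ⟨U, subset_rfl, V, subset_rfl, m, hm, hU, hV, ?_, hreg⟩
      have : ε ^ (t + 1) ≤ 1 := pow_le_one₀ hε.le (by linarith)
      nlinarith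
    push Not at hreg
    obtain ⟨A, hA, B, hB, hAε, hBε, hlow⟩ := hreg
    have hεm : 0 < ε * m := by positivity
    set a := ⌈ε * m⌉₊ with ha
    have ha1 : 1 ≤ a := Nat.one_le_iff_ne_zero.2 (by simpa [ha] using hεm)
    have haA : a ≤ A.card := Nat.ceil_le.2 hAε
    have haB : a ≤ B.card := Nat.ceil_le.2 hBε
    have haε : ε * m ≤ a := Nat.le_ceil _
    have hm2 : 2 ≤ m := by
      by_contra hcon
      have hm1 : m = 1 := by omega
      have e1 : A = U := Finset.eq_of_subset_of_card_le hA (by omega)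
      have e2 : B = V := Finset.eq_of_subset_of_card_le hB (by omega)
      rw [e1, e2, hU, hV] at hlow
      nlinarith
    have ha2 : 2 * a ≤ m := by
      have h1 : (a:ℝ) < ε * m + 1 := Nat.ceil_lt_add_one hεm.le
      have h2 : ε * m ≤ m / 4 := by nlinarith
      have h3 : (a:ℝ) < m / 4 + 1 := by linarith
      have h4 : 4 * a < m + 4 := by
        have : (4:ℝ) * a < m + 4 := by linarith
        exact_mod_cast this
      omega
    obtain ⟨A1, hA1, B1, hB1, cA, cB, hlow1⟩ := trim (fun u v => - f u v) (-(η / 2)) A B a ha1 haA haB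
      (by simp only [Finset.sum_neg_distrib]; linarith)
    simp only [Finset.sum_neg_distrib] at hlow1
    have hA1U := hA1.trans hA
    have hB1V := hB1.trans hB
    set A2 := U \ A1 with hA2
    set B2 := V \ B1 with hB2
    have cA2 : A2.card = m - a := by rw [hA2, Finset.card_sdiff_of_subset hA1U, cA, hU]
    have cB2 : B2.card = m - a := by rw [hB2, Finset.card_sdiff_of_subset hB1V, cB, hV]
    have cA2' : (A2.card : ℝ) = m - a := by rw [cA2, Nat.cast_sub (by omega)]
    have cB2' : (B2.card : ℝ) = m - a := by rw [cB2, Nat.cast_sub (by omega)]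
    have hsplit : ∑ u ∈ U, ∑ v ∈ V, f u v = (∑ u ∈ A1, ∑ v ∈ B1, f u v) + (∑ u ∈ A1, ∑ v ∈ B2, f u v)
        + (∑ u ∈ A2, ∑ v ∈ B1, f u v) + ∑ u ∈ A2, ∑ v ∈ B2, f u v := by
      rw [← Finset.sum_sdiff hA1U]
      have : ∀ u, ∑ v ∈ V, f u v = ∑ v ∈ B2, f u v + ∑ v ∈ B1, f u v := fun u =>
        (Finset.sum_sdiff hB1V).symm
      simp only [this, Finset.sum_add_distrib]
      ring
    set r := 1 + ε ^ 2 / 2 with hr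
    have fin : ∀ P ⊆ U, ∀ Q ⊆ V, a ≤ P.card → a ≤ Q.card → 
        η' * r * ((P.card : ℝ) * Q.card) ≤ ∑ u ∈ P, ∑ v ∈ Q, f u v →
        ∃ U' ⊆ U, ∃ V' ⊆ V, ∃ m' : ℕ, 1 ≤ m' ∧ U'.card = m' ∧ V'.card = m' ∧ ε ^ (t + 1) * m ≤ m' ∧
      ∀ A ⊆ U', ∀ B ⊆ V', ε * m' ≤ A.card → ε * m' ≤ B.card → 
        η / 2 * ((A.card : ℝ) * B.card) ≤ ∑ u ∈ A, ∑ v ∈ B, f u v := by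
      intro P hP Q hQ h1' h2' h3'
      obtain ⟨P1, hP1, Q1, hQ1, c1, c2, h4⟩ := trim f _ P Q a ha1 h1' h2' h3'
      have hηr : η' ≤ η' * r := by
        have : 0 ≤ η' * (ε ^ 2 / 2) := by have : 0 < η' := hη.trans_le hη'
                                          positivity
        rw [hr]; linarith
      obtain ⟨U', hU', V', hV', m', q1, q2, q3, q4, q5⟩ := ih (η' * r) (hη'.trans hηr)
        (by rw [pow_succ] at h1; linarith) a ha1 P1 Q1 c1 c2 h4
      refine ⟨U', hU'.trans (hP1.trans hP), V', hV'.trans (hQ1.trans hQ), m', q1, q2, q3, ?_, q5⟩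
      calc ε ^ (t + 1) * m = ε ^ t * (ε * m) := by ring
        _ ≤ ε ^ t * a := by gcongr
        _ ≤ m' := q4
    by_contra hcon
    have n1 := fun h => hcon (fin A1 hA1U B2 Finset.sdiff_subset (by omega) (by omega) h)
    have n2 := fun h => hcon (fin A2 Finset.sdiff_subset B1 hB1V (by omega) (by omega) h)
    have n3 := fun h => hcon (fin A2 Finset.sdiff_subset B2 Finset.sdiff_subset (by omega) (by omega) h)
    rw [imp_false, not_le] at n1 n2 n3
    rw [cA, cB2'] at n1
    rw [cA2', cB] at n2
    rw [cA2', cB2'] at n3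
    have hη'0 : 0 < η' := hη.trans_le hη'
    have hk : r * ((m:ℝ) * m - a * a) ≤ m * m - a * a / 2 := by
      have q1 : (ε * m) * (ε * m) ≤ (a:ℝ) * a := by gcongr
      rw [hr]
      nlinarith [sq_nonneg (ε * a)]
    have hk2 : η' * (r * ((m:ℝ) * m - a * a)) ≤ η' * (m * m - a * a / 2) := by gcongr
    have hk3 : η / 2 * ((a:ℝ) * a) ≤ η' / 2 * ((a:ℝ) * a) := by gcongr
    nlinarith

lemma lemD {ε η : ℝ} (hε : 0 < ε) (hε4 : ε ≤ 1 / 4) (hη : 0 < η) : ∃ μ : ℝ, 0 < μ ∧ μ ≤ 1 ∧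
    ∀ (W : Type) (n : ℕ) (X Y : Finset W) (B : Finset (W × W)), 1 ≤ n → X.card = n → Y.card = n →
    B ⊆ X ×ˢ Y → η * (n:ℝ) ^ 2 ≤ B.card →
    ∃ U ⊆ X, ∃ V ⊆ Y, ∃ m : ℕ, 1 ≤ m ∧ U.card = m ∧ V.card = m ∧ μ * n ≤ m ∧
      ∀ A' ⊆ U, ∀ B' ⊆ V, ε * m ≤ A'.card → ε * m ≤ B'.card → 
        η / 2 * ((A'.card : ℝ) * B'.card) ≤ ((A' ×ˢ B').filter (· ∈ B)).card := by
  obtain ⟨t, ht⟩ := pow_unbounded_of_one_lt (1 / η) (show (1:ℝ) < 1 + ε ^ 2 / 2 by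
    have : 0 < ε ^ 2 / 2 := by positivity
    linarith)
  rw [div_lt_iff₀ hη] at ht
  refine ⟨ε ^ t, by positivity, pow_le_one₀ hε.le (by linarith), ?_⟩
  intro W n X Y B hn hX hY hB hBc
  have hcard : ∀ P Q : Finset W, (((P ×ˢ Q).filter (· ∈ B)).card : ℝ) = 
      ∑ u ∈ P, ∑ v ∈ Q, if (u, v) ∈ B then (1:ℝ) else 0 := by
    intro P Q
    rw [Finset.card_filter, Finset.sum_product]
    push_cast
    rfl
  obtain ⟨U, hU, V, hV, m, q1, q2, q3, q4, q5⟩ := lemD_aux 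
    (fun u v => if (u, v) ∈ B then (1:ℝ) else 0) (fun u v => by split_ifs <;> norm_num) hε hε4 hη t η
    le_rfl (by linarith) n hn X Y hX hY (by
      rw [← hcard]
      have : (X ×ˢ Y).filter (· ∈ B) = B := by
        ext x
        simp only [Finset.mem_filter]
        exact ⟨fun h => h.2, fun h => ⟨hB h, h⟩⟩
      rw [this]
      linarith)
  refine ⟨U, hU, V, hV, m, q1, q2, q3, q4, fun A' hA' B' hB' h1 h2 => ?_⟩
  rw [hcard]
  exact q5 A' hA' B' hB' h1 h2

/-- the labelled `F`-edges of the map `g` -/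
noncomputable def hF {k : ℕ} {W : Type} (F : Finset (Fin k × Fin k)) (g : Fin k → W) : Finset (Lab k W) :=
  F.image fun a => (a, (g a.1, g a.2))

lemma hF_card {k : ℕ} {W : Type} (F : Finset (Fin k × Fin k)) (g : Fin k → W) : (hF F g).card = F.card :=
  Finset.card_image_of_injective _ fun a b h => (Prod.mk.inj h).1

lemma hF_subset {k : ℕ} {W : Type} (F : Finset (Fin k × Fin k)) (g : Fin k → W) (S : Finset (Lab k W)) :
    hF F g ⊆ S ↔ ∀ a ∈ F, (a, (g a.1, g a.2)) ∈ S := by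
  unfold hF
  rw [Finset.image_subset_iff]

lemma hF_union {k : ℕ} {W : Type} (F : Finset (Fin k × Fin k)) (g g' : Fin k → W) :
    (hF F g ∪ hF F g').card + (F.filter fun a => g a.1 = g' a.1 ∧ g a.2 = g' a.2).card = 2 * F.card := by
  have h1 := Finset.card_union_add_card_inter (hF F g) (hF F g')
  have h2 : (hF F g ∩ hF F g').card = (F.filter fun a => g a.1 = g' a.1 ∧ g a.2 = g' a.2).card := by
    have : hF F g ∩ hF F g' = (F.filter fun a => g a.1 = g' a.1 ∧ g a.2 = g' a.2).image 
        fun a => (a, (g a.1, g a.2)) := by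
      ext x
      simp only [hF, Finset.mem_inter, Finset.mem_image, Finset.mem_filter]
      constructor
      · rintro ⟨⟨a, ha, rfl⟩, b, hb, h⟩
        simp only [Prod.mk.injEq] at h
        obtain ⟨rfl, h1, h2⟩ := h
        exact ⟨b, ⟨hb, h1.symm, h2.symm⟩, rfl⟩
      · rintro ⟨a, ⟨ha, h1, h2⟩, rfl⟩
        exact ⟨⟨a, ha, rfl⟩, a, ha, by rw [h1, h2]⟩
    rw [this, Finset.card_image_of_injective _ fun a b h => (Prod.mk.inj h).1]
  rw [hF_card, hF_card] at h1
  omega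

/-- the balancedness hypothesis -/
def BalH {k : ℕ} (A : Finset (Fin k × Fin k)) (θ : ℝ) : Prop :=
  ∀ e ∈ A, ∀ J : Finset (Fin k), e.1 ∈ J → e.2 ∈ J →
    (((A.erase e).filter fun a => a.1 ∈ J ∧ a.2 ∈ J).card : ℝ) * θ ≤ (J.card : ℝ) - 2

lemma second_moment {k : ℕ} {A : Finset (Fin k × Fin k)} {θ : ℝ} (hθ0 : 0 < θ) (hθ : BalH A θ)
    {e : Fin k × Fin k} (he : e ∈ A) {F : Finset (Fin k × Fin k)} (hFA : F ⊆ A.erase e)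
    {W : Type} [Fintype W] {n : ℕ} (hn : 1 ≤ n) {p : ℝ} (hp : 0 < p) (hp1 : p ≤ 1)
    (hpn : (n:ℝ) ^ (-θ) ≤ p) (X : Fin k → Finset W) (hX : ∀ i, (X i).card = n) :
    ∑ x ∈ (Fintype.piFinset X ×ˢ Fintype.piFinset X).filter 
      (fun x => x.1 e.1 = x.2 e.1 ∧ x.1 e.2 = x.2 e.2), p ^ (hF F x.1 ∪ hF F x.2).card ≤
    2 ^ k * p ^ (2 * F.card) * (n:ℝ) ^ (2 * k) / (n:ℝ) ^ 2 := by
  have hn0 : (0:ℝ) < n := by exact_mod_cast hn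
  set I := (Fintype.piFinset X ×ˢ Fintype.piFinset X).filter 
      (fun x => x.1 e.1 = x.2 e.1 ∧ x.1 e.2 = x.2 e.2) with hI
  let ag : (Fin k → W) × (Fin k → W) → Finset (Fin k) := fun x => univ.filter fun i => x.1 i = x.2 i
  rw [← Finset.sum_fiberwise (s := I) (g := ag)]
  have hJ : ∀ J : Finset (Fin k), ∑ x ∈ I with ag x = J, p ^ (hF F x.1 ∪ hF F x.2).card ≤
      p ^ (2 * F.card) * (n:ℝ) ^ (2 * k) / (n:ℝ) ^ 2 := by
    intro J
    by_cases hemp : (I.filter fun x => ag x = J) = ∅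
    · rw [hemp, Finset.sum_empty]; positivity
    obtain ⟨x0, hx0⟩ := Finset.nonempty_iff_ne_empty.2 hemp
    have hx0' := Finset.mem_filter.1 hx0
    have hx0I := (Finset.mem_filter.1 hx0'.1).2
    have he1 : e.1 ∈ J := by rw [← hx0'.2]; simpa [ag] using hx0I.1
    have he2 : e.2 ∈ J := by rw [← hx0'.2]; simpa [ag] using hx0I.2
    set fJ := (F.filter fun a => a.1 ∈ J ∧ a.2 ∈ J).card with hfJ
    have hfJle : fJ ≤ 2 * F.card := by
      have := Finset.card_filter_le F (fun a => a.1 ∈ J ∧ a.2 ∈ J)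
      omega
    have hJk : J.card ≤ k := by simpa using Finset.card_le_univ J
    have hterm : ∀ x ∈ I.filter (fun x => ag x = J), p ^ (hF F x.1 ∪ hF F x.2).card = 
        p ^ (2 * F.card - fJ) := by
      intro x hx
      have hx2 := (Finset.mem_filter.1 hx).2
      have h1 := hF_union F x.1 x.2
      have h2 : (F.filter fun a => x.1 a.1 = x.2 a.1 ∧ x.1 a.2 = x.2 a.2) = 
          F.filter fun a => a.1 ∈ J ∧ a.2 ∈ J := by
        rw [← hx2]
        ext a
        simp [ag]
      rw [h2] at h1
      congr 1
      omega
    rw [Finset.sum_congr rfl hterm, Finset.sum_const, nsmul_eq_mul]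
    have hcnt : ((I.filter fun x => ag x = J).card : ℝ) ≤ (n:ℝ) ^ k * (n:ℝ) ^ (k - J.card) := by
      have h1 : (I.filter fun x => ag x = J) ⊆ (Fintype.piFinset X).biUnion fun g => 
          (Fintype.piFinset fun i => if i ∈ J then {g i} else X i).image fun g' => (g, g') := by
        rintro ⟨g, g'⟩ hx
        have hx' := Finset.mem_filter.1 hx
        have hxI := Finset.mem_product.1 (Finset.mem_filter.1 hx'.1).1
        rw [Finset.mem_biUnion]
        refine ⟨g, hxI.1, Finset.mem_image.2 ⟨g', ?_, rfl⟩⟩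
        rw [Fintype.mem_piFinset]
        intro i
        split_ifs with hi
        · rw [← hx'.2] at hi
          simp only [ag, Finset.mem_filter, mem_univ, true_and] at hi
          simp [hi]
        · exact Fintype.mem_piFinset.1 hxI.2 i
      have h2 : (I.filter fun x => ag x = J).card ≤ n ^ k * n ^ (k - J.card) := by
        refine (Finset.card_le_card h1).trans (Finset.card_biUnion_le.trans ?_)
        have : ∀ g ∈ Fintype.piFinset X, ((Fintype.piFinset fun i => if i ∈ J then {g i} else X i).image 
            fun g' => (g, g')).card ≤ n ^ (k - J.card) := by
          intro g _
          refine Finset.card_image_le.trans ?_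
          rw [Fintype.card_piFinset]
          have : ∀ i, (if i ∈ J then {g i} else X i).card = if i ∈ J then 1 else n := by
            intro i; split_ifs
            · simp
            · exact hX i
          rw [Finset.prod_congr rfl fun i _ => this i, Finset.prod_ite]
          simp only [Finset.prod_const, one_pow, one_mul]
          have : (univ.filter fun i => i ∉ J).card = k - J.card := by
            have : (univ.filter fun i => i ∉ J) = Jᶜ := by ext; simp
            rw [this, Finset.card_compl, Fintype.card_fin]
          rw [this]
        refine (Finset.sum_le_sum this).trans ?_
        rw [Finset.sum_const, Fintype.card_piFinset, smul_eq_mul]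
        simp [hX]
      exact_mod_cast h2
    have hkey : (n:ℝ) ^ 2 ≤ p ^ fJ * (n:ℝ) ^ J.card := by
      have h1 : ((n:ℝ) ^ (-θ)) ^ fJ ≤ p ^ fJ := by gcongr
      have h2 : (fJ : ℝ) * θ ≤ (J.card : ℝ) - 2 := by
        refine le_trans ?_ (hθ e he J he1 he2)
        gcongr
        rw [hfJ]
        exact Finset.card_le_card (Finset.filter_subset_filter _ hFA)
      have h3 : ((n:ℝ) ^ (-θ)) ^ fJ * (n:ℝ) ^ J.card = (n:ℝ) ^ ((J.card : ℝ) - fJ * θ) := by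
        rw [← Real.rpow_natCast, ← Real.rpow_mul hn0.le, ← Real.rpow_natCast, ← Real.rpow_add hn0]
        congr 1; ring
      calc (n:ℝ) ^ 2 = (n:ℝ) ^ ((2:ℝ)) := by norm_cast
        _ ≤ (n:ℝ) ^ ((J.card : ℝ) - fJ * θ) := by
          apply Real.rpow_le_rpow_of_exponent_le (by exact_mod_cast hn)
          linarith
        _ = ((n:ℝ) ^ (-θ)) ^ fJ * (n:ℝ) ^ J.card := h3.symm
        _ ≤ _ := by gcongr
    rw [le_div_iff₀ (by positivity)]
    calc ((I.filter fun x => ag x = J).card : ℝ) * p ^ (2 * F.card - fJ) * (n:ℝ) ^ 2 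
        ≤ ((n:ℝ) ^ k * (n:ℝ) ^ (k - J.card)) * p ^ (2 * F.card - fJ) * (p ^ fJ * (n:ℝ) ^ J.card) := by
          gcongr
      _ = (p ^ (2 * F.card - fJ) * p ^ fJ) * ((n:ℝ) ^ k * ((n:ℝ) ^ (k - J.card) * (n:ℝ) ^ J.card)) := by ring
      _ = _ := by
        rw [← pow_add, ← pow_add, ← pow_add]
        congr 2 <;> omega
  refine (Finset.sum_le_sum fun J _ => hJ J).trans ?_
  rw [Finset.sum_const, nsmul_eq_mul]
  simp only [Finset.card_univ, Fintype.card_finset, Fintype.card_fin]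
  push_cast
  apply le_of_eq; ring

lemma cs_core {k : ℕ} {W : Type} (N : Finset (Fin k → W)) (B : Finset (W × W)) (e : Fin k × Fin k)
    (n : ℕ) (hn : 1 ≤ n) (hN : ∀ g ∈ N, (g e.1, g e.2) ∈ B) (hB : (B.card : ℝ) ≤ (n:ℝ) ^ 2) (dgx : W × W → ℕ)
    (hdg : ∀ x ∈ B, (N.filter fun g => (g e.1, g e.2) = x).card ≤ dgx x) (M z : ℝ) (hz : 0 < z)
    (hM : (((N ×ˢ N).filter fun x => x.1 e.1 = x.2 e.1 ∧ x.1 e.2 = x.2 e.2).card : ℝ) ≤ M)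
    (hNz : 2 * z ≤ N.card) :
    z ^ 2 ≤ (B.filter fun x => z ≤ (n:ℝ) ^ 2 * dgx x).card * M := by
  have hn0 : (0:ℝ) < n := by exact_mod_cast hn
  set dp : W × W → ℕ := fun x => (N.filter fun g => (g e.1, g e.2) = x).card with hdp
  have h1 : N.card = ∑ x ∈ B, dp x := Finset.card_eq_sum_card_fiberwise hN
  have h2 : ((N ×ˢ N).filter fun x => x.1 e.1 = x.2 e.1 ∧ x.1 e.2 = x.2 e.2).card = ∑ x ∈ B, dp x ^ 2 := by
    rw [Finset.card_eq_sum_card_fiberwise (f := fun y => (y.1 e.1, y.1 e.2)) (t := B)]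
    · refine Finset.sum_congr rfl fun x _ => ?_
      rw [sq, hdp, ← Finset.card_product]
      congr 1
      ext ⟨g, g'⟩
      simp only [Finset.mem_filter, Finset.mem_product]
      constructor
      · rintro ⟨⟨⟨a, b⟩, c, d⟩, rfl⟩
        exact ⟨⟨a, rfl⟩, b, by rw [c, d]⟩
      · rintro ⟨⟨a, rfl⟩, b, c⟩
        rw [Prod.mk.injEq] at c
        exact ⟨⟨⟨a, b⟩, c.1.symm, c.2.symm⟩, rfl⟩
    · intro y hy
      have := (Finset.mem_filter.1 (Finset.mem_coe.1 hy)).1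
      exact hN _ (Finset.mem_product.1 this).1
  set Hv := B.filter fun x => z ≤ (n:ℝ) ^ 2 * dgx x with hHv
  have h3 : (N.card : ℝ) ≤ ∑ x ∈ Hv, (dp x : ℝ) + z := by
    rw [h1]
    push_cast
    rw [← Finset.sum_filter_add_sum_filter_not B (fun x => z ≤ (n:ℝ) ^ 2 * dgx x)]
    gcongr
    calc ∑ x ∈ B with ¬ z ≤ (n:ℝ) ^ 2 * dgx x, (dp x : ℝ) ≤ 
        ∑ x ∈ B with ¬ z ≤ (n:ℝ) ^ 2 * dgx x, z / (n:ℝ) ^ 2 := by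
          refine Finset.sum_le_sum fun x hx => ?_
          rw [Finset.mem_filter, not_le] at hx
          rw [le_div_iff₀ (by positivity)]
          have : (dp x : ℝ) ≤ dgx x := by exact_mod_cast hdg x hx.1
          have : (n:ℝ) ^ 2 * dp x ≤ (n:ℝ) ^ 2 * dgx x := by gcongr
          linarith
      _ ≤ ∑ x ∈ B, z / (n:ℝ) ^ 2 := 
          Finset.sum_le_sum_of_subset_of_nonneg (Finset.filter_subset _ _) fun _ _ _ => by positivity
      _ = B.card * (z / (n:ℝ) ^ 2) := by rw [Finset.sum_const, nsmul_eq_mul]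
      _ ≤ (n:ℝ) ^ 2 * (z / (n:ℝ) ^ 2) := by gcongr
      _ = z := by field_simp
  have h4 : z ≤ ∑ x ∈ Hv, (dp x : ℝ) := by linarith
  have h5 : (∑ x ∈ Hv, (dp x : ℝ)) ^ 2 ≤ Hv.card * ∑ x ∈ Hv, (dp x : ℝ) ^ 2 := sq_sum_le_card_mul_sum_sq
  have h6 : ∑ x ∈ Hv, (dp x : ℝ) ^ 2 ≤ M := by
    refine le_trans ?_ hM
    rw [h2]
    push_cast
    exact Finset.sum_le_sum_of_subset_of_nonneg (Finset.filter_subset _ _) fun _ _ _ => by positivity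
  calc z ^ 2 ≤ (∑ x ∈ Hv, (dp x : ℝ)) ^ 2 := by gcongr
    _ ≤ _ := h5
    _ ≤ _ := by gcongr

/-- all labelled pairs which may be present -/
noncomputable def supp {k : ℕ} {W : Type} [Fintype W] (A : Finset (Fin k × Fin k)) (X : Fin k → Finset W) :
    Finset (Lab k W) := univ.filter fun y => y.1 ∈ A ∧ y.2.1 ∈ X y.1.1 ∧ y.2.2 ∈ X y.1.2

lemma supp_card {k : ℕ} {W : Type} [Fintype W] (A : Finset (Fin k × Fin k)) (X : Fin k → Finset W) (n : ℕ)
    (hX : ∀ i, (X i).card = n) : (supp A X).card ≤ A.card * n ^ 2 := by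
  have : supp A X ⊆ A.biUnion fun a => (X a.1 ×ˢ X a.2).image fun x => (a, x) := by
    intro y hy
    simp only [supp, Finset.mem_filter, mem_univ, true_and] at hy
    rw [Finset.mem_biUnion]
    exact ⟨y.1, hy.1, Finset.mem_image.2 ⟨y.2, Finset.mem_product.2 hy.2, rfl⟩⟩
  refine (Finset.card_le_card this).trans (Finset.card_biUnion_le.trans ?_)
  refine (Finset.sum_le_sum fun a _ => Finset.card_image_le).trans ?_
  simp only [Finset.card_product, hX, Finset.sum_const, smul_eq_mul]
  rw [sq]

/-- the internal inductive statement -/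
def IS {k : ℕ} (A : Finset (Fin k × Fin k)) (θ : ℝ) (F : Finset (Fin k × Fin k)) : Prop :=
  ∀ d : ℝ, 0 < d → ∃ ε ξ b C : ℝ, 0 < ε ∧ 0 < ξ ∧ 0 < b ∧ 0 < C ∧
    ∀ (W : Type) [Fintype W] (n : ℕ) (p : ℝ), 1 ≤ n → 0 < p → p ≤ 1 → C * (n:ℝ) ^ (-θ) ≤ p →
    ∀ (X : Fin k → Finset W) (G : Finset (Lab k W)), (∀ i, (X i).card = n) → G ⊆ supp A X →
    LR A G X (ε * n) d → 
    Pr p (fun Γ => ∃ S, S ⊆ Γ ∧ S ⊆ G ∧ (LR F S X (ε * n) (d * p) ∧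
      ((cop X A G F S).card : ℝ) < ξ * p ^ F.card * (n:ℝ) ^ k)) ≤ Real.exp (-(b * (p * (n:ℝ) ^ 2)))

/-- number of extensions of the pair `x` at `e` -/
noncomputable def dg {k : ℕ} {W : Type} [Fintype W] (X : Fin k → Finset W) (A : Finset (Fin k × Fin k))
    (G : Finset (Lab k W)) (F : Finset (Fin k × Fin k)) (e : Fin k × Fin k) (S : Finset (Lab k W)) 
    (x : W × W) : ℕ :=
  ((cop X (A.erase e) G F S).filter fun g => (g e.1, g e.2) = x).card

lemma scale_pn {θ C p : ℝ} {n : ℕ} (hθ1 : θ ≤ 1) (hn : 1 ≤ n) (hC : 0 < C) (h : C * (n:ℝ) ^ (-θ) ≤ p) :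
    C ≤ p * n ∧ C ≤ p * (n:ℝ) ^ 2 := by
  have hn1 : (1:ℝ) ≤ n := by exact_mod_cast hn
  have hn0 : (0:ℝ) < n := by linarith
  have h1 : (n:ℝ) ^ (-1:ℝ) ≤ (n:ℝ) ^ (-θ) := Real.rpow_le_rpow_of_exponent_le hn1 (by linarith)
  rw [Real.rpow_neg_one] at h1
  have h2 : C * (n:ℝ)⁻¹ ≤ p := le_trans (by gcongr) h
  have h3 : C ≤ p * n := by
    rw [← div_eq_mul_inv, div_le_iff₀ hn0] at h2; exact h2
  refine ⟨h3, ?_⟩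
  nlinarith

lemma scale_m {θ C C' μ p : ℝ} {n m : ℕ} (hθ0 : 0 < θ) (hθ1 : θ ≤ 1) (hn : 1 ≤ n) (hC : 0 < C) (hμ : 0 < μ)
    (hμ1 : μ ≤ 1) (hm : μ * n ≤ m) (hCC : C / μ ≤ C') (h : C' * (n:ℝ) ^ (-θ) ≤ p) :
    C * (m:ℝ) ^ (-θ) ≤ p := by
  have hn1 : (1:ℝ) ≤ n := by exact_mod_cast hn
  have hn0 : (0:ℝ) < n := by linarith
  have h1 : (m:ℝ) ^ (-θ) ≤ (μ * n) ^ (-θ) := 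
    Real.rpow_le_rpow_of_nonpos (by positivity) hm (by linarith)
  rw [Real.mul_rpow hμ.le hn0.le] at h1
  have h2 : μ ^ (-θ) ≤ μ ^ (-1:ℝ) := Real.rpow_le_rpow_of_exponent_ge hμ hμ1 (by linarith)
  rw [Real.rpow_neg_one] at h2
  have hp : 0 ≤ (n:ℝ) ^ (-θ) := by positivity
  calc C * (m:ℝ) ^ (-θ) ≤ C * (μ⁻¹ * (n:ℝ) ^ (-θ)) := by
        gcongr; exact h1.trans (by gcongr)
    _ = C / μ * (n:ℝ) ^ (-θ) := by ring
    _ ≤ C' * (n:ℝ) ^ (-θ) := by gcongr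
    _ ≤ p := h

lemma absorb {K b y : ℝ} (hb : 0 < b) (hK : 0 < K) (hy : 2 * K / b ≤ y) :
    K * Real.exp (-(b * y)) ≤ Real.exp (-(b / 2 * y)) := by
  rw [div_le_iff₀ hb] at hy
  have h1 : K ≤ Real.exp K := by have := Real.add_one_le_exp K; linarith
  calc K * Real.exp (-(b * y)) ≤ Real.exp K * Real.exp (-(b * y)) := by gcongr
    _ = Real.exp (K + -(b * y)) := by rw [Real.exp_add]
    _ ≤ _ := Real.exp_le_exp.2 (by linarith)

lemma half_pow_le {τ y : ℝ} {s : ℕ} (hτ : 0 < τ) (hy : 0 ≤ y) (hs : 1 ≤ s) (hbig : 4 * s / τ ≤ y) :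
    (1 / 2 : ℝ) ^ (⌊τ * y⌋₊ / s) ≤ Real.exp (-(τ / (4 * s) * y)) := by
  have hs0 : (0:ℝ) < s := by exact_mod_cast hs
  set r := ⌊τ * y⌋₊ / s with hr
  have h1 : τ * y < ⌊τ * y⌋₊ + 1 := Nat.lt_floor_add_one _
  have h2 : ⌊τ * y⌋₊ < (r + 1) * s := by
    rw [hr]; exact Nat.lt_mul_of_div_lt (Nat.lt_succ_self _) (by omega)
  have h3 : (⌊τ * y⌋₊ : ℝ) + 1 ≤ (r + 1) * s := by exact_mod_cast h2
  rw [div_le_iff₀ hτ] at hbig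
  have h4 : τ * y / (2 * s) ≤ r := by
    rw [div_le_iff₀ (by positivity)]
    nlinarith
  have h5 : (1 / 2 : ℝ) ≤ Real.exp (-(1 / 2)) := by
    have := Real.add_one_le_exp (-(1 / 2) : ℝ); linarith
  calc (1 / 2 : ℝ) ^ r ≤ (Real.exp (-(1 / 2))) ^ r := by gcongr
    _ = Real.exp (r * (-(1 / 2))) := by rw [Real.exp_nat_mul]
    _ ≤ _ := by
      apply Real.exp_le_exp.2
      have : τ / (4 * s) * y = (τ * y / (2 * s)) / 2 := by field_simp; ring
      rw [this]; linarith

set_option maxHeartbeats 2000000 in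
lemma growth {k : ℕ} {A : Finset (Fin k × Fin k)} (hA : ∀ a ∈ A, a.1 < a.2) {θ : ℝ} (hθ0 : 0 < θ) (hθ1 : θ ≤ 1)
    (hθ : BalH A θ) {e : Fin k × Fin k} (he : e ∈ A) {F : Finset (Fin k × Fin k)} (hFA : F ⊆ A.erase e)
    (hIS : IS A θ F) {d η d0 : ℝ} (hd : 0 < d) (hη : 0 < η) (hd0 : 0 < d0) :
    ∃ ε ξ c : ℝ, 0 < ε ∧ 0 < ξ ∧ 0 < c ∧ ∀ d'' : ℝ, d0 < d'' → ∃ b C : ℝ, 0 < b ∧ 0 < C ∧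
    ∀ (W : Type) [Fintype W] (n : ℕ) (p : ℝ), 1 ≤ n → 0 < p → p ≤ 1 → C * (n:ℝ) ^ (-θ) ≤ p →
    ∀ (X : Fin k → Finset W) (G : Finset (Lab k W)), (∀ i, (X i).card = n) → G ⊆ supp A X →
    LR A G X (ε * n) d → ∀ B ⊆ X e.1 ×ˢ X e.2, (∀ x ∈ B, (e, x) ∈ G) → η * (n:ℝ) ^ 2 ≤ B.card →
    Pr p (fun Γ => ∃ S, S ⊆ Γ ∧ S ⊆ G ∧ (LR F S X (ε * n) (d'' * p) ∧
      ((B.filter fun x => ξ * p ^ F.card * (n:ℝ) ^ k ≤ (n:ℝ) ^ 2 * dg X A G F e S x).card : ℝ) < c * (n:ℝ) ^ 2)) 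
      ≤ Real.exp (-(b * (p * (n:ℝ) ^ 2))) := by
  have heF : e ∉ F := fun h => (Finset.mem_erase.1 (hFA h)).1 rfl
  set dI := min d (min (η / 2) d0) with hdI
  have hdI0 : 0 < dI := lt_min hd (lt_min (by positivity) hd0)
  have hdId : dI ≤ d := min_le_left _ _
  have hdIη : dI ≤ η / 2 := (min_le_right _ _).trans (min_le_left _ _)
  have hdId0 : dI ≤ d0 := (min_le_right _ _).trans (min_le_right _ _)
  clear_value dI
  obtain ⟨εI, ξI, bI, CI, hεI, hξI, hbI, hCI, HIS⟩ := hIS dI hdI0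
  set ε' := min εI (1 / 4) with hε'
  have hε'0 : 0 < ε' := lt_min hεI (by norm_num)
  have hε'4 : ε' ≤ 1 / 4 := min_le_right _ _
  have hε'εI : ε' ≤ εI := min_le_left _ _
  clear_value ε'
  obtain ⟨μ, hμ0, hμ1, HD⟩ := lemD hε'0 hε'4 hη
  set ξ := ξI * μ ^ k / 2 with hξ
  have hξ0 : 0 < ξ := by positivity
  clear_value ξ
  obtain ⟨s, hs⟩ : ∃ s, s = 2 * F.card + 1 := ⟨_, rfl⟩
  refine ⟨ε' * μ, ξ, ξ ^ 2 / 2 ^ (k + 1), by positivity, hξ0, by positivity, ?_⟩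
  intro d'' hd''
  set ε := ε' * μ with hε
  have hε0 : 0 < ε := by positivity
  clear_value ε
  set τ := (d'' - d0) * ε ^ 2 with hτ
  have hτ0 : 0 < τ := mul_pos (by linarith) (by positivity)
  clear_value τ
  set b' := min (bI * μ ^ 2) (τ / (4 * s)) with hb'
  have hs0 : (0:ℝ) < s := by rw [hs]; positivity
  have hb'0 : 0 < b' := lt_min (by positivity) (by positivity)
  have hb'1 : b' ≤ bI * μ ^ 2 := min_le_left _ _
  have hb'2 : b' ≤ τ / (4 * s) := min_le_right _ _
  clear_value b'
  refine ⟨b' / 2, max (max 1 (CI / μ)) (max (4 * s / τ) (2 * 2 / b')), by positivity, by positivity, ?_⟩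
  set C := max (max 1 (CI / μ)) (max (4 * s / τ) (2 * 2 / b')) with hC
  have hC1 : 1 ≤ C := (le_max_left _ _).trans (le_max_left _ _)
  have hC2 : CI / μ ≤ C := (le_max_right _ _).trans (le_max_left _ _)
  have hC3 : 4 * s / τ ≤ C := (le_max_left _ _).trans (le_max_right _ _)
  have hC4 : 2 * 2 / b' ≤ C := (le_max_right _ _).trans (le_max_right _ _)
  clear_value C
  intro W _ n p hn hp hp1 hCp X G hX hGs hG B hB hBG hBc
  have hn1 : (1:ℝ) ≤ n := by exact_mod_cast hn
  have hn0 : (0:ℝ) < n := by linarith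
  obtain ⟨hpn, hpn2⟩ := scale_pn hθ1 hn (by linarith) hCp
  obtain ⟨U, hU, V, hV, m, hm1, cU, cV, hmμ, hUV⟩ := HD W n (X e.1) (X e.2) B hn (hX _) (hX _) hB hBc
  have hmn : m ≤ n := by rw [← cU, ← hX e.1]; exact Finset.card_le_card hU
  have hee : e.1 ≠ e.2 := (hA e he).ne
  -- the restricted system
  have hsub : ∀ i, ∃ Y ⊆ X i, Y.card = m := fun i => Finset.exists_subset_card_eq (by rw [hX]; exact hmn)
  choose Y0 hY0 cY0 using hsub
  let X' : Fin k → Finset W := fun i => if i = e.1 then U else if i = e.2 then V else Y0 i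
  have hX'e1 : X' e.1 = U := by simp [X']
  have hX'e2 : X' e.2 = V := by simp [X', hee.symm]
  have hX'X : ∀ i, X' i ⊆ X i := by
    intro i
    by_cases h1 : i = e.1
    · rw [h1, hX'e1]; exact hU
    · by_cases h2 : i = e.2
      · rw [h2, hX'e2]; exact hV
      · simpa [X', h1, h2] using hY0 i
  have hX' : ∀ i, (X' i).card = m := by
    intro i
    by_cases h1 : i = e.1
    · rw [h1, hX'e1]; exact cU
    · by_cases h2 : i = e.2
      · rw [h2, hX'e2]; exact cV
      · simpa [X', h1, h2] using cY0 i
  let G' : Finset (Lab k W) := (G ∩ supp A X').filter fun y => y.1 = e → y.2 ∈ B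
  have hG'G : G' ⊆ G := (Finset.filter_subset _ _).trans Finset.inter_subset_left
  have hG's : G' ⊆ supp A X' := (Finset.filter_subset _ _).trans Finset.inter_subset_right
  have hεm : ε * n ≤ ε' * m := by rw [hε, mul_assoc]; gcongr
  have hmemG' : ∀ a ∈ A, ∀ x : W × W, x.1 ∈ X' a.1 → x.2 ∈ X' a.2 → (a = e → x ∈ B) → (a, x) ∈ G → 
      (a, x) ∈ G' := by
    intro a ha x h1 h2 h3 h4
    refine Finset.mem_filter.2 ⟨Finset.mem_inter.2 ⟨h4, ?_⟩, h3⟩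
    simp only [supp, Finset.mem_filter, mem_univ, true_and]
    exact ⟨ha, h1, h2⟩
  have hG'B : ∀ x, (e, x) ∈ G' → x ∈ B := fun x hx => (Finset.mem_filter.1 hx).2 rfl
  clear_value G' X'
  have hLRG' : LR A G' X' (ε' * m) dI := by
    intro a ha P hP Q hQ hPm hQm
    by_cases hae : a = e
    · have h1 := hUV P (by rw [← hX'e1, ← hae]; exact hP) Q (by rw [← hX'e2, ← hae]; exact hQ) hPm hQm
      have h2 : ((P ×ˢ Q).filter (· ∈ B)).card ≤ ee G' a P Q := by
        apply Finset.card_le_card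
        intro x hx
        rw [Finset.mem_filter, Finset.mem_product] at hx
        refine Finset.mem_filter.2 ⟨Finset.mem_product.2 hx.1, ?_⟩
        exact hmemG' a ha x (hP hx.1.1) (hQ hx.1.2) (fun _ => hx.2) (by rw [hae]; exact hBG x hx.2)
      have h3 : (((P ×ˢ Q).filter (· ∈ B)).card : ℝ) ≤ ee G' a P Q := by exact_mod_cast h2
      have h4 : dI * ((P.card : ℝ) * Q.card) ≤ η / 2 * ((P.card : ℝ) * Q.card) := by gcongr
      linarith
    · have h1 := hG a ha P (hP.trans (hX'X _)) Q (hQ.trans (hX'X _)) (hεm.trans hPm) (hεm.trans hQm)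
      have h2 : ee G a P Q ≤ ee G' a P Q := by
        apply Finset.card_le_card
        intro x hx
        rw [Finset.mem_filter, Finset.mem_product] at hx
        refine Finset.mem_filter.2 ⟨Finset.mem_product.2 hx.1, ?_⟩
        exact hmemG' a ha x (hP hx.1.1) (hQ hx.1.2) (fun h => absurd h hae) hx.2
      have h3 : (ee G a P Q : ℝ) ≤ ee G' a P Q := by exact_mod_cast h2
      have h4 : dI * ((P.card : ℝ) * Q.card) ≤ d * ((P.card : ℝ) * Q.card) := by gcongr
      linarith
  have hε'I : ε' * m ≤ εI * m := by gcongr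
  -- the two exceptional events
  have hmp : CI * (m:ℝ) ^ (-θ) ≤ p := scale_m hθ0 hθ1 hn hCI hμ0 hμ1 hmμ hC2 hCp
  have E1 := HIS W m p hm1 hp hp1 hmp X' G' hX' hG's (LR_mono subset_rfl hε'I le_rfl hLRG')
  set I := (Fintype.piFinset X ×ˢ Fintype.piFinset X).filter 
      (fun x => x.1 e.1 = x.2 e.1 ∧ x.1 e.2 = x.2 e.2) with hI
  clear_value I
  set M := 2 ^ k * p ^ (2 * F.card) * (n:ℝ) ^ (2 * k) / (n:ℝ) ^ 2 with hM
  have hM0 : 0 < M := by positivity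
  clear_value M
  have hpθ : (n:ℝ) ^ (-θ) ≤ p := by
    refine le_trans ?_ hCp
    have : 0 ≤ (n:ℝ) ^ (-θ) := by positivity
    nlinarith
  have hsm : ∑ x ∈ I, p ^ (hF F x.1 ∪ hF F x.2).card ≤ M := 
    by rw [hI, hM]; exact second_moment hθ0 hθ he hFA hn hp hp1 hpθ X hX
  set t := ⌊τ * (p * (n:ℝ) ^ 2)⌋₊ with ht
  clear_value t
  have E2 := deletion I (fun x => hF F x.1 ∪ hF F x.2) hp.le hp1 hM0 hsm s t (t / s) 
    (by
      intro x _
      have := Finset.card_union_le (hF F x.1) (hF F x.2)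
      rw [hF_card, hF_card] at this
      omega) (Nat.div_mul_le_self _ _)
  have E2' : (1 / 2 : ℝ) ^ (t / s) ≤ Real.exp (-(τ / (4 * s) * (p * (n:ℝ) ^ 2))) := 
    by rw [ht]; exact half_pow_le hτ0 (by positivity) (by omega) (hC3.trans hpn2)
  have hcover : Pr p (fun Γ => ∃ S, S ⊆ Γ ∧ S ⊆ G ∧ (LR F S X (ε * n) (d'' * p) ∧
      ((B.filter fun x => ξ * p ^ F.card * (n:ℝ) ^ k ≤ (n:ℝ) ^ 2 * dg X A G F e S x).card : ℝ) < 
        ξ ^ 2 / 2 ^ (k + 1) * (n:ℝ) ^ 2)) ≤ 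
      Real.exp (-(bI * (p * (m:ℝ) ^ 2))) + Real.exp (-(τ / (4 * s) * (p * (n:ℝ) ^ 2))) := by
    refine le_trans ?_ (add_le_add E1 (E2.trans E2'))
    refine le_trans (Pr_mono hp.le hp1 ?_) (Pr_or_le hp.le hp1 _ _)
    rintro Γ ⟨S, hSΓ, hSG, hSLR, hScount⟩
    by_contra hcon
    rw [not_or] at hcon
    obtain ⟨hc1, hc2⟩ := hcon
    push Not at hc2
    obtain ⟨D, hDt, hDc⟩ := hc2
    set S' := (S ∩ G') \ D with hS'
    have hS'S : S' ⊆ S := Finset.sdiff_subset.trans Finset.inter_subset_left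
    have hS'G' : S' ⊆ G' := Finset.sdiff_subset.trans Finset.inter_subset_right
    have hS'mem : ∀ y, y ∈ S → y ∈ G' → y ∉ D → y ∈ S' := fun y h1 h2 h3 =>
      Finset.mem_sdiff.2 ⟨Finset.mem_inter.2 ⟨h1, h2⟩, h3⟩
    have hS'D : Disjoint S' D := Finset.sdiff_disjoint
    clear_value S'
    have hS'LR : LR F S' X' (ε' * m) (dI * p) := by
      intro a ha P hP Q hQ hPm hQm
      have hPn := hεm.trans hPm
      have hQn := hεm.trans hQm
      have h1 := hSLR a ha P (hP.trans (hX'X _)) Q (hQ.trans (hX'X _)) hPn hQn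
      have hae : a ≠ e := fun h => heF (h ▸ ha)
      have h2 : ee S a P Q ≤ ee S' a P Q + D.card := by
        have : ((P ×ˢ Q).filter fun x => (a, x) ∈ S) ⊆ ((P ×ˢ Q).filter fun x => (a, x) ∈ S') ∪ 
            D.image Prod.snd := by
          intro x hx
          rw [Finset.mem_filter, Finset.mem_product] at hx
          rw [Finset.mem_union]
          by_cases hxD : (a, x) ∈ D
          · right
            exact Finset.mem_image.2 ⟨(a, x), hxD, rfl⟩
          · left
            refine Finset.mem_filter.2 ⟨Finset.mem_product.2 hx.1, ?_⟩
            refine hS'mem _ hx.2 ?_ hxD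
            exact hmemG' a (Finset.mem_of_mem_erase (hFA ha)) x (hP hx.1.1) (hQ hx.1.2) 
              (fun h => absurd h hae) (hSG hx.2)
        refine (Finset.card_le_card this).trans ((Finset.card_union_le _ _).trans ?_)
        exact Nat.add_le_add_left Finset.card_image_le _
      have h3 : (ee S a P Q : ℝ) ≤ ee S' a P Q + D.card := by exact_mod_cast h2
      have h4 : (D.card : ℝ) ≤ τ * (p * (n:ℝ) ^ 2) := by
        have : (D.card : ℝ) ≤ t := by exact_mod_cast hDt
        rw [ht] at this; exact this.trans (Nat.floor_le (by positivity))
      have h5 : (ε * n) * (ε * n) ≤ (P.card : ℝ) * Q.card := by gcongr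
      have h6 : τ * (p * (n:ℝ) ^ 2) ≤ (d'' - d0) * p * ((P.card : ℝ) * Q.card) := by
        calc τ * (p * (n:ℝ) ^ 2) = (d'' - d0) * p * ((ε * n) * (ε * n)) := by rw [hτ]; ring
          _ ≤ _ := by
            have : 0 ≤ (d'' - d0) * p := mul_nonneg (by linarith) hp.le
            gcongr
      have h7 : dI * p * ((P.card : ℝ) * Q.card) ≤ d0 * p * ((P.card : ℝ) * Q.card) := by gcongr
      linarith
    have hcop : ξI * p ^ F.card * (m:ℝ) ^ k ≤ (cop X' A G' F S').card := by
      by_contra hlt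
      push Not at hlt
      exact hc1 ⟨S', hS'S.trans hSΓ, hS'G', LR_mono subset_rfl hε'I le_rfl hS'LR, hlt⟩
    set N := cop X' A G' F S' with hN
    have hNmem : ∀ g ∈ N, (∀ i, g i ∈ X' i) ∧ (∀ a ∈ A, (a, (g a.1, g a.2)) ∈ G') ∧
        ∀ a ∈ F, (a, (g a.1, g a.2)) ∈ S' := by
      intro g hg
      simpa [hN, cop] using hg
    clear_value N
    have hNB : ∀ g ∈ N, (g e.1, g e.2) ∈ B := by
      intro g hg
      have := (hNmem g hg).2.1 e he
      exact hG'B _ this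
    have hz2 : 2 * (ξ * p ^ F.card * (n:ℝ) ^ k) ≤ N.card := by
      refine le_trans ?_ hcop
      calc 2 * (ξ * p ^ F.card * (n:ℝ) ^ k) = ξI * p ^ F.card * (μ * n) ^ k := by rw [hξ]; ring
        _ ≤ _ := by gcongr
    have hBn : (B.card : ℝ) ≤ (n:ℝ) ^ 2 := by
      have := Finset.card_le_card hB
      rw [Finset.card_product, hX, hX] at this
      rw [sq]; exact_mod_cast this
    have hMc : (((N ×ˢ N).filter fun x => x.1 e.1 = x.2 e.1 ∧ x.1 e.2 = x.2 e.2).card : ℝ) ≤ 2 * M := by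
      refine le_trans ?_ hDc.le
      have : ((N ×ˢ N).filter fun x => x.1 e.1 = x.2 e.1 ∧ x.1 e.2 = x.2 e.2) ⊆ 
          (I.filter fun i => (hF F i.1 ∪ hF F i.2) ⊆ Γ ∧ Disjoint (hF F i.1 ∪ hF F i.2) D) := by
        intro x hx
        rw [Finset.mem_filter, Finset.mem_product] at hx
        have sub : hF F x.1 ∪ hF F x.2 ⊆ S' := Finset.union_subset
          ((hF_subset _ _ _).2 (hNmem _ hx.1.1).2.2) ((hF_subset _ _ _).2 (hNmem _ hx.1.2).2.2)
        rw [hI]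
        refine Finset.mem_filter.2 ⟨Finset.mem_filter.2 ⟨Finset.mem_product.2 ⟨?_, ?_⟩, hx.2⟩, ?_, ?_⟩
        · exact Fintype.mem_piFinset.2 fun i => hX'X i ((hNmem _ hx.1.1).1 i)
        · exact Fintype.mem_piFinset.2 fun i => hX'X i ((hNmem _ hx.1.2).1 i)
        · exact (sub.trans hS'S).trans hSΓ
        · exact Finset.disjoint_of_subset_left sub hS'D
      exact_mod_cast Finset.card_le_card this
    have core := cs_core N B e n hn hNB hBn (dg X A G F e S) (by
      intro x hx
      apply Finset.card_le_card
      intro g hg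
      rw [Finset.mem_filter] at hg ⊢
      refine ⟨?_, hg.2⟩
      have := hNmem g hg.1
      simp only [cop, Finset.mem_filter, mem_univ, true_and]
      exact ⟨fun i => hX'X i (this.1 i), fun a ha => hG'G (this.2.1 a (Finset.mem_of_mem_erase ha)),
        fun a ha => hS'S (this.2.2 a ha)⟩) (2 * M) (ξ * p ^ F.card * (n:ℝ) ^ k) (by positivity) hMc hz2
    have : ((B.filter fun x => ξ * p ^ F.card * (n:ℝ) ^ k ≤ (n:ℝ) ^ 2 * dg X A G F e S x).card : ℝ) * (2 * M)
        < ξ ^ 2 / 2 ^ (k + 1) * (n:ℝ) ^ 2 * (2 * M) := by gcongr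
    have e1 : ξ ^ 2 / 2 ^ (k + 1) * (n:ℝ) ^ 2 * (2 * M) = (ξ * p ^ F.card * (n:ℝ) ^ k) ^ 2 := by
      rw [hM]; field_simp; ring
    linarith
  refine hcover.trans ?_
  have hy : 2 * 2 / b' ≤ p * (n:ℝ) ^ 2 := hC4.trans hpn2
  refine le_trans ?_ (absorb hb'0 (by norm_num) hy)
  have q0 : 0 ≤ p * (n:ℝ) ^ 2 := by positivity
  have q1 : Real.exp (-(bI * (p * (m:ℝ) ^ 2))) ≤ Real.exp (-(b' * (p * (n:ℝ) ^ 2))) := by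
    apply Real.exp_le_exp.2
    have : b' * (p * (n:ℝ) ^ 2) ≤ bI * (p * (m:ℝ) ^ 2) := by
      calc b' * (p * (n:ℝ) ^ 2) ≤ bI * μ ^ 2 * (p * (n:ℝ) ^ 2) := by gcongr
        _ = bI * (p * (μ * n) ^ 2) := by ring
        _ ≤ _ := by gcongr
    linarith
  have q2 : Real.exp (-(τ / (4 * s) * (p * (n:ℝ) ^ 2))) ≤ Real.exp (-(b' * (p * (n:ℝ) ^ 2))) := by
    apply Real.exp_le_exp.2
    have : b' * (p * (n:ℝ) ^ 2) ≤ τ / (4 * s) * (p * (n:ℝ) ^ 2) := by gcongr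
    linarith
  linarith

lemma exists_p2 {p δ : ℝ} (hp : 0 < p) (hp1 : p ≤ 1) (hδ : 0 < δ) (hδ2 : δ ≤ 1 / 2) :
    ∃ p2 : ℝ, 1 - p = (1 - δ * p) * (1 - p2) := by
  have : 1 - δ * p ≠ 0 := by nlinarith
  refine ⟨1 - (1 - p) / (1 - δ * p), ?_⟩
  rw [sub_sub_cancel, mul_div_cancel₀ _ this]

lemma round_bound {p δ β b1 K P1 N : ℝ} {g : ℕ} (hp : 0 < p) (hδ : 0 < δ) (hN : 0 ≤ N)
    (hP1 : P1 ≤ Real.exp (-(b1 * (δ * p * N)))) (hb1 : 0 < b1) (hβ : 0 < β)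
    (hg : (g:ℝ) ≤ K * N) (hδK : δ * K ≤ β / 2) (hbig : 2 * 4 / (min (b1 * δ) (β / 2)) ≤ p * N) :
    2 * (P1 + (1 + δ * p) ^ g * Real.exp (-(β * (p * N)))) ≤ 
      Real.exp (-(min (b1 * δ) (β / 2) / 2 * (p * N))) := by
  set b' := min (b1 * δ) (β / 2) with hb'
  have hb'0 : 0 < b' := lt_min (by positivity) (by positivity)
  have h1 : b' ≤ b1 * δ := min_le_left _ _
  have h2 : b' ≤ β / 2 := min_le_right _ _
  clear_value b'
  refine le_trans ?_ (absorb hb'0 (by norm_num) hbig)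
  have hpN : 0 ≤ p * N := by positivity
  have q1 : P1 ≤ Real.exp (-(b' * (p * N))) := by
    refine hP1.trans (Real.exp_le_exp.2 ?_)
    have : b' * (p * N) ≤ b1 * δ * (p * N) := by gcongr
    linarith
  have q2 : (1 + δ * p) ^ g * Real.exp (-(β * (p * N))) ≤ Real.exp (-(b' * (p * N))) := by
    have r1 : (1 + δ * p) ^ g ≤ Real.exp (g * (δ * p)) := by
      rw [Real.exp_nat_mul]
      have : 1 + δ * p ≤ Real.exp (δ * p) := by
        have := Real.add_one_le_exp (δ * p); linarith
      gcongr
    calc _ ≤ Real.exp (g * (δ * p)) * Real.exp (-(β * (p * N))) := by gcongr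
      _ = Real.exp (g * (δ * p) + -(β * (p * N))) := by rw [Real.exp_add]
      _ ≤ _ := by
        apply Real.exp_le_exp.2
        have a1 : g * (δ * p) ≤ K * N * (δ * p) := by gcongr
        have a2 : δ * K * (p * N) ≤ β / 2 * (p * N) := by gcongr
        have a3 : b' * (p * N) ≤ β / 2 * (p * N) := by gcongr
        linarith
  linarith

section pr
variable {k : ℕ} {W : Type} [Fintype W]

/-- pairs at `e` with few extensions -/
noncomputable def poor (X : Fin k → Finset W) (A : Finset (Fin k × Fin k))
    (G : Finset (Lab k W)) (F : Finset (Fin k × Fin k)) (e : Fin k × Fin k) (n : ℕ) (z : ℝ) 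
    (S : Finset (Lab k W)) : Finset (W × W) :=
  (X e.1 ×ˢ X e.2).filter fun x => (e, x) ∈ G ∧ (n:ℝ) ^ 2 * dg X A G F e S x < z

/-- pairs at `e` with many extensions -/
noncomputable def rich (X : Fin k → Finset W) (A : Finset (Fin k × Fin k))
    (G : Finset (Lab k W)) (F : Finset (Fin k × Fin k)) (e : Fin k × Fin k) (n : ℕ) (z : ℝ) 
    (S : Finset (Lab k W)) : Finset (W × W) :=
  (X e.1 ×ˢ X e.2).filter fun x => (e, x) ∈ G ∧ z ≤ (n:ℝ) ^ 2 * dg X A G F e S x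

lemma dg_mono (X : Fin k → Finset W) (A : Finset (Fin k × Fin k))
    (G : Finset (Lab k W)) (F : Finset (Fin k × Fin k)) (e : Fin k × Fin k) {S T : Finset (Lab k W)}
    (h : S ⊆ T) (x : W × W) : dg X A G F e S x ≤ dg X A G F e T x := by
  apply Finset.card_le_card
  apply Finset.filter_subset_filter
  intro g hg
  simp only [cop, Finset.mem_filter, mem_univ, true_and] at hg ⊢
  exact ⟨hg.1, hg.2.1, fun a ha => h (hg.2.2 a ha)⟩

lemma poor_mono (X : Fin k → Finset W) (A : Finset (Fin k × Fin k))
    (G : Finset (Lab k W)) (F : Finset (Fin k × Fin k)) (e : Fin k × Fin k) (n : ℕ) {z z' : ℝ} 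
    {S T : Finset (Lab k W)} (h : T ⊆ S) (hz : z ≤ z') :
    poor X A G F e n z S ⊆ poor X A G F e n z' T := by
  intro x hx
  simp only [poor, Finset.mem_filter] at hx ⊢
  refine ⟨hx.1, hx.2.1, ?_⟩
  have : (dg X A G F e T x : ℝ) ≤ dg X A G F e S x := by exact_mod_cast dg_mono X A G F e h x
  have : (n:ℝ) ^ 2 * dg X A G F e T x ≤ (n:ℝ) ^ 2 * dg X A G F e S x := by gcongr
  linarith [hx.2.2]

lemma rich_mono (X : Fin k → Finset W) (A : Finset (Fin k × Fin k))
    (G : Finset (Lab k W)) (F : Finset (Fin k × Fin k)) (e : Fin k × Fin k) (n : ℕ) {z z' : ℝ} 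
    {S T : Finset (Lab k W)} (h : T ⊆ S) (hz : z ≤ z') :
    rich X A G F e n z' T ⊆ rich X A G F e n z S := by
  intro x hx
  simp only [rich, Finset.mem_filter] at hx ⊢
  refine ⟨hx.1, hx.2.1, ?_⟩
  have : (dg X A G F e T x : ℝ) ≤ dg X A G F e S x := by exact_mod_cast dg_mono X A G F e h x
  have : (n:ℝ) ^ 2 * dg X A G F e T x ≤ (n:ℝ) ^ 2 * dg X A G F e S x := by gcongr
  linarith [hx.2.2]

lemma rich_step (X : Fin k → Finset W) (A : Finset (Fin k × Fin k))
    (G : Finset (Lab k W)) (F : Finset (Fin k × Fin k)) (e : Fin k × Fin k) (n : ℕ) {z z1 z2 : ℝ} 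
    {S T1 T2 : Finset (Lab k W)} (h1 : T1 ⊆ S) (h2 : T2 ⊆ S) (hz1 : z ≤ z1) (hz2 : z ≤ z2) :
    (rich X A G F e n z1 T1).card + ((poor X A G F e n z1 T1).filter fun x => 
      z2 ≤ (n:ℝ) ^ 2 * dg X A G F e T2 x).card ≤ (rich X A G F e n z S).card := by
  rw [← Finset.card_union_of_disjoint]
  · apply Finset.card_le_card
    apply Finset.union_subset (rich_mono X A G F e n h1 hz1)
    refine subset_trans ?_ (rich_mono X A G F e n h2 hz2)
    intro x hx
    simp only [rich, poor, Finset.mem_filter] at hx ⊢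
    exact ⟨hx.1.1, hx.1.2.1, hx.2⟩
  · rw [Finset.disjoint_left]
    intro x hx hx'
    simp only [rich, poor, Finset.mem_filter] at hx hx'
    linarith [hx.2.2, hx'.1.2.2]

end pr

set_option maxHeartbeats 1000000 in
lemma rounds {k : ℕ} {A : Finset (Fin k × Fin k)} {θ : ℝ} (hθ0 : 0 < θ) (hθ1 : θ ≤ 1)
    {e : Fin k × Fin k} {F : Finset (Fin k × Fin k)} {d η d0 ε0 ξ0 c : ℝ} (hd : 0 < d) (hη : 0 < η) 
    (hd0 : 0 < d0) (hε0 : 0 < ε0) (hξ0 : 0 < ξ0) (hc : 0 < c)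
    (hgrow : ∀ d'' : ℝ, d0 < d'' → ∃ b C : ℝ, 0 < b ∧ 0 < C ∧
      ∀ (W : Type) [Fintype W] (n : ℕ) (p : ℝ), 1 ≤ n → 0 < p → p ≤ 1 → C * (n:ℝ) ^ (-θ) ≤ p →
      ∀ (X : Fin k → Finset W) (G : Finset (Lab k W)), (∀ i, (X i).card = n) → G ⊆ supp A X →
      LR A G X (ε0 * n) d → ∀ B ⊆ X e.1 ×ˢ X e.2, (∀ x ∈ B, (e, x) ∈ G) → η * (n:ℝ) ^ 2 ≤ B.card →
      Pr p (fun Γ => ∃ S, S ⊆ Γ ∧ S ⊆ G ∧ (LR F S X (ε0 * n) (d'' * p) ∧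
        ((B.filter fun x => ξ0 * p ^ F.card * (n:ℝ) ^ k ≤ (n:ℝ) ^ 2 * dg X A G F e S x).card : ℝ) < c * (n:ℝ) ^ 2)) 
        ≤ Real.exp (-(b * (p * (n:ℝ) ^ 2)))) :
    ∀ (s : ℕ) (d' : ℝ), d0 < d' → ∃ ε ξ b C : ℝ, 0 < ε ∧ 0 < ξ ∧ 0 < b ∧ 0 < C ∧
    ∀ (W : Type) [Fintype W] (n : ℕ) (p : ℝ), 1 ≤ n → 0 < p → p ≤ 1 → C * (n:ℝ) ^ (-θ) ≤ p →
    ∀ (X : Fin k → Finset W) (G : Finset (Lab k W)), (∀ i, (X i).card = n) → G ⊆ supp A X →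
    LR A G X (ε * n) d → 
    Pr p (fun Γ => ∃ S, S ⊆ Γ ∧ S ⊆ G ∧ (LR F S X (ε * n) (d' * p) ∧
      η * (n:ℝ) ^ 2 < (poor X A G F e n (ξ * p ^ F.card * (n:ℝ) ^ k) S).card ∧
      ((rich X A G F e n (ξ * p ^ F.card * (n:ℝ) ^ k) S).card : ℝ) < s * c * (n:ℝ) ^ 2)) ≤ 
      Real.exp (-(b * (p * (n:ℝ) ^ 2))) := by
  intro s
  induction s with
  | zero =>
    intro d' hd'
    refine ⟨1, 1, 1, 1, one_pos, one_pos, one_pos, one_pos, ?_⟩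
    intro W _ n p hn hp hp1 _ X G _ _ _
    refine le_trans (Pr_mono hp.le hp1 (Ev' := fun _ => False) ?_) ?_
    · rintro Γ ⟨S, _, _, _, _, h⟩
      have : (0:ℝ) ≤ (rich X A G F e n (1 * p ^ F.card * (n:ℝ) ^ k) S).card := by positivity
      simp only [Nat.cast_zero, zero_mul] at h
      linarith
    · rw [Pr_false]; positivity
  | succ s ih =>
    intro d' hd'
    set d'' := (d0 + d') / 2 with hd''
    have h0'' : d0 < d'' := by rw [hd'']; linarith
    have h'' : d'' < d' := by rw [hd'']; linarith
    clear_value d''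
    obtain ⟨ε1, ξ1, b1, C1, hε1, hξ1, hb1, hC1, H1⟩ := ih d'' h0''
    obtain ⟨bg, Cg, hbg, hCg, Hg⟩ := hgrow d'' h0''
    clear ih hgrow
    obtain ⟨δ, hδ, hδ2, hδK⟩ : ∃ δ : ℝ, 0 < δ ∧ δ ≤ 1 / 2 ∧ δ * A.card ≤ bg / 2 / 2 := by
      refine ⟨min (1 / 2) (bg / 2 / 2 / (A.card + 1)), by positivity, min_le_left _ _, ?_⟩
      have : min (1 / 2) (bg / 2 / 2 / ((A.card:ℝ) + 1)) * A.card ≤ bg / 2 / 2 / (A.card + 1) * (A.card + 1) := by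
        gcongr
        · exact min_le_right _ _
        · linarith
      refine this.trans (le_of_eq ?_)
      field_simp
    obtain ⟨ε, hε, hεε1, hεε0⟩ : ∃ ε : ℝ, 0 < ε ∧ ε ≤ ε1 ∧ ε ≤ ε0 := 
      ⟨min ε1 ε0, lt_min hε1 hε0, min_le_left _ _, min_le_right _ _⟩
    obtain ⟨ξ, hξ, hξξ1, hξξ0⟩ : ∃ ξ : ℝ, 0 < ξ ∧ ξ ≤ ξ1 * δ ^ F.card ∧ ξ ≤ ξ0 * (1 / 2) ^ F.card := 
      ⟨min (ξ1 * δ ^ F.card) (ξ0 * (1 / 2) ^ F.card), by positivity, min_le_left _ _, min_le_right _ _⟩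
    obtain ⟨Ct, hCt, Ht⟩ := two_round F hε (hd0.trans h0'') h'' hδ hδ2
    have hbm : 0 < min (b1 * δ) (bg / 2 / 2) := by positivity
    obtain ⟨C, hC, hCa, hCb, hCc, hCd⟩ : ∃ C : ℝ, 0 < C ∧ Ct ≤ C ∧ C1 / δ ≤ C ∧ 2 * Cg ≤ C ∧ 
        2 * 4 / min (b1 * δ) (bg / 2 / 2) ≤ C := by
      refine ⟨max (max Ct (C1 / δ)) (max (2 * Cg) (2 * 4 / min (b1 * δ) (bg / 2 / 2))), by positivity, 
        ?_, ?_, ?_, ?_⟩ <;> simp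
    refine ⟨ε, ξ, min (b1 * δ) (bg / 2 / 2) / 2, C, hε, hξ, by positivity, hC, ?_⟩
    intro W _ n p hn hp hp1 hCp X G hX hGs hG
    have hn1 : (1:ℝ) ≤ n := by exact_mod_cast hn
    have hn0 : (0:ℝ) < n := by linarith
    have hθn : 0 < (n:ℝ) ^ (-θ) := by positivity
    obtain ⟨hpn, hpn2⟩ := scale_pn hθ1 hn hC hCp
    obtain ⟨p2, hp2⟩ := exists_p2 hp hp1 hδ hδ2
    obtain ⟨hb1', hb2'⟩ := p2_bounds hp hp1 hδ hδ2 hp2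
    have hp20 : 0 < p2 := by linarith
    have hδp : 0 < δ * p := by positivity
    set z := ξ * p ^ F.card * (n:ℝ) ^ k with hz
    set z1 := ξ1 * (δ * p) ^ F.card * (n:ℝ) ^ k with hz1
    set z2 := ξ0 * p2 ^ F.card * (n:ℝ) ^ k with hz2
    have hzz1 : z ≤ z1 := by
      calc z ≤ ξ1 * δ ^ F.card * p ^ F.card * (n:ℝ) ^ k := by rw [hz]; gcongr
        _ = z1 := by rw [hz1, mul_pow]; ring
    have hzz2 : z ≤ z2 := by
      calc z ≤ ξ0 * (1 / 2) ^ F.card * p ^ F.card * (n:ℝ) ^ k := by rw [hz]; gcongr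
        _ = ξ0 * (p / 2) ^ F.card * (n:ℝ) ^ k := by rw [div_pow, div_pow]; ring
        _ ≤ z2 := by rw [hz2]; gcongr
    have E1 := H1 W n (δ * p) hn hδp (by nlinarith) (by
      rw [div_le_iff₀ hδ] at hCb
      calc C1 * (n:ℝ) ^ (-θ) ≤ C * δ * (n:ℝ) ^ (-θ) := by gcongr
        _ = δ * (C * (n:ℝ) ^ (-θ)) := by ring
        _ ≤ _ := by gcongr) X G hX hGs (LR_mono subset_rfl (by gcongr) le_rfl hG)
    rw [← hz1] at E1
    clear_value z z1
    have tr := Ht W n p p2 hn hp hp1 (hCa.trans hpn) hp2 X hX G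
      (fun S => LR F S X (ε * n) (d' * p) ∧ η * (n:ℝ) ^ 2 < (poor X A G F e n z S).card ∧
        ((rich X A G F e n z S).card : ℝ) < (s + 1 : ℕ) * c * (n:ℝ) ^ 2)
      (fun Γ => ∃ S, S ⊆ Γ ∧ S ⊆ G ∧ (LR F S X (ε1 * n) (d'' * (δ * p)) ∧ 
        η * (n:ℝ) ^ 2 < (poor X A G F e n z1 S).card ∧
        ((rich X A G F e n z1 S).card : ℝ) < s * c * (n:ℝ) ^ 2))
      (fun T Γ => η * (n:ℝ) ^ 2 ≤ (poor X A G F e n z1 T).card ∧ ∃ S, S ⊆ Γ ∧ S ⊆ G ∧ 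
        (LR F S X (ε0 * n) (d'' * p2) ∧ (((poor X A G F e n z1 T).filter fun x => 
          z2 ≤ (n:ℝ) ^ 2 * dg X A G F e S x).card : ℝ) < c * (n:ℝ) ^ 2))
      (Real.exp (-(bg / 2 * (p * (n:ℝ) ^ 2)))) (fun S hS => hS.1) (by
        intro Γ1 Γ2 S hSΓ hSG hbad hL1 hL2
        obtain ⟨-, hpo, hri⟩ := hbad
        by_contra hcon
        rw [not_or] at hcon
        obtain ⟨n1, n2⟩ := hcon
        have hpT : η * (n:ℝ) ^ 2 < (poor X A G F e n z1 (S ∩ Γ1)).card := by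
          refine hpo.trans_le ?_
          exact_mod_cast Finset.card_le_card (poor_mono X A G F e n Finset.inter_subset_left hzz1)
        have r1 : s * c * (n:ℝ) ^ 2 ≤ (rich X A G F e n z1 (S ∩ Γ1)).card := by
          by_contra h
          push Not at h
          exact n1 ⟨S ∩ Γ1, Finset.inter_subset_right, Finset.inter_subset_left.trans hSG, 
            LR_mono subset_rfl (by gcongr) le_rfl hL1, hpT, h⟩
        have r2 : c * (n:ℝ) ^ 2 ≤ ((poor X A G F e n z1 (S ∩ Γ1)).filter fun x => 
          z2 ≤ (n:ℝ) ^ 2 * dg X A G F e (S ∩ Γ2) x).card := by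
          by_contra h
          push Not at h
          exact n2 ⟨hpT.le, S ∩ Γ2, Finset.inter_subset_right, Finset.inter_subset_left.trans hSG, 
            LR_mono subset_rfl (by gcongr) le_rfl hL2, h⟩
        have r3 := rich_step X A G F e n (S := S) (T1 := S ∩ Γ1) (T2 := S ∩ Γ2) 
          Finset.inter_subset_left Finset.inter_subset_left hzz1 hzz2
        have r4 : ((rich X A G F e n z1 (S ∩ Γ1)).card : ℝ) + ((poor X A G F e n z1 (S ∩ Γ1)).filter fun x => 
          z2 ≤ (n:ℝ) ^ 2 * dg X A G F e (S ∩ Γ2) x).card ≤ (rich X A G F e n z S).card := by exact_mod_cast r3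
        push_cast at hri
        linarith) (by
        intro T hT
        by_cases hpT : η * (n:ℝ) ^ 2 ≤ (poor X A G F e n z1 T).card
        · refine le_trans (Pr_mono hp20.le (hb2'.trans hp1) (fun Γ h => h.2)) ?_
          refine (Hg W n p2 hn hp20 (hb2'.trans hp1) (by nlinarith) X G hX hGs 
            (LR_mono subset_rfl (by gcongr) le_rfl hG) _ (Finset.filter_subset _ _) 
            (fun x hx => (Finset.mem_filter.1 hx).2.1) hpT).trans ?_
          apply Real.exp_le_exp.2
          have : p / 2 * (n:ℝ) ^ 2 ≤ p2 * (n:ℝ) ^ 2 := by gcongr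
          have := mul_le_mul_of_nonneg_left this hbg.le
          linarith
        · refine le_trans (Pr_mono hp20.le (hb2'.trans hp1) (Ev' := fun _ => False) 
            (fun Γ h => hpT h.1)) ?_
          rw [Pr_false]; positivity)
    refine tr.trans ?_
    refine round_bound hp hδ (by positivity) E1 hb1 (by positivity) (K := A.card) ?_ hδK (hCd.trans hpn2)
    have := (Finset.card_le_card hGs).trans (supp_card A X n hX)
    exact_mod_cast this

lemma poor_small {k : ℕ} {A : Finset (Fin k × Fin k)} (hA : ∀ a ∈ A, a.1 < a.2) {θ : ℝ} (hθ0 : 0 < θ) (hθ1 : θ ≤ 1)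
    (hθ : BalH A θ) {e : Fin k × Fin k} (he : e ∈ A) {F : Finset (Fin k × Fin k)} (hFA : F ⊆ A.erase e)
    (hIS : IS A θ F) {d η d' : ℝ} (hd : 0 < d) (hη : 0 < η) (hd' : 0 < d') :
    ∃ ε ξ b C : ℝ, 0 < ε ∧ 0 < ξ ∧ 0 < b ∧ 0 < C ∧
    ∀ (W : Type) [Fintype W] (n : ℕ) (p : ℝ), 1 ≤ n → 0 < p → p ≤ 1 → C * (n:ℝ) ^ (-θ) ≤ p →
    ∀ (X : Fin k → Finset W) (G : Finset (Lab k W)), (∀ i, (X i).card = n) → G ⊆ supp A X →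
    LR A G X (ε * n) d → 
    Pr p (fun Γ => ∃ S, S ⊆ Γ ∧ S ⊆ G ∧ (LR F S X (ε * n) (d' * p) ∧
      η * (n:ℝ) ^ 2 < (poor X A G F e n (ξ * p ^ F.card * (n:ℝ) ^ k) S).card)) ≤ 
      Real.exp (-(b * (p * (n:ℝ) ^ 2))) := by
  obtain ⟨ε0, ξ0, c, hε0, hξ0, hc, hg⟩ := growth hA hθ0 hθ1 hθ he hFA hIS hd hη (d0 := d' / 2) (by positivity)
  obtain ⟨s, hs⟩ := exists_nat_gt (1 / c)
  rw [div_lt_iff₀ hc] at hs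
  obtain ⟨ε, ξ, b, C, hε, hξ, hb, hC, H⟩ := rounds hθ0 hθ1 hd hη (by positivity) hε0 hξ0 hc hg s d' (by linarith)
  refine ⟨ε, ξ, b, C, hε, hξ, hb, hC, ?_⟩
  intro W _ n p hn hp hp1 hCp X G hX hGs hG
  refine le_trans (Pr_mono hp.le hp1 ?_) (H W n p hn hp hp1 hCp X G hX hGs hG)
  rintro Γ ⟨S, h1, h2, h3, h4⟩
  refine ⟨S, h1, h2, h3, h4, ?_⟩
  have q : (rich X A G F e n (ξ * p ^ F.card * (n:ℝ) ^ k) S).card ≤ n ^ 2 := by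
    refine (Finset.card_filter_le _ _).trans ?_
    rw [Finset.card_product, hX, hX, sq]
  have q' : ((rich X A G F e n (ξ * p ^ F.card * (n:ℝ) ^ k) S).card : ℝ) ≤ (n:ℝ) ^ 2 := by exact_mod_cast q
  have hn0 : (0:ℝ) < n := by exact_mod_cast hn
  have : (n:ℝ) ^ 2 * 1 < (n:ℝ) ^ 2 * (s * c) := by gcongr
  linarith

lemma count_step {k : ℕ} {W : Type} [Fintype W] (X : Fin k → Finset W) (A : Finset (Fin k × Fin k))
    (G : Finset (Lab k W)) (F : Finset (Fin k × Fin k)) {e : Fin k × Fin k} (n : ℕ) {z : ℝ}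
    {S T M : Finset (Lab k W)} (hT : T ⊆ S) (hM : M ⊆ S) (hS : S ⊆ G) (hn : 1 ≤ n) :
    z * ((ee M e (X e.1) (X e.2) : ℝ) - (M ∩ (poor X A G F e n z T).image fun x => (e, x)).card) ≤ 
      (n:ℝ) ^ 2 * (cop X A G (insert e F) S).card ∨ z < 0 := by
  by_cases hz : z < 0
  · exact Or.inr hz
  left
  push Not at hz
  set Q := (X e.1 ×ˢ X e.2).filter fun x => (e, x) ∈ M with hQ
  set Qp := Q.filter fun x => x ∈ poor X A G F e n z T with hQp
  set Qr := Q.filter fun x => ¬ x ∈ poor X A G F e n z T with hQr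
  have h1 : Qp.card + Qr.card = Q.card := Finset.card_filter_add_card_filter_not _
  have h2 : Qp.card ≤ (M ∩ (poor X A G F e n z T).image fun x => (e, x)).card := by
    rw [← Finset.card_image_of_injective Qp (f := fun x => (e, x)) (fun x y h => by simpa using h)]
    apply Finset.card_le_card
    intro y hy
    obtain ⟨x, hx, rfl⟩ := Finset.mem_image.1 hy
    rw [hQp, Finset.mem_filter, hQ, Finset.mem_filter] at hx
    exact Finset.mem_inter.2 ⟨hx.1.2, Finset.mem_image_of_mem _ hx.2⟩
  have h3 : ∑ x ∈ Qr, dg X A G F e T x ≤ (cop X A G (insert e F) S).card := by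
    have : ∑ x ∈ Qr, dg X A G F e T x ≤ 
        ∑ x ∈ Qr, ((cop X A G (insert e F) S).filter fun g => (g e.1, g e.2) = x).card := by
      refine Finset.sum_le_sum fun x hx => Finset.card_le_card ?_
      intro g hg
      rw [hQr, Finset.mem_filter, hQ, Finset.mem_filter] at hx
      have hx2 := hx.1.2
      simp only [cop, Finset.mem_filter, mem_univ, true_and] at hg ⊢
      obtain ⟨⟨g1, g2, g3⟩, g4⟩ := hg
      refine ⟨⟨g1, ?_, ?_⟩, g4⟩
      · intro a ha
        by_cases hae : a = e
        · subst hae; rw [g4]; exact hS (hM hx2)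
        · exact g2 a (Finset.mem_erase.2 ⟨hae, ha⟩)
      · intro a ha
        rcases Finset.mem_insert.1 ha with rfl | ha
        · rw [g4]; exact hM hx2
        · exact hT (g3 a ha)
    refine this.trans ?_
    rw [← Finset.card_biUnion]
    · apply Finset.card_le_card
      intro g hg
      obtain ⟨x, _, hx⟩ := Finset.mem_biUnion.1 hg
      exact (Finset.mem_filter.1 hx).1
    · intro x _ y _ hxy
      rw [Function.onFun, Finset.disjoint_left]
      intro g hg hg'
      exact hxy ((Finset.mem_filter.1 hg).2.symm.trans (Finset.mem_filter.1 hg').2)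
  have h4 : (Qr.card : ℝ) * z ≤ (n:ℝ) ^ 2 * ∑ x ∈ Qr, (dg X A G F e T x : ℝ) := by
    rw [Finset.mul_sum, ← nsmul_eq_mul, ← Finset.sum_const]
    refine Finset.sum_le_sum fun x hx => ?_
    rw [hQr, Finset.mem_filter, hQ, Finset.mem_filter] at hx
    by_contra hcon
    push Not at hcon
    exact hx.2 (Finset.mem_filter.2 ⟨hx.1.1, hS (hM hx.1.2), hcon⟩)
  have h5 : (∑ x ∈ Qr, (dg X A G F e T x : ℝ)) ≤ (cop X A G (insert e F) S).card := by exact_mod_cast h3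
  have h6 : (Qp.card : ℝ) + Qr.card = ee M e (X e.1) (X e.2) := by exact_mod_cast h1
  have h7 : (Qp.card : ℝ) ≤ (M ∩ (poor X A G F e n z T).image fun x => (e, x)).card := by exact_mod_cast h2
  calc _ ≤ z * (Qr.card : ℝ) := by gcongr; linarith
    _ ≤ (n:ℝ) ^ 2 * ∑ x ∈ Qr, (dg X A G F e T x : ℝ) := by rw [mul_comm]; exact h4
    _ ≤ _ := by gcongr

set_option maxHeartbeats 1000000 in
lemma IS_step {k : ℕ} {A : Finset (Fin k × Fin k)} (hA : ∀ a ∈ A, a.1 < a.2) {θ : ℝ} (hθ0 : 0 < θ) (hθ1 : θ ≤ 1)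
    (hθ : BalH A θ) {e : Fin k × Fin k} (he : e ∈ A) {F : Finset (Fin k × Fin k)} (hFA : F ⊆ A.erase e)
    (hIS : IS A θ F) : IS A θ (insert e F) := by
  intro d hd
  have heF : e ∉ F := fun h => by simpa using hFA h
  obtain ⟨d'', hd''0, hd''⟩ : ∃ d'' : ℝ, 0 < d'' ∧ d'' < d := ⟨d / 2, by linarith, by linarith⟩
  obtain ⟨ε1, ξ1, b1, C1, hε1, hξ1, hb1, hC1, H1⟩ := 
    poor_small hA hθ0 hθ1 hθ he hFA hIS hd (η := d'' / 8) (by positivity) hd''0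
  obtain ⟨δ, hδ, hδ2, hδK⟩ : ∃ δ : ℝ, 0 < δ ∧ δ ≤ 1 / 2 ∧ δ * A.card ≤ d'' / 16 / 2 := by
    refine ⟨min (1 / 2) (d'' / 16 / 2 / (A.card + 1)), by positivity, min_le_left _ _, ?_⟩
    have : min (1 / 2) (d'' / 16 / 2 / ((A.card:ℝ) + 1)) * A.card ≤ d'' / 16 / 2 / (A.card + 1) * (A.card + 1) := by
      gcongr
      · exact min_le_right _ _
      · linarith
    refine this.trans (le_of_eq ?_)
    field_simp
  obtain ⟨ε, hε, hεε1, hεε0⟩ : ∃ ε : ℝ, 0 < ε ∧ ε ≤ ε1 ∧ ε ≤ 1 := 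
    ⟨min ε1 1, lt_min hε1 one_pos, min_le_left _ _, min_le_right _ _⟩
  obtain ⟨ξ, hξ, hξξ⟩ : ∃ ξ : ℝ, 0 < ξ ∧ ξ = d'' / 4 * (ξ1 * δ ^ F.card) := ⟨_, by positivity, rfl⟩
  obtain ⟨Ct, hCt, Ht⟩ := two_round (insert e F) hε hd''0 hd'' hδ hδ2
  have hbm : 0 < min (b1 * δ) (d'' / 16 / 2) := by positivity
  obtain ⟨C, hC, hCa, hCb, hCd⟩ : ∃ C : ℝ, 0 < C ∧ Ct ≤ C ∧ C1 / δ ≤ C ∧ 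
      2 * 4 / min (b1 * δ) (d'' / 16 / 2) ≤ C := by
    refine ⟨max (max Ct (C1 / δ)) (2 * 4 / min (b1 * δ) (d'' / 16 / 2)), by positivity, 
      ?_, ?_, ?_⟩ <;> simp
  refine ⟨ε, ξ, min (b1 * δ) (d'' / 16 / 2) / 2, C, hε, hξ, by positivity, hC, ?_⟩
  intro W _ n p hn hp hp1 hCp X G hX hGs hG
  have hn1 : (1:ℝ) ≤ n := by exact_mod_cast hn
  have hn0 : (0:ℝ) < n := by linarith
  have hθn : 0 < (n:ℝ) ^ (-θ) := by positivity
  obtain ⟨hpn, hpn2⟩ := scale_pn hθ1 hn hC hCp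
  obtain ⟨p2, hp2⟩ := exists_p2 hp hp1 hδ hδ2
  obtain ⟨hb1', hb2'⟩ := p2_bounds hp hp1 hδ hδ2 hp2
  have hp20 : 0 < p2 := by linarith
  have hδp : 0 < δ * p := by positivity
  set z1 := ξ1 * (δ * p) ^ F.card * (n:ℝ) ^ k with hz1
  have hz10 : 0 < z1 := by positivity
  have hzz : ξ * p ^ (insert e F).card * (n:ℝ) ^ k = d'' / 2 * (p / 2) * z1 := by
    rw [Finset.card_insert_of_notMem heF, hξξ, hz1, mul_pow, pow_succ]; ring
  have E1 := H1 W n (δ * p) hn hδp (by nlinarith) (by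
    rw [div_le_iff₀ hδ] at hCb
    calc C1 * (n:ℝ) ^ (-θ) ≤ C * δ * (n:ℝ) ^ (-θ) := by gcongr
      _ = δ * (C * (n:ℝ) ^ (-θ)) := by ring
      _ ≤ _ := by gcongr) X G hX hGs (LR_mono subset_rfl (by gcongr) le_rfl hG)
  rw [← hz1] at E1
  rw [hzz]
  clear_value z1
  have tr := Ht W n p p2 hn hp hp1 (hCa.trans hpn) hp2 X hX G
    (fun S => LR (insert e F) S X (ε * n) (d * p) ∧ 
      ((cop X A G (insert e F) S).card : ℝ) < d'' / 2 * (p / 2) * z1)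
    (fun Γ => ∃ S, S ⊆ Γ ∧ S ⊆ G ∧ (LR F S X (ε1 * n) (d'' * (δ * p)) ∧ 
      d'' / 8 * (n:ℝ) ^ 2 < (poor X A G F e n z1 S).card))
    (fun T Γ => ((poor X A G F e n z1 T).card : ℝ) ≤ d'' / 8 * (n:ℝ) ^ 2 ∧ 
      d'' / 2 * p2 * (n:ℝ) ^ 2 ≤ (Γ ∩ (poor X A G F e n z1 T).image fun x => (e, x)).card)
    (Real.exp (-(d'' / 16 * (p * (n:ℝ) ^ 2)))) (fun S hS => hS.1) (by
      intro Γ1 Γ2 S hSΓ hSG hbad hL1 hL2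
      obtain ⟨-, hco⟩ := hbad
      by_contra hcon
      rw [not_or] at hcon
      obtain ⟨n1, n2⟩ := hcon
      have r1 : ((poor X A G F e n z1 (S ∩ Γ1)).card : ℝ) ≤ d'' / 8 * (n:ℝ) ^ 2 := by
        by_contra h
        push Not at h
        exact n1 ⟨S ∩ Γ1, Finset.inter_subset_right, Finset.inter_subset_left.trans hSG, 
          LR_mono subset_rfl (by gcongr) le_rfl 
            (fun a ha => hL1 a (Finset.mem_insert_of_mem ha)), h⟩
      have r2 : ((Γ2 ∩ (poor X A G F e n z1 (S ∩ Γ1)).image fun x => (e, x)).card : ℝ) < 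
          d'' / 2 * p2 * (n:ℝ) ^ 2 := by
        by_contra h
        push Not at h
        exact n2 ⟨r1, h⟩
      have r2' : (((S ∩ Γ2) ∩ (poor X A G F e n z1 (S ∩ Γ1)).image fun x => (e, x)).card : ℝ) ≤ 
          (Γ2 ∩ (poor X A G F e n z1 (S ∩ Γ1)).image fun x => (e, x)).card := by
        exact_mod_cast Finset.card_le_card 
          (Finset.inter_subset_inter_right Finset.inter_subset_right)
      have r3 := hL2 e (Finset.mem_insert_self _ _) (X e.1) subset_rfl (X e.2) subset_rfl
        (by rw [hX]; nlinarith) (by rw [hX]; nlinarith)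
      rw [hX, hX] at r3
      rcases count_step X A G F (e := e) n (z := z1) (S := S) (T := S ∩ Γ1) (M := S ∩ Γ2) 
        Finset.inter_subset_left Finset.inter_subset_left hSG hn with r4 | r4
      · have r5 : z1 * (d'' / 2 * p2 * (n:ℝ) ^ 2) < (n:ℝ) ^ 2 * (d'' / 2 * (p / 2) * z1) := by
          calc _ ≤ z1 * ((ee (S ∩ Γ2) e (X e.1) (X e.2) : ℝ) - 
                ((S ∩ Γ2) ∩ (poor X A G F e n z1 (S ∩ Γ1)).image fun x => (e, x)).card) := by
                gcongr
                linarith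
            _ ≤ _ := r4
            _ < _ := by gcongr
        have r6 : (n:ℝ) ^ 2 * (d'' / 2 * (p / 2) * z1) ≤ (n:ℝ) ^ 2 * (d'' / 2 * p2 * z1) := by gcongr
        linarith
      · linarith) (by
      intro T hT
      by_cases hpT : ((poor X A G F e n z1 T).card : ℝ) ≤ d'' / 8 * (n:ℝ) ^ 2
      · refine le_trans (Pr_mono hp20.le (hb2'.trans hp1) (fun Γ h => h.2)) ?_
        refine (upper_tail hp20.le (hb2'.trans hp1) _).trans ?_
        apply Real.exp_le_exp.2
        have a1 : (((poor X A G F e n z1 T).image fun x => (e, x)).card : ℝ) ≤ d'' / 8 * (n:ℝ) ^ 2 := 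
          le_trans (by exact_mod_cast Finset.card_image_le) hpT
        have a2 : p2 * (((poor X A G F e n z1 T).image fun x => (e, x)).card : ℝ) ≤ p2 * (d'' / 8 * (n:ℝ) ^ 2) := by
          gcongr
        have : p / 2 * (n:ℝ) ^ 2 ≤ p2 * (n:ℝ) ^ 2 := by gcongr
        have := mul_le_mul_of_nonneg_left this hd''0.le
        linarith
      · refine le_trans (Pr_mono hp20.le (hb2'.trans hp1) (Ev' := fun _ => False) 
          (fun Γ h => hpT h.1)) ?_
        rw [Pr_false]; positivity)
  refine tr.trans ?_
  refine round_bound hp hδ (by positivity) E1 hb1 (by positivity) (K := A.card) ?_ hδK (hCd.trans hpn2)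
  have := (Finset.card_le_card hGs).trans (supp_card A X n hX)
  exact_mod_cast this

lemma IS_base {k : ℕ} {A : Finset (Fin k × Fin k)} (hA : ∀ a ∈ A, a.1 < a.2) (θ : ℝ) : IS A θ ∅ := by
  intro d hd
  obtain ⟨ε, ξ, hε, hξ, H⟩ := dense_count A hA hd
  refine ⟨ε, ξ, 1, 1, hε, hξ, one_pos, one_pos, ?_⟩
  intro W _ n p hn hp hp1 hCp X G hX hGs hG
  refine le_trans (Pr_mono hp.le hp1 (Ev' := fun _ => False) ?_) ?_
  · rintro Γ ⟨S, _, _, _, h⟩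
    have := H W n hn X hX G hG S
    simp only [Finset.card_empty, pow_zero, mul_one] at h
    linarith
  · rw [Pr_false]; positivity

lemma IS_all {k : ℕ} {A : Finset (Fin k × Fin k)} (hA : ∀ a ∈ A, a.1 < a.2) {θ : ℝ} (hθ0 : 0 < θ) (hθ1 : θ ≤ 1)
    (hθ : BalH A θ) (F : Finset (Fin k × Fin k)) : F ⊆ A → IS A θ F := by
  induction F using Finset.induction_on with
  | empty => intro _; exact IS_base hA θ
  | insert e F heF ih =>
    intro hF
    rw [Finset.insert_subset_iff] at hF
    exact IS_step hA hθ0 hθ1 hθ hF.1 (Finset.subset_erase.2 ⟨hF.2, heF⟩) (ih hF.2)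

section matching
variable {k : ℕ} {W : Type} [Fintype W]

lemma match_ext (X : Fin k → Finset W) (n : ℕ) (hX : ∀ i, (X i).card = n) 
    (D : Fin k × Fin k → Finset (W × W)) (A : Finset (Fin k × Fin k)) (e : Fin k × Fin k)
    (he : e.1 < e.2) (hDe : D e ⊆ X e.1 ×ˢ X e.2)
    (hdis : ∀ a ∈ A, a.1 ≠ e.1 ∧ a.1 ≠ e.2 ∧ a.2 ≠ e.1 ∧ a.2 ≠ e.2) :
    (univ.filter fun f : Fin k → W => (∀ i, f i ∈ X i) ∧ ∀ a ∈ A, (f a.1, f a.2) ∈ D a).card * (D e).card ≤ 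
    (univ.filter fun f : Fin k → W => (∀ i, f i ∈ X i) ∧ ∀ a ∈ insert e A, (f a.1, f a.2) ∈ D a).card * n ^ 2 := by
  have : n ^ 2 = (X e.1 ×ˢ X e.2).card := by rw [Finset.card_product, hX, hX, sq]
  rw [this, ← Finset.card_product, ← Finset.card_product]
  have hne : e.1 ≠ e.2 := he.ne
  have key : ∀ (f : Fin k → W) (x : W × W), 
    Function.update (Function.update (Function.update (Function.update f e.1 x.1) e.2 x.2) e.1 (f e.1)) e.2 (f e.2) = f := by
    intro f x
    funext i
    by_cases h2 : i = e.2
    · subst h2; simp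
    · by_cases h1 : i = e.1
      · subst h1; simp [hne]
      · simp [h1, h2]
  refine Finset.card_le_card_of_injOn (fun y => (Function.update (Function.update y.1 e.1 y.2.1) e.2 y.2.2, 
    (y.1 e.1, y.1 e.2))) ?_ ?_
  · rintro ⟨f, x⟩ hy
    simp only [Finset.coe_product, Set.mem_prod, Finset.mem_coe, Finset.mem_filter, mem_univ, true_and,
      Finset.mem_product] at hy ⊢
    obtain ⟨⟨h1, h2⟩, h3⟩ := hy
    have hx := Finset.mem_product.1 (hDe h3)
    refine ⟨⟨?_, ?_⟩, h1 _, h1 _⟩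
    · intro i
      by_cases hi2 : i = e.2
      · subst hi2; simpa using hx.2
      · by_cases hi1 : i = e.1
        · subst hi1; simpa [hne] using hx.1
        · simpa [hi1, hi2] using h1 i
    · intro a ha
      rcases Finset.mem_insert.1 ha with rfl | ha
      · simpa [hne] using h3
      · obtain ⟨q1, q2, q3, q4⟩ := hdis a ha
        simpa [q1, q2, q3, q4] using h2 a ha
  · rintro ⟨f, x⟩ _ ⟨g, y⟩ _ h
    simp only [Prod.mk.injEq] at h
    obtain ⟨h1, h2, h3⟩ := h
    have e1 := key f x
    have e2 := key g y
    rw [h1, h2, h3, e2] at e1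
    subst e1
    have hx2 := congrFun h1 e.2
    have hx1 := congrFun h1 e.1
    simp only [Function.update_self, Function.update_of_ne hne] at hx1 hx2
    rw [Prod.mk.injEq]
    exact ⟨rfl, Prod.ext hx1.symm.symm hx2⟩

lemma match_count (X : Fin k → Finset W) (n : ℕ) (hn : 1 ≤ n) (hX : ∀ i, (X i).card = n) 
    (D : Fin k × Fin k → Finset (W × W)) (c : Fin k × Fin k → ℝ) (A : Finset (Fin k × Fin k)) 
    (hA : ∀ a ∈ A, a.1 < a.2) (hD : ∀ a ∈ A, D a ⊆ X a.1 ×ˢ X a.2)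
    (hc : ∀ a ∈ A, 0 ≤ c a) (hcD : ∀ a ∈ A, c a * (n:ℝ) ^ 2 ≤ (D a).card)
    (hdis : ∀ a ∈ A, ∀ e ∈ A, a ≠ e → a.1 ≠ e.1 ∧ a.1 ≠ e.2 ∧ a.2 ≠ e.1 ∧ a.2 ≠ e.2) :
    (∏ a ∈ A, c a) * (n:ℝ) ^ k ≤ 
    (univ.filter fun f : Fin k → W => (∀ i, f i ∈ X i) ∧ ∀ a ∈ A, (f a.1, f a.2) ∈ D a).card := by
  have hn0 : (0:ℝ) < n := by exact_mod_cast hn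
  induction A using Finset.induction_on with
  | empty =>
    have : (univ.filter fun f : Fin k → W => (∀ i, f i ∈ X i) ∧ 
      ∀ a ∈ (∅ : Finset (Fin k × Fin k)), (f a.1, f a.2) ∈ D a) = Fintype.piFinset X := by
      ext f; simp [Fintype.mem_piFinset]
    rw [this, Fintype.card_piFinset]
    simp [hX]
  | insert e A heA ih =>
    have ih' := ih (fun a ha => hA a (Finset.mem_insert_of_mem ha)) 
      (fun a ha => hD a (Finset.mem_insert_of_mem ha)) (fun a ha => hc a (Finset.mem_insert_of_mem ha))
      (fun a ha => hcD a (Finset.mem_insert_of_mem ha)) 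
      (fun a ha e he => hdis a (Finset.mem_insert_of_mem ha) e (Finset.mem_insert_of_mem he))
    have hs := Finset.mem_insert_self e A
    have st := match_ext X n hX D A e (hA e hs) (hD e hs) (fun a ha => 
      hdis a (Finset.mem_insert_of_mem ha) e hs (fun h => heA (h ▸ ha)))
    have st' : ((univ.filter fun f : Fin k → W => (∀ i, f i ∈ X i) ∧ ∀ a ∈ A, (f a.1, f a.2) ∈ D a).card : ℝ)
      * (D e).card ≤ (univ.filter fun f : Fin k → W => (∀ i, f i ∈ X i) ∧ 
        ∀ a ∈ insert e A, (f a.1, f a.2) ∈ D a).card * (n:ℝ) ^ 2 := by exact_mod_cast st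
    rw [Finset.prod_insert heA]
    have h1 := hcD e hs
    have h0 := hc e hs
    refine le_of_mul_le_mul_right (le_trans ?_ st') (by positivity : 0 < (n:ℝ) ^ 2)
    calc c e * (∏ a ∈ A, c a) * (n:ℝ) ^ k * (n:ℝ) ^ 2 = ((∏ a ∈ A, c a) * (n:ℝ) ^ k) * (c e * (n:ℝ) ^ 2) := by ring
      _ ≤ _ := by gcongr

end matching

lemma IS_matching {k : ℕ} {A F : Finset (Fin k × Fin k)} (hA : ∀ a ∈ A, a.1 < a.2) (hF : F ⊆ A) (θ : ℝ)
    (hdis : ∀ a ∈ A, ∀ e ∈ A, a ≠ e → a.1 ≠ e.1 ∧ a.1 ≠ e.2 ∧ a.2 ≠ e.1 ∧ a.2 ≠ e.2) : IS A θ F := by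
  intro d hd
  refine ⟨1, d ^ A.card, 1, 1, one_pos, by positivity, one_pos, one_pos, ?_⟩
  intro W _ n p hn hp hp1 hCp X G hX hGs hG
  refine le_trans (Pr_mono hp.le hp1 (Ev' := fun _ => False) ?_) ?_
  · rintro Γ ⟨S, _, hSG, hS, h⟩
    rw [one_mul] at hG hS
    have := match_count X n hn hX 
      (fun a => (X a.1 ×ˢ X a.2).filter fun x => (a, x) ∈ if a ∈ F then S else G)
      (fun a => d * if a ∈ F then p else 1) A hA (fun a _ => Finset.filter_subset _ _) 
      (fun a _ => by split_ifs <;> positivity) (by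
        intro a ha
        by_cases haF : a ∈ F
        · have := hS a haF (X a.1) subset_rfl (X a.2) subset_rfl (by rw [hX]) (by rw [hX])
          rw [hX, hX, ee] at this
          simp only [haF, if_true]
          rw [sq]; exact this
        · have := hG a ha (X a.1) subset_rfl (X a.2) subset_rfl (by rw [hX]) (by rw [hX])
          rw [hX, hX, ee] at this
          simp only [haF, if_false, mul_one]
          rw [sq]; exact this) hdis
    have e1 : ∏ a ∈ A, (d * if a ∈ F then p else 1) = d ^ A.card * p ^ F.card := by
      rw [Finset.prod_mul_distrib, Finset.prod_const, Finset.prod_ite_mem, 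
        Finset.inter_eq_right.2 hF, Finset.prod_const]
    rw [e1] at this
    have h2 : ((univ.filter fun f : Fin k → W => (∀ i, f i ∈ X i) ∧ ∀ a ∈ A, (f a.1, f a.2) ∈ 
      (X a.1 ×ˢ X a.2).filter fun x => (a, x) ∈ if a ∈ F then S else G).card : ℝ) ≤ (cop X A G F S).card := by
      norm_cast
      apply Finset.card_le_card
      intro f hf
      simp only [cop, Finset.mem_filter, mem_univ, true_and] at hf ⊢
      refine ⟨hf.1, fun a ha => ?_, fun a ha => ?_⟩
      · have := (hf.2 a ha).2
        split_ifs at this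
        · exact hSG this
        · exact this
      · have := (hf.2 a (hF ha)).2
        rwa [if_pos ha] at this
    linarith
  · rw [Pr_false]; positivity

lemma edgesWithin_eq {k : ℕ} (H : SimpleGraph (Fin k)) (S : Finset (Fin k)) : 
    edgesWithin H S = ((hPairs H).filter fun a => a.1 ∈ S ∧ a.2 ∈ S).card := by
  have : {e ∈ H.edgeSet | ∀ v ∈ e, v ∈ S} = 
      (fun a : Fin k × Fin k => s(a.1, a.2)) '' ((hPairs H).filter fun a => a.1 ∈ S ∧ a.2 ∈ S : Finset _) := by
    ext e
    induction e using Sym2.ind with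
    | _ u v =>
    simp only [Set.mem_setOf_eq, SimpleGraph.mem_edgeSet, Sym2.mem_iff, forall_eq_or_imp, forall_eq, 
      hPairs, Finset.coe_filter, Set.mem_image, Prod.exists, Finset.mem_filter, mem_univ, true_and]
    constructor
    · rintro ⟨h1, h2, h3⟩
      rcases lt_or_gt_of_ne h1.ne with h | h
      · exact ⟨u, v, ⟨⟨h1, h⟩, h2, h3⟩, rfl⟩
      · exact ⟨v, u, ⟨⟨h1.symm, h⟩, h3, h2⟩, Sym2.eq_swap⟩
    · rintro ⟨a, b, ⟨⟨h1, h⟩, h2, h3⟩, h4⟩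
      rcases Sym2.eq_iff.1 h4 with ⟨rfl, rfl⟩ | ⟨rfl, rfl⟩
      · exact ⟨h1, h2, h3⟩
      · exact ⟨h1.symm, h3, h2⟩
  rw [edgesWithin, this, Set.ncard_image_of_injOn, Set.ncard_coe_finset]
  rintro ⟨a, b⟩ h ⟨a', b'⟩ h' hh
  simp only [hPairs, Finset.coe_filter, Finset.mem_filter, mem_univ, true_and, Set.mem_setOf_eq] at h h'
  rcases Sym2.eq_iff.1 hh with ⟨rfl, rfl⟩ | ⟨rfl, rfl⟩
  · rfl
  · exact absurd h.1.2 (not_lt.2 h'.1.2.le)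

lemma edgeCount_eq {k : ℕ} (H : SimpleGraph (Fin k)) : edgeCount H = (hPairs H).card := by
  have := edgesWithin_eq H univ
  simpa [edgesWithin, edgeCount] using this

lemma dens_le {k : ℕ} (H : SimpleGraph (Fin k)) (S : Finset (Fin k)) (hS : 3 ≤ S.card) : 
    ((edgesWithin H S : ℝ) - 1) / ((S.card : ℝ) - 2) ≤ twoDensity H := by
  refine le_trans ?_ (le_max_right _ _)
  apply le_csSup
  · apply Set.Finite.bddAbove
    refine (Set.finite_range (fun S : Finset (Fin k) => ((edgesWithin H S : ℝ) - 1) / ((S.card : ℝ) - 2))).subset ?_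
    rintro x ⟨S, _, rfl⟩
    exact ⟨S, rfl⟩
  · exact ⟨S, hS, rfl⟩

lemma hPairs_lt {k : ℕ} (H : SimpleGraph (Fin k)) : ∀ a ∈ hPairs H, a.1 < a.2 := by
  intro a ha
  simp only [hPairs, Finset.mem_filter] at ha
  exact ha.2.2

lemma balH_of {k : ℕ} (H : SimpleGraph (Fin k)) : BalH (hPairs H) (1 / twoDensity H) := by
  have hm : 0 < twoDensity H := lt_of_lt_of_le (by norm_num) (le_max_left _ _)
  intro e he J h1 h2
  have hlt := hPairs_lt H
  have hsub : {e.1, e.2} ⊆ J := by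
    intro x hx
    rcases Finset.mem_insert.1 hx with rfl | hx
    · exact h1
    · rw [Finset.mem_singleton.1 hx]; exact h2
  have hc2 : ({e.1, e.2} : Finset (Fin k)).card = 2 := Finset.card_pair (hlt e he).ne
  have hJ2 : 2 ≤ J.card := hc2 ▸ Finset.card_le_card hsub
  rcases hJ2.eq_or_lt with h | h
  · have hJ : {e.1, e.2} = J := Finset.eq_of_subset_of_card_le hsub (by omega)
    have : ((hPairs H).erase e).filter (fun a => a.1 ∈ J ∧ a.2 ∈ J) = ∅ := by
      rw [Finset.filter_eq_empty_iff]
      rintro a ha ⟨q1, q2⟩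
      rw [Finset.mem_erase] at ha
      have := hlt a ha.2
      have := hlt e he
      rw [← hJ] at q1 q2
      simp only [Finset.mem_insert, Finset.mem_singleton] at q1 q2
      apply ha.1
      apply Prod.ext <;> grind
    rw [this, ← h]; simp
  · have hd := dens_le H J h
    have h3 : (3:ℝ) ≤ J.card := by exact_mod_cast h
    rw [div_le_iff₀ (by linarith), edgesWithin_eq] at hd
    have : (((hPairs H).erase e).filter fun a => a.1 ∈ J ∧ a.2 ∈ J).card + 1 = 
        ((hPairs H).filter fun a => a.1 ∈ J ∧ a.2 ∈ J).card := by
      rw [Finset.filter_erase]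
      exact Finset.card_erase_add_one (Finset.mem_filter.2 ⟨he, h1, h2⟩)
    have h' : ((((hPairs H).erase e).filter fun a => a.1 ∈ J ∧ a.2 ∈ J).card : ℝ) + 1 = 
        ((hPairs H).filter fun a => a.1 ∈ J ∧ a.2 ∈ J).card := by exact_mod_cast this
    rw [mul_one_div, div_le_iff₀ hm]
    linarith

lemma one_le_dens {k : ℕ} (H : SimpleGraph (Fin k)) {a e : Fin k × Fin k} (ha : a ∈ hPairs H) (he : e ∈ hPairs H)
    (hae : a ≠ e) (h : ¬ (a.1 ≠ e.1 ∧ a.1 ≠ e.2 ∧ a.2 ≠ e.1 ∧ a.2 ≠ e.2)) : 1 ≤ twoDensity H := by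
  have l1 := hPairs_lt H a ha
  have l2 := hPairs_lt H e he
  have hc : (({a.1, a.2} ∪ {e.1, e.2} : Finset (Fin k))).card = 3 := by
    have hne : a.1 ≠ e.1 ∨ a.2 ≠ e.2 := by
      by_contra hh
      push Not at hh
      exact hae (Prod.ext hh.1 hh.2)
    have key : ∀ x y z : Fin k, x ≠ y → x ≠ z → y ≠ z → ({x, y, z} : Finset (Fin k)).card = 3 := by
      intro x y z h1 h2 h3
      rw [Finset.card_eq_three]
      exact ⟨x, y, z, h1, h2, h3, rfl⟩
    obtain ⟨a1, a2⟩ := a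
    obtain ⟨e1, e2⟩ := e
    simp only at *
    by_cases q1 : a1 = e1
    · subst q1
      rw [← key a1 a2 e2 l1.ne l2.ne (by grind)]
      congr 1; ext x; simp
    · by_cases q2 : a1 = e2
      · subst q2
        rw [← key a1 a2 e1 l1.ne q1 (by grind)]
        congr 1; ext x; simp; tauto
      · by_cases q3 : a2 = e1
        · subst q3
          rw [← key a1 a2 e2 l1.ne q2 l2.ne]
          congr 1; ext x; simp; 
        · have q4 : a2 = e2 := by grind
          subst q4
          rw [← key a1 a2 e1 l1.ne q1 q3]
          congr 1; ext x; simp; tauto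
  have := dens_le H _ hc.ge
  rw [hc] at this
  refine le_trans ?_ this
  rw [edgesWithin_eq]
  have h2 : 2 ≤ ((hPairs H).filter fun x => x.1 ∈ ({a.1, a.2} ∪ {e.1, e.2} : Finset (Fin k)) ∧ 
      x.2 ∈ ({a.1, a.2} ∪ {e.1, e.2} : Finset (Fin k))).card := by
    rw [← Finset.card_pair hae]
    apply Finset.card_le_card
    intro x hx
    rcases Finset.mem_insert.1 hx with rfl | hx
    · simp [ha]
    · rw [Finset.mem_singleton.1 hx]; simp [he]
  have h2' : (2:ℝ) ≤ ((hPairs H).filter fun x => x.1 ∈ ({a.1, a.2} ∪ {e.1, e.2} : Finset (Fin k)) ∧ 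
      x.2 ∈ ({a.1, a.2} ∪ {e.1, e.2} : Finset (Fin k))).card := by exact_mod_cast h2
  have h31 : ((3:ℕ):ℝ) - 2 = 1 := by norm_num
  rw [h31, div_one]
  linarith

lemma IS_graph {k : ℕ} (H : SimpleGraph (Fin k)) {F : Finset (Fin k × Fin k)} (hF : F ⊆ hPairs H) : 
    IS (hPairs H) (1 / twoDensity H) F := by
  by_cases h : ∀ a ∈ hPairs H, ∀ e ∈ hPairs H, a ≠ e → a.1 ≠ e.1 ∧ a.1 ≠ e.2 ∧ a.2 ≠ e.1 ∧ a.2 ≠ e.2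
  · exact IS_matching (hPairs_lt H) hF _ h
  · rw [not_forall] at h
    obtain ⟨a, h⟩ := h
    rw [Classical.not_imp, not_forall] at h
    obtain ⟨ha, e, h⟩ := h
    rw [Classical.not_imp, Classical.not_imp] at h
    have h1 := one_le_dens H ha h.1 h.2.1 h.2.2
    refine IS_all (hPairs_lt H) (by positivity) ?_ (balH_of H) F hF
    rw [div_le_one (by linarith)]; exact h1

section trans
variable {k : ℕ} {W : Type} [Fintype W]

/-- labelled edge set of a graph -/
noncomputable def Lset (H : SimpleGraph (Fin k)) (P : Fin k → Finset W) (G : SimpleGraph W) : Finset (Lab k W) :=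
  univ.filter fun y => y.1 ∈ hPairs H ∧ y.2.1 ∈ P y.1.1 ∧ y.2.2 ∈ P y.1.2 ∧ G.Adj y.2.1 y.2.2

/-- graph of a labelled edge set -/
def gr (T : Finset (Lab k W)) : SimpleGraph W := 
  SimpleGraph.fromRel fun u v => ∃ a, (a, (u, v)) ∈ T

lemma mem_Lset {H : SimpleGraph (Fin k)} {P : Fin k → Finset W} {G : SimpleGraph W} {y : Lab k W} : 
    y ∈ Lset H P G ↔ (H.Adj y.1.1 y.1.2 ∧ y.1.1 < y.1.2) ∧ y.2.1 ∈ P y.1.1 ∧ y.2.2 ∈ P y.1.2 ∧ G.Adj y.2.1 y.2.2 := by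
  simp [Lset, hPairs]

lemma Lset_mono {H : SimpleGraph (Fin k)} {P : Fin k → Finset W} {G G' : SimpleGraph W} (h : G' ≤ G) : 
    Lset H P G' ⊆ Lset H P G := by
  intro y hy
  rw [mem_Lset] at hy ⊢
  exact ⟨hy.1, hy.2.1, hy.2.2.1, h hy.2.2.2⟩

lemma part_eq {P : Fin k → Finset W} (hP : ∀ i j, i ≠ j → Disjoint (P i) (P j)) {i j : Fin k} {u : W}
    (hi : u ∈ P i) (hj : u ∈ P j) : i = j := by
  by_contra h
  exact Finset.disjoint_left.1 (hP i j h) hi hj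

lemma Lset_gr {H : SimpleGraph (Fin k)} {P : Fin k → Finset W} {G : SimpleGraph W} 
    (hP : ∀ i j, i ≠ j → Disjoint (P i) (P j)) {T : Finset (Lab k W)} (hT : T ⊆ Lset H P G) : 
    Lset H P (gr T) = T := by
  ext ⟨⟨i, j⟩, ⟨u, v⟩⟩
  rw [mem_Lset]
  simp only [gr, SimpleGraph.fromRel_adj]
  constructor
  · rintro ⟨⟨h1, h2⟩, h3, h4, h5, ⟨⟨i', j'⟩, h⟩ | ⟨⟨i', j'⟩, h⟩⟩
    · have := mem_Lset.1 (hT h)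
      simp only at this
      obtain rfl := part_eq hP h3 this.2.1
      obtain rfl := part_eq hP h4 this.2.2.1
      exact h
    · have := mem_Lset.1 (hT h)
      simp only at this
      obtain rfl := part_eq hP h3 this.2.2.1
      obtain rfl := part_eq hP h4 this.2.1
      exact absurd h2 (not_lt.2 this.1.2.le)
  · intro h
    have := mem_Lset.1 (hT h)
    exact ⟨this.1, this.2.1, this.2.2.1, this.2.2.2.ne, Or.inl ⟨_, h⟩⟩

lemma gr_le {H : SimpleGraph (Fin k)} {P : Fin k → Finset W} {G : SimpleGraph W} 
    {T : Finset (Lab k W)} (hT : T ⊆ Lset H P G) : gr T ≤ G := by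
  intro u v h
  simp only [gr, SimpleGraph.fromRel_adj] at h
  obtain ⟨h5, ⟨a, h⟩ | ⟨a, h⟩⟩ := h
  · exact (mem_Lset.1 (hT h)).2.2.2
  · exact (mem_Lset.1 (hT h)).2.2.2.symm

lemma gr_Lset {H : SimpleGraph (Fin k)} {P : Fin k → Finset W} {G : SimpleGraph W} 
    (hG : ∀ u v, G.Adj u v → ∃ i j, H.Adj i j ∧ u ∈ P i ∧ v ∈ P j) : gr (Lset H P G) = G := by
  apply le_antisymm (gr_le subset_rfl)
  intro u v h
  simp only [gr, SimpleGraph.fromRel_adj]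
  refine ⟨h.ne, ?_⟩
  obtain ⟨i, j, hij, hu, hv⟩ := hG u v h
  rcases lt_or_gt_of_ne hij.ne with hl | hl
  · exact Or.inl ⟨(i, j), mem_Lset.2 ⟨⟨hij, hl⟩, hu, hv, h⟩⟩
  · exact Or.inr ⟨(j, i), mem_Lset.2 ⟨⟨hij.symm, hl⟩, hv, hu, h.symm⟩⟩

lemma edgeCount_Lset {H : SimpleGraph (Fin k)} {P : Fin k → Finset W} {G : SimpleGraph W} 
    (hP : ∀ i j, i ≠ j → Disjoint (P i) (P j)) 
    (hG : ∀ u v, G.Adj u v → ∃ i j, H.Adj i j ∧ u ∈ P i ∧ v ∈ P j) : edgeCount G = (Lset H P G).card := by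
  have : G.edgeSet = (fun y : Lab k W => s(y.2.1, y.2.2)) '' (Lset H P G : Set (Lab k W)) := by
    ext e
    induction e using Sym2.ind with
    | _ u v =>
    rw [SimpleGraph.mem_edgeSet, Set.mem_image]
    constructor
    · intro h
      obtain ⟨i, j, hij, hu, hv⟩ := hG u v h
      rcases lt_or_gt_of_ne hij.ne with hl | hl
      · exact ⟨((i, j), (u, v)), mem_Lset.2 ⟨⟨hij, hl⟩, hu, hv, h⟩, rfl⟩
      · exact ⟨((j, i), (v, u)), mem_Lset.2 ⟨⟨hij.symm, hl⟩, hv, hu, h.symm⟩, Sym2.eq_swap⟩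
    · rintro ⟨y, hy, h4⟩
      have := (mem_Lset.1 (Finset.mem_coe.1 hy)).2.2.2
      rw [← SimpleGraph.mem_edgeSet] at this ⊢
      rwa [← h4]
  rw [edgeCount, this, Set.InjOn.ncard_image, Set.ncard_coe_finset]
  rintro ⟨⟨i, j⟩, ⟨u, v⟩⟩ h ⟨⟨i', j'⟩, ⟨u', v'⟩⟩ h' hh
  have m1 := mem_Lset.1 (Finset.mem_coe.1 h)
  have m2 := mem_Lset.1 (Finset.mem_coe.1 h')
  simp only at m1 m2
  rcases Sym2.eq_iff.1 hh with ⟨q1, q2⟩ | ⟨q1, q2⟩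
  · simp only at q1 q2
    subst q1 q2
    obtain rfl := part_eq hP m1.2.1 m2.2.1
    obtain rfl := part_eq hP m1.2.2.1 m2.2.2.1
    rfl
  · simp only at q1 q2
    subst q1 q2
    obtain rfl := part_eq hP m1.2.1 m2.2.2.1
    obtain rfl := part_eq hP m1.2.2.1 m2.2.1
    exact absurd m1.1.2 (not_lt.2 m2.1.2.le)

lemma LR_of {H : SimpleGraph (Fin k)} {P : Fin k → Finset W} {G : SimpleGraph W} {n : ℕ} {d ε : ℝ} 
    (h : InGl H G P n d ε) : LR (hPairs H) (Lset H P G) P (ε * n) d := by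
  obtain ⟨-, hc, -, -, h⟩ := h
  intro a ha U hU V hV h1 h2
  have ha' : H.Adj a.1 a.2 ∧ a.1 < a.2 := by simpa [hPairs] using ha
  have := h a.1 a.2 ha'.1 U hU V hV (by rw [hc]; exact h1) (by rw [hc]; exact h2)
  have e1 : ee (Lset H P G) a U V = edgesBetween G U V := by
    unfold ee edgesBetween
    congr 1
    apply Finset.filter_congr
    intro x hx
    rw [Finset.mem_product] at hx
    rw [mem_Lset]
    exact ⟨fun h => h.2.2.2, fun h => ⟨ha', hU hx.1, hV hx.2, h⟩⟩
  rw [e1]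
  rw [density] at this
  rcases eq_or_lt_of_le (show (0:ℝ) ≤ (U.card : ℝ) * V.card by positivity) with h0 | h0
  · rw [← h0]; simp
  · rwa [le_div_iff₀ h0] at this

lemma restricted_eq {H H' : SimpleGraph (Fin k)} (hH : H' ≤ H) {P : Fin k → Finset W} {G G' : SimpleGraph W} : 
    restrictedCount H G H' G' P = (cop P (hPairs H) (Lset H P G) (hPairs H') (Lset H P G')).card := by
  rw [restrictedCount, ← Set.ncard_coe_finset]
  congr 1
  ext f
  simp only [Set.mem_setOf_eq, Finset.mem_coe, cop, Finset.mem_filter, mem_univ, true_and, mem_Lset, hPairs]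
  constructor
  · rintro ⟨h1, h2, h3⟩
    exact ⟨h1, fun a ha => ⟨ha, h1 _, h1 _, h2 _ _ ha.1⟩, 
      fun a ha => ⟨⟨hH ha.1, ha.2⟩, h1 _, h1 _, h3 _ _ ha.1⟩⟩
  · rintro ⟨h1, h2, h3⟩
    refine ⟨h1, fun i j hij => ?_, fun i j hij => ?_⟩
    · rcases lt_or_gt_of_ne hij.ne with hl | hl
      · exact (h2 (i, j) ⟨hij, hl⟩).2.2.2
      · exact (h2 (j, i) ⟨hij.symm, hl⟩).2.2.2.symm
    · rcases lt_or_gt_of_ne hij.ne with hl | hl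
      · exact (h3 (i, j) ⟨hij, hl⟩).2.2.2
      · exact (h3 (j, i) ⟨hij.symm, hl⟩).2.2.2.symm

lemma prob_eq {H : SimpleGraph (Fin k)} {P : Fin k → Finset W} {G : SimpleGraph W} 
    (hP : ∀ i j, i ≠ j → Disjoint (P i) (P j)) 
    (hG : ∀ u v, G.Adj u v → ∃ i j, H.Adj i j ∧ u ∈ P i ∧ v ∈ P j) (p : ℝ) (Q : SimpleGraph W → Prop) : 
    subgraphProb G p Q = Pr p (fun Γ : Finset (Lab k W) => Q (gr (Γ ∩ Lset H P G))) := by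
  rw [Pr_marginal p (Lset H P G) (fun T => Q (gr T)), subgraphProb, ← Finset.sum_filter]
  have hsub : ∀ G' : SimpleGraph W, G' ≤ G → ∀ u v, G'.Adj u v → ∃ i j, H.Adj i j ∧ u ∈ P i ∧ v ∈ P j := 
    fun G' h u v huv => hG u v (h huv)
  refine Finset.sum_bij' (fun G' _ => Lset H P G') (fun T _ => gr T) ?_ ?_ ?_ ?_ ?_
  · intro G' hG'
    rw [Finset.mem_filter] at hG'
    rw [Finset.mem_filter, Finset.mem_powerset, gr_Lset (hsub G' hG'.2.1)]
    exact ⟨Lset_mono hG'.2.1, hG'.2.2⟩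
  · intro T hT
    rw [Finset.mem_filter, Finset.mem_powerset] at hT
    rw [Finset.mem_filter]
    exact ⟨mem_univ _, gr_le hT.1, hT.2⟩
  · intro G' hG'
    rw [Finset.mem_filter] at hG'
    exact gr_Lset (hsub G' hG'.2.1)
  · intro T hT
    rw [Finset.mem_filter, Finset.mem_powerset] at hT
    exact Lset_gr hP hT.1
  · intro G' hG'
    rw [Finset.mem_filter] at hG'
    rw [edgeCount_Lset hP hG, edgeCount_Lset hP (hsub G' hG'.2.1)]

end trans

/-- Strengthened one-sided counting in random subgraphs (Theorem 2.1). -/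
theorem one_sided_counting_random_subgraphs (k : ℕ) (H H' : SimpleGraph (Fin k))
    (hH' : H' ≤ H) (d : ℝ) (hd : 0 < d) :
    ∃ (ε ξ b C : ℝ) (n₀ : ℕ), 0 < ε ∧ 0 < ξ ∧ 0 < b ∧ 0 < C ∧
      ∀ n : ℕ, n₀ ≤ n → ∀ p : ℝ, 0 ≤ p → p ≤ 1 →
        C * (n : ℝ) ^ (-(1 / twoDensity H)) ≤ p →
        ∀ (W : Type) [Fintype W] [DecidableEq W],
        ∀ (G : SimpleGraph W) (P : Fin k → Finset W),
          InGl H G P n d ε →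
          1 - Real.exp (-(b * p * (n : ℝ) ^ 2)) ≤
            subgraphProb G p (fun Γ =>
              ∀ G' : SimpleGraph W, G' ≤ Γ → InGl H G' P n (d * p) ε →
                ξ * p ^ (edgeCount H') * (n : ℝ) ^ k
                  ≤ (restrictedCount H G H' G' P : ℝ)) := by
  have hF : hPairs H' ⊆ hPairs H := by
    intro a ha
    simp only [hPairs, Finset.mem_filter, mem_univ, true_and] at ha ⊢
    exact ⟨hH' ha.1, ha.2⟩
  obtain ⟨ε, ξ, b, C, hε, hξ, hb, hC, h⟩ := IS_graph H hF d hd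
  refine ⟨ε, ξ, b, C, 1, hε, hξ, hb, hC, ?_⟩
  intro n hn p hp0 hp1 hCp W _ inst G P hG
  have hinst : inst = fun a b => Classical.propDecidable (a = b) := Subsingleton.elim _ _
  subst hinst
  have hn0 : (0:ℝ) < n := by exact_mod_cast hn
  have hp : 0 < p := lt_of_lt_of_le (by positivity) hCp
  have hb2 := h W n p hn hp hp1 hCp P (Lset H P G) hG.2.1 (by
    intro y hy
    simp only [Lset, supp, Finset.mem_filter, mem_univ, true_and] at hy ⊢
    exact ⟨hy.1, hy.2.1, hy.2.2.1⟩) (LR_of hG)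
  rw [prob_eq hG.1 hG.2.2.2.1]
  rw [sub_le_comm, ← Pr_compl]
  rw [mul_assoc b p]
  refine le_trans (Pr_mono hp.le hp1 ?_) hb2
  intro Γ hΓ
  push Not at hΓ
  obtain ⟨G', hle, hin, hlt⟩ := hΓ
  have hsub : Lset H P G' ⊆ Γ ∩ Lset H P G := by
    have := Lset_mono (H := H) (P := P) hle
    rwa [Lset_gr hG.1 Finset.inter_subset_right] at this
  refine ⟨Lset H P G', hsub.trans Finset.inter_subset_left, hsub.trans Finset.inter_subset_right, 
    fun a ha => LR_of hin a (hF ha), ?_⟩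
  rw [← restricted_eq hH', ← edgeCount_eq]
  exact hlt
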